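/- arXiv:2303.14316 — 2 statements merged into one kernel-verified Lean document; each statement's English description precedes it below -/
import Mathlib

section
/- There exist constants c > 0 and c' > 0 such that for all sufficiently large M, #{n ∈ [M, 2M) : G(n) ≥ c·n·(log n)^{1/4}/(log log n)} ≥ c'·M/(log log M)². -/
open Real Filter Finset
open scoped Classical

/-- `n` is a sum of two squares. -/
def IsSumTwoSquares (n : ℕ) : Prop := ∃ x y : ℤ, (n : ℤ) = x ^ 2 + y ^ 2

/-- Indicator function of the sums of two squares. -/
noncomputable def b (n : ℕ) : ℕ := if IsSumTwoSquares n then 1 else 0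

/-- `G n = Σ_{1 ≤ k ≤ (log n)^{5/8}} Σ_{1 ≤ m ≤ n (log n)^{5/8}} b(m)·b(m + nk)`. -/
noncomputable def G (n : ℕ) : ℕ :=
  ∑ k ∈ Finset.Icc 1 ⌊Real.log n ^ ((5:ℝ)/8)⌋₊,
    ∑ m ∈ Finset.Icc 1 ⌊(n : ℝ) * Real.log n ^ ((5:ℝ)/8)⌋₊,
      b m * b (m + n * k)

namespace TwoSquares

open ArithmeticFunction (vonMangoldt)

lemma log_factorial_eq_sum_vonMangoldt (N : ℕ) :
    Real.log (N.factorial : ℝ) = ∑ n ∈ Ioc 0 N, vonMangoldt n * ((N / n : ℕ) : ℝ) := by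
  rw [← ArithmeticFunction.sum_Ioc_mul_zeta_eq_sum, ArithmeticFunction.vonMangoldt_mul_zeta]
  induction N with
  | zero => simp
  | succ k ih =>
    rw [Nat.factorial_succ, Nat.cast_mul, Real.log_mul (by positivity) (by positivity), ih,
      Finset.sum_Ioc_succ_top (by omega)]
    simp [ArithmeticFunction.log_apply, add_comm]

lemma sum_vonMangoldt_le (N : ℕ) : ∑ n ∈ Ioc 0 N, vonMangoldt n ≤ 6 * N := by
  have h := Chebyshev.psi_le_const_mul_self (x := (N : ℝ)) (by positivity)
  rw [Chebyshev.psi, Nat.floor_natCast] at h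
  have h4 : Real.log 4 ≤ 2 := by
    rw [show (4 : ℝ) = 2 ^ 2 by norm_num, Real.log_pow]
    have := Real.log_two_lt_d9
    push_cast
    linarith
  refine h.trans ?_
  gcongr
  linarith

lemma log_factorial_ge (N : ℕ) : N * Real.log N - N ≤ Real.log (N.factorial : ℝ) := by
  rcases Nat.eq_zero_or_pos N with rfl | hN
  · simp
  have h := Stirling.le_log_factorial_stirling (n := N) (by omega)
  have h1 : 0 ≤ Real.log (N : ℝ) := Real.log_natCast_nonneg N
  have h2 : 0 ≤ Real.log (2 * π) := Real.log_nonneg (by nlinarith [Real.pi_gt_three])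
  linarith

lemma log_factorial_le (N : ℕ) : Real.log (N.factorial : ℝ) ≤ N * Real.log N := by
  rw [← Real.log_pow]
  apply Real.log_le_log (by positivity)
  exact_mod_cast Nat.factorial_le_pow N

lemma abs_sum_vonMangoldt_div_sub_log_le {N : ℕ} (hN : 1 ≤ N) :
    |∑ n ∈ Ioc 0 N, vonMangoldt n / n - Real.log N| ≤ 6 := by
  have hN' : (0 : ℝ) < N := by exact_mod_cast hN
  have e := log_factorial_eq_sum_vonMangoldt N
  have up : Real.log (N.factorial : ℝ) ≤ N * ∑ n ∈ Ioc 0 N, vonMangoldt n / n := by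
    rw [e, Finset.mul_sum]
    refine Finset.sum_le_sum fun n _ => ?_
    have := Nat.cast_div_le (α := ℝ) (m := N) (n := n)
    calc vonMangoldt n * ((N / n : ℕ) : ℝ) ≤ vonMangoldt n * ((N : ℝ) / n) := by
          gcongr
      _ = _ := by ring
  have lo : N * ∑ n ∈ Ioc 0 N, vonMangoldt n / n ≤ Real.log (N.factorial : ℝ) + 6 * N := by
    refine le_trans ?_ (add_le_add_right (sum_vonMangoldt_le N) _)
    rw [e, Finset.mul_sum, ← Finset.sum_add_distrib]
    refine Finset.sum_le_sum fun n _ => ?_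
    have : (N : ℝ) / n ≤ ((N / n : ℕ) : ℝ) + 1 := by
      rw [← Nat.floor_div_eq_div (K := ℝ)]
      exact (Nat.lt_floor_add_one _).le
    calc N * (vonMangoldt n / n) = vonMangoldt n * ((N : ℝ) / n) := by ring
      _ ≤ vonMangoldt n * (((N / n : ℕ) : ℝ) + 1) := by
          gcongr
      _ = _ := by ring
  have h1 := log_factorial_ge N
  have h2 := log_factorial_le N
  rw [abs_le]
  constructor
  · have : N * (Real.log N - 1) ≤ N * ∑ n ∈ Ioc 0 N, vonMangoldt n / n := by linarith
    have := le_of_mul_le_mul_left this hN'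
    linarith
  · have : N * ∑ n ∈ Ioc 0 N, vonMangoldt n / n ≤ N * (Real.log N + 6) := by linarith
    have := le_of_mul_le_mul_left this hN'
    linarith

/-- The nontrivial character modulo `4`, as a real function on the naturals. -/
noncomputable def chi (n : ℕ) : ℝ := ((ZMod.χ₄ (n : ZMod 4) : ℤ) : ℝ)

lemma chi_mul (m n : ℕ) : chi (m * n) = chi m * chi n := by
  rw [chi, chi, chi]; push_cast; rw [map_mul]; push_cast; rfl

lemma chi_eq (n : ℕ) : chi n = if n % 2 = 0 then 0 else if n % 4 = 1 then 1 else -1 := by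
  rw [chi, ZMod.χ₄_nat_eq_if_mod_four]
  split_ifs <;> simp

lemma abs_chi_le (n : ℕ) : |chi n| ≤ 1 := by
  rw [chi_eq]
  split_ifs <;> simp

lemma chi_mul_sum_mem {f : ℕ → ℝ} (m : ℕ) : ∀ a : ℕ, a % 2 = 1 →
    (∀ i j, a ≤ i → i ≤ j → f j ≤ f i) → (∀ i, a ≤ i → 0 ≤ f i) →
    0 ≤ chi a * ∑ i ∈ range m, chi (a + i) * f (a + i) ∧
      chi a * ∑ i ∈ range m, chi (a + i) * f (a + i) ≤ f a := by
  induction m using Nat.twoStepInduction with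
  | zero => intro a _ _ h0; simpa using h0 a le_rfl
  | one =>
    intro a ha _ h0
    have : chi a * chi a = 1 := by
      rw [chi_eq]; split_ifs <;> first | omega | norm_num
    simp only [range_one, sum_singleton, add_zero, ← mul_assoc, this, one_mul]
    exact ⟨h0 a le_rfl, le_rfl⟩
  | more n ih _ =>
    intro a ha hf h0
    obtain ⟨h1, h2⟩ := ih (a + 2) (by omega) (fun i j hi => hf i j (by omega))
      (fun i hi => h0 i (by omega))
    have c1 : chi a * chi a = 1 := by
      rw [chi_eq]; split_ifs <;> first | omega | norm_num
    have c2 : chi (a + 1) = 0 := by rw [chi_eq]; simp; omega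
    have c3 : chi (a + 2) = - chi a := by
      rw [chi_eq, chi_eq]; split_ifs <;> first | omega | norm_num
    rw [Finset.sum_range_succ', Finset.sum_range_succ']
    have e : ∀ i, chi (a + (i + 1 + 1)) * f (a + (i + 1 + 1)) =
        chi (a + 2 + i) * f (a + 2 + i) := by
      intro i; rw [show a + (i + 1 + 1) = a + 2 + i by ring]
    simp only [e, zero_add, add_zero, c2, zero_mul]
    rw [c3] at h1 h2
    have key : chi a * (∑ i ∈ range n, chi (a + 2 + i) * f (a + 2 + i) + chi a * f a) =
        f a - (-chi a * ∑ i ∈ range n, chi (a + 2 + i) * f (a + 2 + i)) := by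
      rw [mul_add, ← mul_assoc (chi a) (chi a), c1]; ring
    rw [key]
    have := hf a (a + 2) le_rfl (by omega)
    constructor <;> linarith

lemma abs_sum_chi_mul_le {f : ℕ → ℝ} {a c : ℕ}
    (hf : ∀ i j, a < i → i ≤ j → f j ≤ f i) (h0 : ∀ i, a < i → 0 ≤ f i) :
    |∑ n ∈ Ioc a c, chi n * f n| ≤ f (a + 1) := by
  have odd : ∀ a m : ℕ, a % 2 = 1 →
    (∀ i j, a ≤ i → i ≤ j → f j ≤ f i) → (∀ i, a ≤ i → 0 ≤ f i) →
    |∑ i ∈ range m, chi (a + i) * f (a + i)| ≤ f a := by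
    intro a m ha hf h0
    obtain ⟨h1, h2⟩ := chi_mul_sum_mem m a ha hf h0
    have : |chi a| = 1 := by
      rw [chi_eq]; split_ifs <;> first | omega | norm_num
    rw [← one_mul |_|, ← this, ← abs_mul, abs_of_nonneg h1]
    exact h2
  have e : ∑ n ∈ Ioc a c, chi n * f n =
      ∑ i ∈ range (c - a), chi (a + 1 + i) * f (a + 1 + i) := by
    have h := Finset.sum_Ico_eq_sum_range (fun n => chi n * f n) (a + 1) (c + 1)
    rw [Nat.add_sub_add_right] at h
    rw [← h]
    congr 1
    ext
    simp only [mem_Ioc, mem_Ico]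
    omega
  rw [e]
  rcases Nat.mod_two_eq_zero_or_one (a + 1) with h | h
  · rcases Nat.eq_zero_or_pos (c - a) with h' | h'
    · rw [h']; simpa using h0 (a + 1) (by omega)
    obtain ⟨m, hm⟩ := Nat.exists_eq_add_of_le' h'
    rw [hm, Finset.sum_range_succ']
    have c0 : chi (a + 1 + 0) = 0 := by rw [chi_eq]; simp; omega
    rw [c0, zero_mul, add_zero]
    have e : ∀ i, chi (a + 1 + (i + 1)) * f (a + 1 + (i + 1)) =
        chi (a + 2 + i) * f (a + 2 + i) := by
      intro i; rw [show a + 1 + (i + 1) = a + 2 + i by ring]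
    simp only [e]
    exact (odd (a + 2) m (by omega) (fun i j hi => hf i j (by omega))
      (fun i hi => h0 i (by omega))).trans (hf _ _ (by omega) (by omega))
  · exact odd (a + 1) _ h (fun i j hi => hf i j (by omega)) (fun i hi => h0 i (by omega))

lemma abs_sum_chi_mul_log_div_le (N : ℕ) :
    |∑ n ∈ Ioc 0 N, chi n * (Real.log n / n)| ≤ 3 := by
  have small : |∑ n ∈ Ioc 0 (min N 2), chi n * (Real.log n / n)| ≤ 0 := by
    have : ∑ n ∈ Ioc 0 (min N 2), chi n * (Real.log n / n) = 0 := by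
      apply Finset.sum_eq_zero
      intro n hn
      simp only [mem_Ioc, le_min_iff] at hn
      obtain ⟨h1, h2, h3⟩ := hn
      interval_cases n
      · simp
      · simp [chi_eq]
    rw [this]; simp
  have large : |∑ n ∈ Ioc 2 N, chi n * (Real.log n / n)| ≤ Real.log ((2 + 1 : ℕ) : ℝ) / (2 + 1 : ℕ) := by
    apply abs_sum_chi_mul_le (f := fun n : ℕ => Real.log n / n)
    · intro i j hi hij
      have he : Real.exp 1 ≤ 3 := by linarith [Real.exp_one_lt_d9]
      have h3 : (3 : ℝ) ≤ i := by exact_mod_cast hi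
      exact Real.log_div_self_antitoneOn (by simpa using he.trans h3)
        (by simpa using he.trans (h3.trans (by exact_mod_cast hij))) (by exact_mod_cast hij)
    · intro i _
      exact div_nonneg (Real.log_natCast_nonneg i) (by positivity)
  have h3 : Real.log ((2 + 1 : ℕ) : ℝ) / (2 + 1 : ℕ) ≤ 1 := by
    have := Real.log_le_sub_one_of_pos (x := ((2 + 1 : ℕ) : ℝ)) (by positivity)
    rw [div_le_one (by positivity)]
    linarith
  rcases le_total N 2 with h | h
  · rw [min_eq_left h] at small; linarith
  · rw [min_eq_right h] at small
    rw [← Finset.sum_Ioc_consecutive _ (Nat.zero_le 2) h]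
    refine (abs_add_le _ _).trans ?_
    linarith

lemma abs_sum_chi_div_sub_le {m N : ℕ} (h : m ≤ N) :
    |∑ n ∈ Ioc 0 m, chi n * (1 / (n : ℝ)) - ∑ n ∈ Ioc 0 N, chi n * (1 / (n : ℝ))| ≤
      1 / (m + 1) := by
  rw [← Finset.sum_Ioc_consecutive _ (Nat.zero_le m) h, sub_add_cancel_left, abs_neg]
  have := abs_sum_chi_mul_le (f := fun n : ℕ => 1 / (n : ℝ)) (a := m) (c := N)
    (fun i j hi hij => by
      have : (0 : ℝ) < i := by exact_mod_cast (by omega : 0 < i)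
      exact one_div_le_one_div_of_le this (by exact_mod_cast hij))
    (fun i _ => by positivity)
  simpa using this

lemma sum_chi_div_ge {N : ℕ} (hN : 1 ≤ N) : 1 / 2 ≤ ∑ n ∈ Ioc 0 N, chi n * (1 / (n : ℝ)) := by
  rcases Nat.lt_or_ge N 2 with h | h
  · have : N = 1 := by omega
    subst this
    simp [chi_eq]; norm_num
  · have := abs_sum_chi_div_sub_le h
    have e : ∑ n ∈ Ioc 0 2, chi n * (1 / (n : ℝ)) = 1 := by
      rw [show Ioc 0 2 = {1, 2} by rfl]
      simp [chi_eq]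
    rw [e] at this
    have := (abs_le.mp this).2
    norm_num at this ⊢
    linarith

lemma abs_sum_chi_mul_vonMangoldt_div_le {N : ℕ} (hN : 1 ≤ N) :
    |∑ n ∈ Ioc 0 N, chi n * (vonMangoldt n / n)| ≤ 18 := by
  have hN' : (0 : ℝ) < N := by exact_mod_cast hN
  let f : ArithmeticFunction ℝ := ⟨fun n => chi n * (vonMangoldt n / n), by simp⟩
  let g : ArithmeticFunction ℝ := ⟨fun n => chi n * (1 / n), by simp⟩
  have hfg : ∀ n, (f * g) n = chi n * (Real.log n / n) := by
    intro n
    rw [ArithmeticFunction.mul_apply, ← ArithmeticFunction.log_apply,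
      ← ArithmeticFunction.vonMangoldt_mul_zeta, ArithmeticFunction.mul_apply, Finset.sum_div,
      Finset.mul_sum]
    refine Finset.sum_congr rfl fun x hx => ?_
    obtain ⟨hx1, hx2⟩ := Nat.mem_divisorsAntidiagonal.mp hx
    have h1 : x.1 ≠ 0 := by rintro h; simp [h] at hx1; omega
    have h2 : x.2 ≠ 0 := by rintro h; simp [h] at hx1; omega
    have hh : (n : ℝ) = x.1 * x.2 := by rw [← hx1]; push_cast; ring
    have hz : ((ArithmeticFunction.zeta x.2 : ℕ) : ℝ) = 1 := by
      rw [ArithmeticFunction.zeta_apply_ne h2]; simp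
    simp only [f, g, ArithmeticFunction.coe_mk, ArithmeticFunction.natCoe_apply, hz]
    rw [← hx1, chi_mul]
    push_cast
    field_simp
  set S : ℕ → ℝ := fun m => ∑ n ∈ Ioc 0 m, chi n * (1 / (n : ℝ)) with hS
  have e : ∑ n ∈ Ioc 0 N, chi n * (Real.log n / n) =
      ∑ n ∈ Ioc 0 N, chi n * (vonMangoldt n / n) * S (N / n) := by
    rw [← Finset.sum_congr rfl fun n _ => hfg n, ArithmeticFunction.sum_Ioc_mul_eq_sum_sum]
    rfl
  have hdiff : |∑ n ∈ Ioc 0 N, chi n * (vonMangoldt n / n) * S (N / n) -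
      S N * ∑ n ∈ Ioc 0 N, chi n * (vonMangoldt n / n)| ≤ 6 := by
    rw [Finset.mul_sum, ← Finset.sum_sub_distrib]
    refine (Finset.abs_sum_le_sum_abs _ _).trans ?_
    have : ∀ n ∈ Ioc 0 N, |chi n * (vonMangoldt n / n) * S (N / n) -
        S N * (chi n * (vonMangoldt n / n))| ≤ vonMangoldt n / N := by
      intro n hn
      have hn0 : (0 : ℝ) < n := by exact_mod_cast (mem_Ioc.mp hn).1
      have h1 : |S (N / n) - S N| ≤ n / N := by
        refine (abs_sum_chi_div_sub_le (Nat.div_le_self N n)).trans ?_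
        rw [div_le_div_iff₀ (by positivity) hN', one_mul]
        have := Nat.lt_floor_add_one ((N : ℝ) / n)
        rw [Nat.floor_div_eq_div, div_lt_iff₀ hn0] at this
        linarith
      have hL : 0 ≤ vonMangoldt n := ArithmeticFunction.vonMangoldt_nonneg
      rw [show chi n * (vonMangoldt n / n) * S (N / n) - S N * (chi n * (vonMangoldt n / n)) =
        chi n * (vonMangoldt n / n * (S (N / n) - S N)) by ring, abs_mul, abs_mul,
        abs_of_nonneg (show 0 ≤ vonMangoldt n / n by positivity)]
      calc |chi n| * (vonMangoldt n / n * |S (N / n) - S N|)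
          ≤ 1 * (vonMangoldt n / n * (n / N)) := by
            gcongr
            exact abs_chi_le n
        _ = vonMangoldt n / N := by field_simp
    refine (Finset.sum_le_sum this).trans ?_
    rw [← Finset.sum_div, div_le_iff₀ hN']
    exact sum_vonMangoldt_le N
  have h1 := abs_sum_chi_mul_log_div_le N
  rw [e] at h1
  have h2 := sum_chi_div_ge hN
  have h3 : |S N * ∑ n ∈ Ioc 0 N, chi n * (vonMangoldt n / n)| ≤ 9 := by
    have := abs_sub_abs_le_abs_sub (S N * ∑ n ∈ Ioc 0 N, chi n * (vonMangoldt n / n))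
      (∑ n ∈ Ioc 0 N, chi n * (vonMangoldt n / n) * S (N / n))
    rw [abs_sub_comm] at hdiff
    linarith
  rw [abs_mul, abs_of_nonneg (by linarith : 0 ≤ S N)] at h3
  nlinarith [abs_nonneg (∑ n ∈ Ioc 0 N, chi n * (vonMangoldt n / n))]

lemma exists_sum_nonprime_vonMangoldt_div_le :
    ∃ C : ℝ, 0 ≤ C ∧ ∀ s : Finset ℕ, ∑ n ∈ s, (if n.Prime then 0 else vonMangoldt n) / n ≤ C := by
  have h := ArithmeticFunction.vonMangoldt.summable_residueClass_non_primes_div (0 : ZMod 1)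
  have e : ∀ n : ℕ, ArithmeticFunction.vonMangoldt.residueClass (0 : ZMod 1) n = vonMangoldt n := by
    intro n
    simp [ArithmeticFunction.vonMangoldt.residueClass, Set.indicator, Subsingleton.elim (n : ZMod 1) 0]
  simp only [e] at h
  have h0 : ∀ n : ℕ, 0 ≤ (if n.Prime then 0 else vonMangoldt n) / (n : ℝ) := by
    intro n
    have : 0 ≤ vonMangoldt n := ArithmeticFunction.vonMangoldt_nonneg
    split_ifs <;> positivity
  exact ⟨_, tsum_nonneg h0, fun s => h.sum_le_tsum s fun n _ => h0 n⟩

/-- The primes up to `N` that are congruent to `i` modulo `4`. -/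
noncomputable def primesMod (i N : ℕ) : Finset ℕ :=
  (Ioc 0 N).filter fun p => p.Prime ∧ p % 4 = i

lemma mem_primesMod {i N p : ℕ} : p ∈ primesMod i N ↔ p ≤ N ∧ p.Prime ∧ p % 4 = i := by
  simp only [primesMod, mem_filter, mem_Ioc]
  exact ⟨fun h => ⟨h.1.2, h.2⟩, fun h => ⟨⟨h.2.1.pos, h.1⟩, h.2⟩⟩

lemma exists_abs_sum_primesMod_log_div_sub_le : ∃ C : ℝ, 0 ≤ C ∧ ∀ i : ℕ, (i = 1 ∨ i = 3) →
    ∀ N : ℕ, 1 ≤ N → |∑ p ∈ primesMod i N, Real.log p / p - 1 / 2 * Real.log N| ≤ C := by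
  obtain ⟨C₀, hC₀, hC⟩ := exists_sum_nonprime_vonMangoldt_div_le
  refine ⟨C₀ + 1 + 12, by positivity, fun i hi N hN => ?_⟩
  obtain ⟨s, hs, hsi⟩ : ∃ s : ℝ, |s| ≤ 1 ∧
      ∀ n : ℕ, n % 2 = 1 → (1 + s * chi n) / 2 = if n % 4 = i then 1 else 0 := by
    rcases hi with rfl | rfl
    · refine ⟨1, by simp, fun n hn => ?_⟩
      rw [chi_eq]; split_ifs <;> first | omega | norm_num
    · refine ⟨-1, by simp, fun n hn => ?_⟩
      rw [chi_eq]; split_ifs <;> first | omega | norm_num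
  have hL : ∀ n, 0 ≤ vonMangoldt n := fun n => ArithmeticFunction.vonMangoldt_nonneg
  have key : ∀ n ∈ Ioc 0 N, |(1 + s * chi n) / 2 * (vonMangoldt n / n) -
      (if n.Prime ∧ n % 4 = i then Real.log n / n else 0)| ≤
      (if n.Prime then 0 else vonMangoldt n) / n + (if n = 2 then 1 else 0) := by
    intro n hn
    have hb : |(1 + s * chi n) / 2| ≤ 1 := by
      have := abs_mul s (chi n)
      have h1 : |s * chi n| ≤ 1 := by
        rw [this]; exact mul_le_one₀ hs (abs_nonneg _) (abs_chi_le n)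
      rw [abs_le] at h1 ⊢
      constructor <;> linarith
    by_cases hp : n.Prime
    · rcases hp.eq_two_or_odd with rfl | hodd
      · have : ¬ (2 % 4 = i) := by omega
        have l2 := Real.log_two_lt_d9
        have l2' := Real.log_two_gt_d9
        simp only [hp, this, and_false, if_true, if_false, sub_zero, zero_div, zero_add,
          ArithmeticFunction.vonMangoldt_apply_prime Nat.prime_two]
        rw [abs_mul]
        refine mul_le_one₀ hb (abs_nonneg _) ?_
        rw [abs_of_nonneg (by positivity)]
        push_cast
        linarith
      · have h2 : n ≠ 2 := by rintro rfl; omega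
        rw [hsi n hodd, ArithmeticFunction.vonMangoldt_apply_prime hp]
        by_cases h4 : n % 4 = i <;> simp [hp, h4, h2]
    · have : 0 ≤ (if n = 2 then (1 : ℝ) else 0) := by split_ifs <;> norm_num
      simp only [hp, false_and, if_false, sub_zero]
      rw [abs_mul, abs_of_nonneg (div_nonneg (hL n) (Nat.cast_nonneg n))]
      have := mul_le_of_le_one_left (div_nonneg (hL n) (Nat.cast_nonneg n)) hb
      linarith
  have h2 : ∑ n ∈ Ioc 0 N, (if n = 2 then (1 : ℝ) else 0) ≤ 1 := by
    rw [Finset.sum_ite_eq']; split_ifs <;> norm_num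
  have h1 := (Finset.abs_sum_le_sum_abs _ _).trans (Finset.sum_le_sum key)
  rw [Finset.sum_add_distrib, Finset.sum_sub_distrib, ← Finset.sum_filter] at h1
  change |_ - ∑ p ∈ primesMod i N, Real.log p / p| ≤ _ at h1
  have e : ∑ n ∈ Ioc 0 N, (1 + s * chi n) / 2 * (vonMangoldt n / n) =
      1 / 2 * ∑ n ∈ Ioc 0 N, vonMangoldt n / n +
        s / 2 * ∑ n ∈ Ioc 0 N, chi n * (vonMangoldt n / n) := by
    rw [Finset.mul_sum, Finset.mul_sum, ← Finset.sum_add_distrib]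
    exact Finset.sum_congr rfl fun n _ => by ring
  rw [e] at h1
  have h3 := abs_sum_vonMangoldt_div_sub_log_le hN
  have h4 : |s / 2 * ∑ n ∈ Ioc 0 N, chi n * (vonMangoldt n / n)| ≤ 9 := by
    rw [abs_mul, abs_div]
    have := abs_sum_chi_mul_vonMangoldt_div_le hN
    calc |s| / |(2 : ℝ)| * _ ≤ 1 / |(2 : ℝ)| * 18 := by gcongr
      _ = 9 := by norm_num
  have h5 := hC (Ioc 0 N)
  rw [abs_le] at h1 h3 h4 ⊢
  constructor <;> linarith [h1.1, h1.2, h3.1, h3.2, h4.1, h4.2]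

lemma exists_sum_primesMod_inv_le : ∃ C : ℝ, 0 ≤ C ∧ ∀ i : ℕ, (i = 1 ∨ i = 3) →
    ∀ N : ℕ, 2 ≤ N → ∑ p ∈ primesMod i N, 1 / (p : ℝ) ≤ 1 / 2 * Real.log (Real.log N) + C := by
  obtain ⟨C, hC0, hC⟩ := exists_abs_sum_primesMod_log_div_sub_le
  have l2 := Real.log_two_lt_d9
  have l2' := Real.log_two_gt_d9
  refine ⟨1 / 2 + C / Real.log 2 + (1 / 2) * (- Real.log (Real.log 2)) + 0 +
    C / Real.log 2 + 1, ?_, fun i hi N hN => ?_⟩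
  · have : Real.log (Real.log 2) ≤ 0 := Real.log_nonpos (by linarith) (by linarith)
    have : 0 ≤ C / Real.log 2 := by positivity
    linarith
  set A : ℕ → ℝ := fun N => ∑ p ∈ primesMod i N, Real.log p / p with hA
  have succ : ∀ (f : ℕ → ℝ) (N : ℕ), ∑ p ∈ primesMod i (N + 1), f p =
      ∑ p ∈ primesMod i N, f p + if (N + 1).Prime ∧ (N + 1) % 4 = i then f (N + 1) else 0 := by
    intro f N
    rw [primesMod, Finset.sum_filter, Finset.sum_Ioc_succ_top (by omega), primesMod,
      Finset.sum_filter]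
  have main : ∑ p ∈ primesMod i N, 1 / (p : ℝ) ≤ A N / Real.log N +
      1 / 2 * Real.log (Real.log N) - C / Real.log N +
      ((1 / 2) * (- Real.log (Real.log 2)) + C / Real.log 2 + 1) := by
    induction N, hN using Nat.le_induction with
    | base =>
      have e : ∑ p ∈ primesMod i 2, 1 / (p : ℝ) = 0 := by
        apply Finset.sum_eq_zero
        intro p hp
        rw [mem_primesMod] at hp
        have := hp.2.1.two_le
        omega
      have e' : A 2 = 0 := by
        apply Finset.sum_eq_zero
        intro p hp
        rw [mem_primesMod] at hp
        have := hp.2.1.two_le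
        omega
      rw [e, e', zero_div]
      push_cast
      linarith
    | succ N hN ih =>
      rw [succ, hA]
      dsimp only
      rw [succ]
      change _ ≤ (A N + _) / _ + _ - _ + _
      have hN2 : (2 : ℝ) ≤ N := by exact_mod_cast hN
      have l0 : 0 < Real.log N := Real.log_pos (by linarith)
      have l1 : Real.log N ≤ Real.log ((N + 1 : ℕ) : ℝ) :=
        Real.log_le_log (by linarith) (by push_cast; linarith)
      set u := Real.log N
      set v := Real.log ((N + 1 : ℕ) : ℝ)
      have v0 : 0 < v := by linarith
      have hAN : A N ≤ 1 / 2 * u + C := by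
        have := (abs_le.mp (hC i hi N (by omega))).2
        linarith
      have hll : 1 - u / v ≤ Real.log v - Real.log u := by
        have := Real.log_le_sub_one_of_pos (x := u / v) (by positivity)
        rw [Real.log_div l0.ne' v0.ne'] at this
        linarith
      have hinv : 0 ≤ 1 / u - 1 / v := by
        have := one_div_le_one_div_of_le l0 l1
        linarith
      have step : A N * (1 / u - 1 / v) ≤ 1 / 2 * (Real.log v - Real.log u) + C * (1 / u - 1 / v) := by
        calc A N * (1 / u - 1 / v) ≤ (1 / 2 * u + C) * (1 / u - 1 / v) := by gcongr
          _ = 1 / 2 * (1 - u / v) + C * (1 / u - 1 / v) := by field_simp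
          _ ≤ _ := by gcongr
      have last : (if (N + 1).Prime ∧ (N + 1) % 4 = i then 1 / ((N + 1 : ℕ) : ℝ) else 0) =
          (if (N + 1).Prime ∧ (N + 1) % 4 = i then v / ((N + 1 : ℕ) : ℝ) else 0) / v := by
        split_ifs
        · field_simp
        · simp
      rw [last, add_div]
      have e1 : A N / u = A N * (1 / u) := by ring
      have e2 : A N / v = A N * (1 / v) := by ring
      have e3 : C / u = C * (1 / u) := by ring
      have e4 : C / v = C * (1 / v) := by ring
      rw [e1, e3] at ih
      rw [e2, e4]
      linarith
  have hN2 : (2 : ℝ) ≤ N := by exact_mod_cast hN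
  have l0 : 0 < Real.log N := Real.log_pos (by linarith)
  have l1 : Real.log 2 ≤ Real.log N := Real.log_le_log (by norm_num) hN2
  have hAN : A N ≤ 1 / 2 * Real.log N + C := by
    have := (abs_le.mp (hC i hi N (by omega))).2
    linarith
  have : A N / Real.log N ≤ 1 / 2 + C / Real.log N := by
    rw [div_le_iff₀ l0, add_mul, div_mul_cancel₀ _ l0.ne']
    exact hAN
  have : 0 ≤ C / Real.log 2 := by positivity
  linarith

lemma exists_sum_primesMod_log_ge : ∃ A : ℕ, 1 ≤ A ∧ ∀ N : ℕ, A ≤ N →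
    (N : ℝ) / A ≤ ∑ p ∈ primesMod 1 N, Real.log p := by
  obtain ⟨C, hC0, hC⟩ := exists_abs_sum_primesMod_log_div_sub_le
  refine ⟨⌈Real.exp (4 * C + 2)⌉₊, Nat.one_le_ceil_iff.mpr (Real.exp_pos _), fun N hN => ?_⟩
  set A := ⌈Real.exp (4 * C + 2)⌉₊ with hA
  have hA1 : 1 ≤ A := Nat.one_le_ceil_iff.mpr (Real.exp_pos _)
  have hA0 : (0 : ℝ) < A := by exact_mod_cast hA1
  have hN0 : (0 : ℝ) < N := by exact_mod_cast (by omega : 0 < N)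
  have hlA : 4 * C + 2 ≤ Real.log A := by
    rw [Real.le_log_iff_exp_le hA0]
    exact Nat.le_ceil _
  have hm1 : 1 ≤ N / A := (Nat.one_le_div_iff hA1).mpr hN
  have hlm : Real.log ((N / A : ℕ) : ℝ) ≤ Real.log N - Real.log A := by
    rw [← Real.log_div hN0.ne' hA0.ne']
    exact Real.log_le_log (by exact_mod_cast hm1) Nat.cast_div_le
  have h1 := (abs_le.mp (hC 1 (Or.inl rfl) N (by omega))).1
  have h2 := (abs_le.mp (hC 1 (Or.inl rfl) (N / A) hm1)).2
  have hsub : primesMod 1 (N / A) ⊆ primesMod 1 N := by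
    intro p hp
    rw [mem_primesMod] at hp ⊢
    exact ⟨hp.1.trans (Nat.div_le_self _ _), hp.2⟩
  have h3 := Finset.sum_sdiff (f := fun p : ℕ => Real.log p / p) hsub
  have h4 : ∑ p ∈ primesMod 1 N \ primesMod 1 (N / A), Real.log p / p ≤
      ∑ p ∈ primesMod 1 N \ primesMod 1 (N / A), Real.log p * (A / N) := by
    refine Finset.sum_le_sum fun p hp => ?_
    rw [Finset.mem_sdiff, mem_primesMod, mem_primesMod] at hp
    have hp1 : N / A < p := by
      by_contra hcon
      exact hp.2 ⟨not_lt.mp hcon, hp.1.2⟩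
    have hp0 : (0 : ℝ) < p := by exact_mod_cast hp.1.2.1.pos
    rw [div_eq_mul_one_div]
    refine mul_le_mul_of_nonneg_left ?_ (Real.log_natCast_nonneg p)
    rw [div_le_div_iff₀ hp0 hN0, one_mul]
    have := (Nat.div_lt_iff_lt_mul (by omega)).mp hp1
    have h' : (N : ℝ) < p * A := by exact_mod_cast this
    linarith
  have h5 : ∑ p ∈ primesMod 1 N \ primesMod 1 (N / A), Real.log p * (A / N) ≤
      ∑ p ∈ primesMod 1 N, Real.log p * (A / N) := by
    refine Finset.sum_le_sum_of_subset_of_nonneg Finset.sdiff_subset fun p _ _ => ?_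
    have := Real.log_natCast_nonneg p
    positivity
  rw [← Finset.sum_mul] at h4 h5
  rw [← Finset.sum_mul] at h5
  have h6 : 1 ≤ (∑ p ∈ primesMod 1 N, Real.log p) * (A / N) := by linarith
  rw [mul_div_assoc', le_div_iff₀ hN0] at h6
  rw [div_le_iff₀ hA0]
  linarith

lemma exists_prod_primesMod_le : ∃ C : ℝ, 0 < C ∧ ∀ i : ℕ, (i = 1 ∨ i = 3) →
    ∀ N : ℕ, 2 ≤ N → ∏ p ∈ primesMod i N, (1 + 1 / (p : ℝ)) ≤ C * √(Real.log N) := by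
  obtain ⟨C, -, hC⟩ := exists_sum_primesMod_inv_le
  refine ⟨Real.exp C, Real.exp_pos C, fun i hi N hN => ?_⟩
  have l0 : 0 < Real.log N := Real.log_pos (by exact_mod_cast hN)
  calc ∏ p ∈ primesMod i N, (1 + 1 / (p : ℝ)) ≤ ∏ p ∈ primesMod i N, Real.exp (1 / (p : ℝ)) := by
        refine Finset.prod_le_prod (fun p _ => by positivity) fun p _ => ?_
        rw [add_comm]
        exact Real.add_one_le_exp _
    _ = Real.exp (∑ p ∈ primesMod i N, 1 / (p : ℝ)) := (Real.exp_sum _ _).symm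
    _ ≤ Real.exp (1 / 2 * Real.log (Real.log N) + C) := Real.exp_le_exp.mpr (hC i hi N hN)
    _ = _ := by
        rw [Real.exp_add, mul_comm, Real.sqrt_eq_rpow, Real.rpow_def_of_pos l0,
          mul_comm (1 / 2 : ℝ)]

/-- The sum of `1 / d` over the squarefree `d ≤ w` composed of elements of `P`. -/
noncomputable def recipSum (P : Finset ℕ) (w : ℕ) : ℝ :=
  ∑ A ∈ P.powerset.filter (fun A => ∏ p ∈ A, p ≤ w), ∏ p ∈ A, 1 / (p : ℝ)

lemma recipSum_nonneg (P : Finset ℕ) (w : ℕ) : 0 ≤ recipSum P w :=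
  Finset.sum_nonneg fun _ _ => Finset.prod_nonneg fun _ _ => by positivity

lemma sum_le_sum_of_injection {ι κ : Type*} {s : Finset ι} {t : Finset κ} {f : ι → ℝ} {g : κ → ℝ}
    (e : ι → κ) (he : ∀ i ∈ s, e i ∈ t) (hinj : Set.InjOn e s) (hfg : ∀ i ∈ s, f i ≤ g (e i))
    (hg : ∀ j ∈ t, 0 ≤ g j) : ∑ i ∈ s, f i ≤ ∑ j ∈ t, g j := by
  refine (Finset.sum_le_sum hfg).trans ?_
  rw [← Finset.sum_image (f := g) hinj]
  refine Finset.sum_le_sum_of_subset_of_nonneg ?_ fun j hj _ => hg j hj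
  intro j hj
  obtain ⟨i, hi, rfl⟩ := Finset.mem_image.mp hj
  exact he i hi

lemma sum_inv_sq_le (w : ℕ) : ∑ m ∈ Ioc 0 w, 1 / (m : ℝ) ^ 2 ≤ 2 := by
  have h : ∀ w : ℕ, ∑ m ∈ Ioc 0 (w + 1), 1 / (m : ℝ) ^ 2 ≤ 2 - 1 / ((w : ℝ) + 1) := by
    intro w
    induction w with
    | zero => norm_num
    | succ k ih =>
      rw [Finset.sum_Ioc_succ_top (by omega)]
      have : (1 : ℝ) / ((k + 1 + 1 : ℕ) : ℝ) ^ 2 ≤ 1 / (k + 1) - 1 / (k + 1 + 1) := by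
        rw [div_sub_div _ _ (by positivity) (by positivity),
          div_le_div_iff₀ (by positivity) (by positivity)]
        push_cast
        nlinarith [(Nat.cast_nonneg k : (0 : ℝ) ≤ k)]
      push_cast at this ⊢
      linarith
  cases w with
  | zero => simp
  | succ w =>
    have := h w
    have h0 : (0 : ℝ) ≤ 1 / ((w : ℝ) + 1) := by positivity
    linarith

lemma log_le_recipSum (w : ℕ) :
    Real.log w ≤ 2 * recipSum ((Ioc 0 w).filter Nat.Prime) w := by
  rcases Nat.eq_zero_or_pos w with rfl | hw
  · simpa using recipSum_nonneg _ _
  have h1 : Real.log w ≤ ∑ n ∈ Ioc 0 w, 1 / (n : ℝ) := by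
    have h := log_add_one_le_harmonic w
    have h' : Real.log w ≤ Real.log (w + 1) := Real.log_le_log (by positivity) (by linarith)
    refine (h'.trans (by exact_mod_cast h)).trans (le_of_eq ?_)
    rw [harmonic_eq_sum_Icc]
    push_cast
    simp only [one_div]
    rfl
  refine h1.trans ?_
  have hex : ∀ n : ℕ, ∃ ab : ℕ × ℕ, ab.2 ^ 2 * ab.1 = n ∧ Squarefree ab.1 := by
    intro n
    obtain ⟨a, b, h⟩ := Nat.sq_mul_squarefree n
    exact ⟨(a, b), h⟩
  choose φ hφ hsq using hex
  calc ∑ n ∈ Ioc 0 w, 1 / (n : ℝ) ≤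
      ∑ x ∈ ((((Ioc 0 w).filter Nat.Prime).powerset.filter (fun A => ∏ p ∈ A, p ≤ w)) ×ˢ Ioc 0 w),
        (∏ p ∈ x.1, 1 / (p : ℝ)) * (1 / (x.2 : ℝ) ^ 2) := by
        refine sum_le_sum_of_injection (fun n => ((φ n).1.primeFactors, (φ n).2)) ?_ ?_ ?_ ?_
        · intro n hn
          rw [mem_Ioc] at hn
          have hn' := hφ n
          have ha : (φ n).1 ≠ 0 := by rintro h; rw [h] at hn'; omega
          have hb : (φ n).2 ≠ 0 := by rintro h; rw [h] at hn'; simp at hn'; omega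
          have hale : (φ n).1 ≤ n := by
            conv_rhs => rw [← hn']
            exact Nat.le_mul_of_pos_left _ (by positivity)
          have hble : (φ n).2 ≤ n := by
            have h1 : (φ n).2 ^ 2 ≤ n := by
              conv_rhs => rw [← hn']
              exact Nat.le_mul_of_pos_right _ (by omega)
            exact (Nat.le_self_pow two_ne_zero _).trans h1
          simp only [mem_product, mem_filter, mem_powerset, mem_Ioc]
          refine ⟨⟨fun p hp => ?_, ?_⟩, by omega, by omega⟩
          · have hp' := Nat.prime_of_mem_primeFactors hp
            have := Nat.le_of_mem_primeFactors hp
            simp only [mem_filter, mem_Ioc]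
            exact ⟨⟨hp'.pos, by omega⟩, hp'⟩
          · rw [Nat.prod_primeFactors_of_squarefree (hsq n)]; omega
        · intro n _ m _ h
          simp only [Prod.mk.injEq] at h
          rw [← hφ n, ← hφ m, h.2, ← Nat.prod_primeFactors_of_squarefree (hsq n), h.1,
            Nat.prod_primeFactors_of_squarefree (hsq m)]
        · intro n _
          have hn' := hφ n
          refine le_of_eq ?_
          have : ∏ p ∈ (φ n).1.primeFactors, 1 / (p : ℝ) = 1 / (φ n).1 := by
            rw [Finset.prod_div_distrib, Finset.prod_const_one, ← Nat.cast_prod,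
              Nat.prod_primeFactors_of_squarefree (hsq n)]
          rw [this]
          conv_lhs => rw [← hn']
          push_cast
          rw [one_div_mul_one_div, mul_comm]
        · intro x _
          exact mul_nonneg (Finset.prod_nonneg fun _ _ => by positivity) (by positivity)
    _ = recipSum ((Ioc 0 w).filter Nat.Prime) w * ∑ m ∈ Ioc 0 w, 1 / (m : ℝ) ^ 2 := by
        rw [recipSum, Finset.sum_mul_sum, Finset.sum_product]
    _ ≤ recipSum ((Ioc 0 w).filter Nat.Prime) w * 2 := by
        gcongr
        · exact recipSum_nonneg _ _
        · exact sum_inv_sq_le w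
    _ = _ := by ring

lemma recipSum_le_mul_prod {P Q : Finset ℕ} (hQ : ∀ p ∈ Q, 0 < p) (w : ℕ) :
    recipSum Q w ≤ recipSum P w * ∏ p ∈ Q \ P, (1 + 1 / (p : ℝ)) := by
  rw [Finset.prod_one_add, recipSum, recipSum, Finset.sum_mul_sum, ← Finset.sum_product']
  refine sum_le_sum_of_injection (fun B => (B ∩ P, B \ P)) ?_ ?_ ?_ ?_
  · intro B hB
    simp only [mem_filter, mem_powerset, mem_product] at hB ⊢
    refine ⟨⟨Finset.inter_subset_right, le_trans ?_ hB.2⟩, Finset.sdiff_subset_sdiff hB.1 le_rfl⟩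
    refine Finset.prod_le_prod_of_subset_of_one_le' Finset.inter_subset_left fun p hp _ => ?_
    exact hQ p (hB.1 hp)
  · intro B _ B' _ h
    simp only [Prod.mk.injEq] at h
    rw [← sup_inf_sdiff B P, ← sup_inf_sdiff B' P]
    exact congrArg₂ (· ⊔ ·) h.1 h.2
  · intro B _
    refine le_of_eq ?_
    rw [Finset.prod_inter_mul_prod_sdiff]
  · intro x _
    exact mul_nonneg (Finset.prod_nonneg fun _ _ => by positivity)
      (Finset.prod_nonneg fun _ _ => by positivity)

lemma sum_pairs_union_le (C : Finset ℕ) (s : Finset (Finset ℕ × Finset ℕ)) {h : ℕ → ℝ}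
    (hh : ∀ p, 0 ≤ h p) (hs : ∀ x ∈ s, x.1 ∪ x.2 = C) :
    ∑ x ∈ s, (∏ p ∈ x.1, h p) * ∏ p ∈ x.2, h p ≤ ∏ p ∈ C, (h p * (1 + h p) + h p) := by
  have e : ∏ p ∈ C, (h p * (1 + h p) + h p) =
      ∑ A ∈ C.powerset, ∑ E ∈ A.powerset,
        (∏ p ∈ A, h p) * (∏ p ∈ C \ A, h p) * ∏ p ∈ E, h p := by
    rw [Finset.prod_add]
    refine Finset.sum_congr rfl fun A _ => ?_
    rw [Finset.prod_mul_distrib, Finset.prod_one_add, ← Finset.mul_sum]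
    ring
  rw [e, Finset.sum_sigma']
  refine sum_le_sum_of_injection (fun x => (⟨x.1, x.1 ∩ x.2⟩ : (_ : Finset ℕ) × Finset ℕ))
    ?_ ?_ ?_ ?_
  · intro x hx
    simp only [mem_sigma, mem_powerset]
    exact ⟨by rw [← hs x hx]; exact Finset.subset_union_left, Finset.inter_subset_left⟩
  · intro x hx y hy hxy
    simp only [Sigma.mk.injEq, heq_eq_eq] at hxy
    have h1 : ∀ z ∈ s, z.2 = (C \ z.1) ∪ (z.1 ∩ z.2) := by
      intro z hz
      rw [← hs z hz]
      ext p
      simp only [mem_union, Finset.mem_sdiff, mem_inter]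
      tauto
    refine Prod.ext hxy.1 ?_
    rw [h1 x hx, h1 y hy, hxy.1]
    congr 1
    rw [← hxy.1]
    exact hxy.2.trans (by rw [hxy.1])
  · intro x hx
    refine le_of_eq ?_
    have : x.2 = (C \ x.1) ∪ (x.1 ∩ x.2) := by
      rw [← hs x hx]
      ext p
      simp only [mem_union, Finset.mem_sdiff, mem_inter]
      tauto
    have hd : Disjoint (C \ x.1) (x.1 ∩ x.2) :=
      Finset.disjoint_left.mpr fun p hp hp' =>
        (Finset.mem_sdiff.mp hp).2 (Finset.mem_inter.mp hp').1
    conv_lhs => rw [this, Finset.prod_union hd]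
    ring
  · intro x _
    exact mul_nonneg (mul_nonneg (Finset.prod_nonneg fun _ _ => hh _)
      (Finset.prod_nonneg fun _ _ => hh _)) (Finset.prod_nonneg fun _ _ => hh _)

lemma recipSum_sq_le {P : Finset ℕ} (hP : ∀ p ∈ P, 3 ≤ p) (w : ℕ) :
    recipSum P w ^ 2 ≤ ∑ A ∈ P.powerset.filter (fun A => ∏ p ∈ A, p ≤ w ^ 2),
      ∏ p ∈ A, 2 / ((p : ℝ) - 2) := by
  rw [sq, recipSum, Finset.sum_mul_sum, ← Finset.sum_product']
  have hmaps : ∀ x ∈ (P.powerset.filter (fun A => ∏ p ∈ A, p ≤ w)) ×ˢ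
      (P.powerset.filter (fun A => ∏ p ∈ A, p ≤ w)),
      x.1 ∪ x.2 ∈ P.powerset.filter (fun A => ∏ p ∈ A, p ≤ w ^ 2) := by
    intro x hx
    simp only [mem_product, mem_filter, mem_powerset] at hx ⊢
    refine ⟨Finset.union_subset hx.1.1 hx.2.1, ?_⟩
    rw [sq]
    refine le_trans ?_ (Nat.mul_le_mul hx.1.2 hx.2.2)
    rw [← Finset.prod_union_inter]
    refine Nat.le_mul_of_pos_right _ (Finset.prod_pos fun p hp => ?_)
    have := hP p (hx.1.1 (Finset.mem_inter.mp hp).1)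
    omega
  rw [← Finset.sum_fiberwise_of_maps_to hmaps]
  refine Finset.sum_le_sum fun C hC => ?_
  refine (sum_pairs_union_le C _ (h := fun p => 1 / (p : ℝ)) (fun p => by positivity)
    (fun x hx => (Finset.mem_filter.mp hx).2)).trans ?_
  refine Finset.prod_le_prod (fun p _ => by positivity) fun p hp => ?_
  rw [mem_filter, mem_powerset] at hC
  have h3 : (3 : ℝ) ≤ p := by exact_mod_cast hP p (hC.1 hp)
  have : 1 / (p : ℝ) * (1 + 1 / p) + 1 / p = (2 * p + 1) / (p * p) := by
    field_simp
    ring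
  rw [this, div_le_div_iff₀ (by positivity) (by linarith)]
  nlinarith

/-- `∏_{p ∣ n} (1 + 1/p)`. -/
noncomputable def dedekindRatio (n : ℕ) : ℝ := ∏ p ∈ n.primeFactors, (1 + 1 / (p : ℝ))

lemma one_le_prod_one_add (s : Finset ℕ) : 1 ≤ ∏ p ∈ s, (1 + 1 / (p : ℝ)) := by
  calc (1 : ℝ) = ∏ _p ∈ s, (1 : ℝ) := Finset.prod_const_one.symm
    _ ≤ _ := Finset.prod_le_prod (fun _ _ => zero_le_one) fun p _ =>
      le_add_of_nonneg_right (by positivity)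

lemma prod_one_add_mono {s t : Finset ℕ} (h : s ⊆ t) :
    ∏ p ∈ s, (1 + 1 / (p : ℝ)) ≤ ∏ p ∈ t, (1 + 1 / (p : ℝ)) := by
  rw [← Finset.prod_sdiff h]
  exact le_mul_of_one_le_left (by linarith [one_le_prod_one_add s]) (one_le_prod_one_add _)

lemma prod_one_add_union_le (s t : Finset ℕ) :
    ∏ p ∈ s ∪ t, (1 + 1 / (p : ℝ)) ≤
      (∏ p ∈ s, (1 + 1 / (p : ℝ))) * ∏ p ∈ t, (1 + 1 / (p : ℝ)) := by
  rw [← Finset.prod_union_inter]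
  exact le_mul_of_one_le_right (by linarith [one_le_prod_one_add (s ∪ t)]) (one_le_prod_one_add _)

lemma one_le_dedekindRatio (n : ℕ) : 1 ≤ dedekindRatio n := one_le_prod_one_add _

lemma dedekindRatio_mul_le {m n : ℕ} (hm : m ≠ 0) (hn : n ≠ 0) :
    dedekindRatio (m * n) ≤ dedekindRatio m * dedekindRatio n := by
  rw [dedekindRatio, Nat.primeFactors_mul hm hn]
  exact prod_one_add_union_le _ _

lemma exists_recipSum_primesMod_ge : ∃ c : ℝ, 0 < c ∧ ∀ i : ℕ, (i = 1 ∨ i = 3) → ∀ D : ℕ, D ≠ 0 →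
    ∀ w : ℕ, 2 ≤ w → c * √(Real.log w) ≤
      recipSum ((primesMod i w).filter fun p => ¬ p ∣ D) w * dedekindRatio D := by
  obtain ⟨C, hC0, hC⟩ := exists_prod_primesMod_le
  refine ⟨1 / (3 * C), by positivity, fun i hi D hD w hw => ?_⟩
  have l0 : 0 < Real.log w := Real.log_pos (by exact_mod_cast hw)
  obtain ⟨j, hj, hij⟩ : ∃ j, (j = 1 ∨ j = 3) ∧ (∀ p : ℕ, p % 2 = 1 → p % 4 ≠ i → p % 4 = j) := by
    rcases hi with rfl | rfl
    · exact ⟨3, Or.inr rfl, fun p h1 h2 => by omega⟩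
    · exact ⟨1, Or.inl rfl, fun p h1 h2 => by omega⟩
  set P := (primesMod i w).filter fun p => ¬ p ∣ D
  set Q := (Ioc 0 w).filter Nat.Prime
  have h1 := log_le_recipSum w
  have h2 : recipSum Q w ≤ recipSum P w * ∏ p ∈ Q \ P, (1 + 1 / (p : ℝ)) :=
    recipSum_le_mul_prod (fun p hp => (Finset.mem_filter.mp hp).2.pos) w
  have hsub : Q \ P ⊆ ({2} ∪ primesMod j w) ∪ D.primeFactors := by
    intro p hp
    simp only [P, Q, Finset.mem_sdiff, mem_filter, mem_Ioc, mem_primesMod, not_and, not_not] at hp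
    simp only [mem_union, mem_singleton, mem_primesMod, Nat.mem_primeFactors]
    obtain ⟨⟨hp1, hp2⟩, hp3⟩ := hp
    by_cases hi4 : p % 4 = i
    · exact Or.inr ⟨hp2, hp3 ⟨hp1.2, hp2, hi4⟩, hD⟩
    · left
      rcases hp2.eq_two_or_odd with h | h
      · exact Or.inl h
      · exact Or.inr ⟨hp1.2, hp2, hij p h hi4⟩
  have h3 : ∏ p ∈ Q \ P, (1 + 1 / (p : ℝ)) ≤ (3 / 2 * (C * √(Real.log w))) * dedekindRatio D := by
    refine (prod_one_add_mono hsub).trans ((prod_one_add_union_le _ _).trans ?_)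
    refine mul_le_mul_of_nonneg_right ((prod_one_add_union_le _ _).trans ?_)
      (zero_le_one.trans (one_le_dedekindRatio D))
    rw [Finset.prod_singleton]
    have e : (1 : ℝ) + 1 / ((2 : ℕ) : ℝ) = 3 / 2 := by norm_num
    rw [e]
    exact mul_le_mul_of_nonneg_left (hC j hj w hw) (by norm_num)
  have hP0 := recipSum_nonneg P w
  have h4 : Real.log w ≤ (3 * C * √(Real.log w)) * (recipSum P w * dedekindRatio D) := by
    calc Real.log w ≤ 2 * recipSum Q w := h1
      _ ≤ 2 * (recipSum P w * ((3 / 2 * (C * √(Real.log w))) * dedekindRatio D)) := by gcongr; exact h2.trans (by gcongr)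
      _ = _ := by ring
  have hs : 0 < √(Real.log w) := Real.sqrt_pos.mpr l0
  nth_rw 1 [← Real.mul_self_sqrt l0.le] at h4
  have h5 : √(Real.log w) ≤ 3 * C * (recipSum P w * dedekindRatio D) := by
    refine le_of_mul_le_mul_left ?_ hs
    linarith
  rw [one_div, inv_mul_le_iff₀ (by positivity)]
  exact h5

/-- `n` is positive and all its prime factors are congruent to `1` modulo `4`. -/
def IsSplitProduct (n : ℕ) : Prop := n ≠ 0 ∧ ∀ p : ℕ, p.Prime → p ∣ n → p % 4 = 1

/-- The split products in `[1, N]`. -/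
noncomputable def splitProducts (N : ℕ) : Finset ℕ := (Ioc 0 N).filter IsSplitProduct

lemma mem_splitProducts {N n : ℕ} : n ∈ splitProducts N ↔ n ≤ N ∧ IsSplitProduct n := by
  simp only [splitProducts, Finset.mem_filter, Finset.mem_Ioc]
  constructor
  · rintro ⟨⟨-, h⟩, h'⟩
    exact ⟨h, h'⟩
  · rintro ⟨h, h'⟩
    exact ⟨⟨Nat.pos_of_ne_zero h'.1, h⟩, h'⟩

lemma IsSplitProduct.isSumTwoSquares {n : ℕ} (h : IsSplitProduct n) : IsSumTwoSquares n := by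
  obtain ⟨x, y, hxy⟩ := (Nat.eq_sq_add_sq_iff (n := n)).mpr fun q hq h3 => by
    have := h.2 q (Nat.prime_of_mem_primeFactors hq) (Nat.dvd_of_mem_primeFactors hq)
    omega
  exact ⟨x, y, by exact_mod_cast hxy⟩

lemma IsSplitProduct.mul_prime {m p : ℕ} (hm : IsSplitProduct m) (hp : p.Prime) (h : p % 4 = 1) :
    IsSplitProduct (m * p) := by
  refine ⟨mul_ne_zero hm.1 hp.ne_zero, fun q hq hd => ?_⟩
  rcases (Nat.Prime.dvd_mul hq).mp hd with hd | hd
  · exact hm.2 q hq hd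
  · rwa [(Nat.prime_dvd_prime_iff_eq hq hp).mp hd]

lemma recipSum_le_sum_splitProducts {P : Finset ℕ} (hP : ∀ p ∈ P, p.Prime ∧ p % 4 = 1) (w : ℕ) :
    recipSum P w ≤ ∑ m ∈ splitProducts w, 1 / (m : ℝ) := by
  refine sum_le_sum_of_injection (fun A => ∏ p ∈ A, p) ?_ ?_ ?_ fun j _ => by positivity
  · intro A hA
    rw [Finset.mem_filter, Finset.mem_powerset] at hA
    refine mem_splitProducts.mpr ⟨hA.2, ?_, fun q hq hd => ?_⟩
    · exact Finset.prod_ne_zero_iff.mpr fun p hp => (hP p (hA.1 hp)).1.ne_zero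
    · obtain ⟨p, hp, hqp⟩ := (hq.prime.dvd_finsetProd_iff _).mp hd
      rw [(Nat.prime_dvd_prime_iff_eq hq (hP p (hA.1 hp)).1).mp hqp]
      exact (hP p (hA.1 hp)).2
  · intro A hA B hB h
    have hA' := (Finset.mem_powerset.mp (Finset.mem_filter.mp hA).1)
    have hB' := (Finset.mem_powerset.mp (Finset.mem_filter.mp hB).1)
    rw [← Nat.primeFactors_prod (s := A) fun p hp => (hP p (hA' hp)).1,
      ← Nat.primeFactors_prod (s := B) fun p hp => (hP p (hB' hp)).1]
    exact congrArg _ h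
  · intro A _
    rw [Finset.prod_div_distrib, Finset.prod_const_one, Nat.cast_prod]

lemma sum_log_primeFactors_le {n : ℕ} (hn : n ≠ 0) :
    ∑ p ∈ n.primeFactors, Real.log p ≤ Real.log n := by
  rw [← Real.log_prod fun p hp => by exact_mod_cast (Nat.prime_of_mem_primeFactors hp).ne_zero]
  refine Real.log_le_log ?_ ?_
  · exact Finset.prod_pos fun p hp => by exact_mod_cast (Nat.prime_of_mem_primeFactors hp).pos
  · rw [← Nat.cast_prod]
    exact_mod_cast Nat.le_of_dvd (Nat.pos_of_ne_zero hn) (Nat.prod_primeFactors_dvd n)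

lemma sum_sum_log_le (Y B : ℕ) :
    ∑ m ∈ splitProducts B, ∑ p ∈ primesMod 1 (Y / m), Real.log p ≤
      (splitProducts Y).card * Real.log Y := by
  calc ∑ m ∈ splitProducts B, ∑ p ∈ primesMod 1 (Y / m), Real.log p ≤
      ∑ n ∈ splitProducts Y, ∑ p ∈ n.primeFactors, Real.log p := by
        rw [Finset.sum_sigma', Finset.sum_sigma']
        refine sum_le_sum_of_injection
          (fun x => (⟨x.1 * x.2, x.2⟩ : (_ : ℕ) × ℕ)) ?_ ?_ (fun _ _ => le_rfl)
          fun x _ => Real.log_natCast_nonneg _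
        · rintro ⟨m, p⟩ hx
          simp only [Finset.mem_sigma, mem_splitProducts, mem_primesMod,
            Nat.mem_primeFactors] at hx ⊢
          obtain ⟨⟨-, hm⟩, hp, hp', hp4⟩ := hx
          have h := hm.mul_prime hp' hp4
          refine ⟨⟨?_, h⟩, hp', Dvd.intro_left _ rfl, h.1⟩
          rw [mul_comm]
          exact (Nat.le_div_iff_mul_le (Nat.pos_of_ne_zero hm.1)).mp hp
        · rintro ⟨m, p⟩ hx ⟨m', p'⟩ _ h
          simp only [Finset.coe_sigma, Set.mem_sigma_iff, Finset.mem_coe, mem_primesMod] at hx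
          simp only [Sigma.mk.injEq, heq_eq_eq] at h
          obtain ⟨h1, rfl⟩ := h
          have := Nat.eq_of_mul_eq_mul_right hx.2.2.1.pos h1
          subst this
          rfl
    _ ≤ ∑ n ∈ splitProducts Y, Real.log Y := by
        refine Finset.sum_le_sum fun n hn => ?_
        rw [mem_splitProducts] at hn
        refine (sum_log_primeFactors_le hn.2.1).trans (Real.log_le_log ?_ ?_)
        · exact_mod_cast Nat.pos_of_ne_zero hn.2.1
        · exact_mod_cast hn.1
    _ = _ := by rw [Finset.sum_const, nsmul_eq_mul]

lemma exists_card_splitProducts_ge : ∃ c : ℝ, 0 < c ∧ ∃ Y₀ : ℕ, ∀ Y : ℕ, Y₀ ≤ Y →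
    c * Y ≤ (splitProducts Y).card * √(Real.log Y) := by
  obtain ⟨A, hA1, hA⟩ := exists_sum_primesMod_log_ge
  obtain ⟨c, hc0, hc⟩ := exists_recipSum_primesMod_ge
  refine ⟨c / (4 * A), by positivity, 4 * A ^ 2 + 4, fun Y hY => ?_⟩
  have hA0 : (0 : ℝ) < A := by exact_mod_cast hA1
  have hA1' : (1 : ℝ) ≤ A := by exact_mod_cast hA1
  have hY' : 4 * (A : ℝ) ^ 2 + 4 ≤ Y := by exact_mod_cast hY
  have hY0 : (0 : ℝ) < Y := by nlinarith
  have l0 : 0 < Real.log Y := Real.log_pos (by nlinarith)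
  set w := Y / A with hw
  have half : ∀ m : ℕ, 0 < m → m ≤ Y → (Y : ℝ) / (2 * m) ≤ ((Y / m : ℕ) : ℝ) := by
    intro m hm hmY
    have h1 : 1 ≤ Y / m := (Nat.one_le_div_iff hm).mpr hmY
    have h2 : Y < m * (Y / m + 1) := Nat.lt_mul_div_succ Y hm
    have h3 : Y ≤ 2 * m * (Y / m) := by nlinarith
    rw [div_le_iff₀ (by positivity)]
    calc (Y : ℝ) ≤ ((2 * m * (Y / m) : ℕ) : ℝ) := by exact_mod_cast h3
      _ = _ := by push_cast; ring
  have hwY : √(Y : ℝ) ≤ w := by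
    refine le_trans ?_ (half A hA1 (by nlinarith))
    rw [le_div_iff₀ (by positivity)]
    have : 2 * (A : ℝ) ≤ √Y := Real.le_sqrt_of_sq_le (by nlinarith)
    nlinarith [Real.mul_self_sqrt hY0.le, Real.sqrt_nonneg (Y : ℝ)]
  have hw2 : 2 ≤ w := by
    have : (2 : ℝ) ≤ √Y := Real.le_sqrt_of_sq_le (by nlinarith)
    exact_mod_cast this.trans hwY
  have hlog : 1 / 4 * Real.log Y ≤ Real.log w := by
    have h := Real.log_le_log (by positivity) hwY
    rw [Real.log_sqrt hY0.le] at h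
    linarith
  have hsq : 1 / 2 * √(Real.log Y) ≤ √(Real.log w) := by
    refine Real.le_sqrt_of_sq_le ?_
    rw [mul_pow, Real.sq_sqrt l0.le]
    linarith
  have h1 : c * √(Real.log w) ≤ ∑ m ∈ splitProducts w, 1 / (m : ℝ) := by
    have h := hc 1 (Or.inl rfl) 1 one_ne_zero w hw2
    have e : dedekindRatio 1 = 1 := by simp [dedekindRatio]
    rw [e, mul_one] at h
    refine h.trans (recipSum_le_sum_splitProducts (fun p hp => ?_) w)
    exact (mem_primesMod.mp (Finset.mem_filter.mp hp).1).2
  have h2 : (Y : ℝ) / (2 * A) * ∑ m ∈ splitProducts w, 1 / (m : ℝ) ≤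
      (splitProducts Y).card * Real.log Y := by
    refine le_trans ?_ (sum_sum_log_le Y w)
    rw [Finset.mul_sum]
    refine Finset.sum_le_sum fun m hm => ?_
    rw [mem_splitProducts] at hm
    have hm0 : 0 < m := Nat.pos_of_ne_zero hm.2.1
    have hmA : A ≤ Y / m := by
      rw [Nat.le_div_iff_mul_le hm0, mul_comm]
      exact (Nat.le_div_iff_mul_le hA1).mp hm.1
    refine le_trans ?_ (hA _ hmA)
    rw [le_div_iff₀ hA0]
    refine le_trans (le_of_eq ?_) (half m hm0 (hm.1.trans (Nat.div_le_self _ _)))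
    have : (0 : ℝ) < m := by exact_mod_cast hm0
    field_simp
  have hs : 0 < √(Real.log Y) := Real.sqrt_pos.mpr l0
  refine le_of_mul_le_mul_right ?_ hs
  rw [mul_assoc _ (√_) (√_), Real.mul_self_sqrt l0.le]
  refine le_trans ?_ h2
  calc c / (4 * A) * Y * √(Real.log Y) = Y / (2 * A) * (c * (1 / 2 * √(Real.log Y))) := by
        field_simp
        norm_num
    _ ≤ Y / (2 * A) * ∑ m ∈ splitProducts w, 1 / (m : ℝ) := by
        refine mul_le_mul_of_nonneg_left (le_trans ?_ h1) (by positivity)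
        gcongr

lemma sum_range_mul_eq_of_coprime {a b : ℕ} (hab : a.Coprime b) (ha : 0 < a) (hb : 0 < b)
    {f g : ℕ → ℝ} (hf : Function.Periodic f a) (hg : Function.Periodic g b) :
    ∑ m ∈ range (a * b), f m * g m = (∑ m ∈ range a, f m) * ∑ m ∈ range b, g m := by
  rw [Finset.sum_mul_sum, ← Finset.sum_product']
  refine Finset.sum_bij (fun m _ => (m % a, m % b)) ?_ ?_ ?_ ?_
  · intro m _
    simp only [Finset.mem_product, Finset.mem_range]
    exact ⟨Nat.mod_lt _ ha, Nat.mod_lt _ hb⟩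
  · intro m hm n hn h
    simp only [Prod.mk.injEq] at h
    rw [Finset.mem_range] at hm hn
    exact Nat.ModEq.eq_of_lt_of_lt ((Nat.modEq_and_modEq_iff_modEq_mul hab).mp h) hm hn
  · rintro ⟨i, j⟩ hx
    simp only [Finset.mem_product, Finset.mem_range] at hx
    refine ⟨Nat.chineseRemainder hab i j, ?_, ?_⟩
    · rw [Finset.mem_range]
      exact Nat.chineseRemainder_lt_mul hab i j ha.ne' hb.ne'
    · have h := (Nat.chineseRemainder hab i j).2
      exact Prod.ext (Nat.mod_eq_of_modEq h.1 hx.1) (Nat.mod_eq_of_modEq h.2 hx.2)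
  · intro m _
    simp only
    rw [hf.map_mod_nat, hg.map_mod_nat]

lemma periodic_prod {S : Finset ℕ} {k : ℕ → ℕ → ℝ}
    (hk : ∀ p ∈ S, Function.Periodic (k p) p) :
    Function.Periodic (fun m => ∏ p ∈ S, k p m) (∏ p ∈ S, p) := by
  intro m
  refine Finset.prod_congr rfl fun p hp => ?_
  obtain ⟨c, hc⟩ := Finset.dvd_prod_of_mem (fun p => p) hp
  rw [hc, mul_comm, ← smul_eq_mul]
  exact (hk p hp).nsmul c m

lemma sum_range_prod_prod {S : Finset ℕ} (hS : ∀ p ∈ S, p.Prime) {k : ℕ → ℕ → ℝ}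
    (hk : ∀ p ∈ S, Function.Periodic (k p) p) :
    ∑ m ∈ range (∏ p ∈ S, p), ∏ p ∈ S, k p m = ∏ p ∈ S, ∑ m ∈ range p, k p m := by
  induction S using Finset.induction_on with
  | empty => simp
  | insert p S hp ih =>
    have hS' : ∀ q ∈ S, q.Prime := fun q hq => hS q (Finset.mem_insert_of_mem hq)
    have hk' : ∀ q ∈ S, Function.Periodic (k q) q := fun q hq => hk q (Finset.mem_insert_of_mem hq)
    have hpp := hS p (Finset.mem_insert_self _ _)
    rw [Finset.prod_insert hp, Finset.prod_insert hp, ← ih hS' hk']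
    simp only [Finset.prod_insert hp]
    refine sum_range_mul_eq_of_coprime ?_ hpp.pos (Finset.prod_pos fun q hq => (hS' q hq).pos)
      (hk p (Finset.mem_insert_self _ _)) (periodic_prod hk')
    refine Nat.Coprime.prod_right fun q hq => (Nat.coprime_primes hpp (hS' q hq)).mpr ?_
    rintro rfl
    exact hp hq

lemma sum_range_mul_of_periodic {f : ℕ → ℝ} {q : ℕ} (hf : Function.Periodic f q) (k : ℕ) :
    ∑ m ∈ range (q * k), f m = k * ∑ m ∈ range q, f m := by
  induction k with
  | zero => simp
  | succ k ih =>
    rw [Nat.mul_succ, Finset.sum_range_add, ih]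
    have : ∀ x, f (q * k + x) = f x := fun x => by
      rw [add_comm, mul_comm, ← smul_eq_mul]
      exact hf.nsmul k x
    simp only [this]
    push_cast
    ring

lemma sum_range_le_of_periodic_nonneg {f : ℕ → ℝ} {q : ℕ} (hf : Function.Periodic f q)
    (hq : 0 < q) (h0 : ∀ m, 0 ≤ f m) (N : ℕ) :
    ∑ m ∈ range N, f m ≤ (N / q + 1) * ∑ m ∈ range q, f m := by
  calc ∑ m ∈ range N, f m ≤ ∑ m ∈ range (q * (N / q + 1)), f m :=
        Finset.sum_le_sum_of_subset_of_nonneg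
          (Finset.range_subset_range.mpr (Nat.lt_mul_div_succ N hq).le) fun m _ _ => h0 m
    _ = ((N / q : ℕ) + 1) * ∑ m ∈ range q, f m := by
        rw [sum_range_mul_of_periodic hf]
        push_cast
        rfl
    _ ≤ _ := by
        gcongr
        · exact Finset.sum_nonneg fun m _ => h0 m
        · exact Nat.cast_div_le

lemma sum_range_le_of_periodic_sum_zero {f : ℕ → ℝ} {q : ℕ} (hf : Function.Periodic f q)
    (hq : 0 < q) (h0 : ∑ m ∈ range q, f m = 0) {B : ℝ} (hB0 : 0 ≤ B) (hB : ∀ m, f m ≤ B) (N : ℕ) :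
    ∑ m ∈ range N, f m ≤ q * B := by
  conv_lhs => rw [← Nat.div_add_mod N q]
  rw [Finset.sum_range_add, sum_range_mul_of_periodic hf, h0, mul_zero, zero_add]
  refine (Finset.sum_le_sum fun m _ => hB _).trans ?_
  rw [Finset.sum_const, Finset.card_range, nsmul_eq_mul]
  gcongr
  exact (Nat.mod_lt _ hq).le

/-- The mean-zero function modulo `p` which is `1` away from the two residue classes `0`, `-D`. -/
noncomputable def localWeight (D p m : ℕ) : ℝ :=
  1 - p / 2 * if p ∣ m ∨ p ∣ m + D then 1 else 0

lemma localWeight_periodic (D p : ℕ) : Function.Periodic (localWeight D p) p := by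
  intro m
  have : (p ∣ m + p ∨ p ∣ m + p + D) ↔ (p ∣ m ∨ p ∣ m + D) := by
    rw [add_right_comm, Nat.dvd_add_self_right, Nat.dvd_add_self_right]
  simp only [localWeight, this]

lemma abs_localWeight_le (D m : ℕ) {p : ℕ} (hp : 1 ≤ p) : |localWeight D p m| ≤ p := by
  have h1 : (1 : ℝ) ≤ p := by exact_mod_cast hp
  rw [localWeight, abs_le]
  split_ifs <;> constructor <;> linarith

lemma card_filter_dvd_or_dvd {D p : ℕ} (hp : 0 < p) (hD : ¬ p ∣ D) :
    ((range p).filter fun m => p ∣ m ∨ p ∣ m + D).card = 2 := by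
  have h0 : 0 < D % p := Nat.pos_of_ne_zero fun h => hD (Nat.dvd_of_mod_eq_zero h)
  have hlt : D % p < p := Nat.mod_lt _ hp
  have hdm := Nat.div_add_mod D p
  have e : ((range p).filter fun m => p ∣ m ∨ p ∣ m + D) = {0, p - D % p} := by
    ext m
    simp only [Finset.mem_filter, Finset.mem_range, Finset.mem_insert, Finset.mem_singleton]
    constructor
    · rintro ⟨hm, h | h⟩
      · exact Or.inl (Nat.eq_zero_of_dvd_of_lt h hm)
      · right
        have h' : p ∣ m + D % p := by
          rw [← hdm, add_comm (p * _), ← add_assoc] at h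
          exact (Nat.dvd_add_iff_left (Dvd.intro _ rfl)).mpr h
        obtain ⟨k, hk⟩ := h'
        have hk1 : k = 1 := by
          have : k < 2 := by
            by_contra hk2
            have : p * 2 ≤ p * k := Nat.mul_le_mul_left _ (by omega)
            omega
          have : k ≠ 0 := by
            rintro rfl
            omega
          omega
        subst hk1
        omega
    · rintro (rfl | rfl)
      · exact ⟨hp, Or.inl (dvd_zero _)⟩
      · refine ⟨by omega, Or.inr ⟨D / p + 1, ?_⟩⟩
        rw [Nat.mul_succ]
        omega
  rw [e, Finset.card_pair (by omega)]

lemma sum_localWeight {D p : ℕ} (hp : 0 < p) (hD : ¬ p ∣ D) :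
    ∑ m ∈ range p, localWeight D p m = 0 := by
  simp only [localWeight]
  rw [Finset.sum_sub_distrib, ← Finset.mul_sum, Finset.sum_boole, card_filter_dvd_or_dvd hp hD]
  simp

lemma sum_localWeight_sq {D p : ℕ} (hp : 0 < p) (hD : ¬ p ∣ D) :
    ∑ m ∈ range p, localWeight D p m * localWeight D p m = p * ((p - 2) / 2) := by
  have : ∀ m, localWeight D p m * localWeight D p m =
      1 - (p - p ^ 2 / 4) * if p ∣ m ∨ p ∣ m + D then 1 else 0 := by
    intro m
    rw [localWeight]
    split_ifs <;> ring
  simp only [this]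
  rw [Finset.sum_sub_distrib, ← Finset.mul_sum, Finset.sum_boole, card_filter_dvd_or_dvd hp hD]
  simp
  ring

/-- The product of the local weights over `A`. -/
noncomputable def sieveWeight (D : ℕ) (A : Finset ℕ) (m : ℕ) : ℝ := ∏ p ∈ A, localWeight D p m

lemma abs_sieveWeight_le (D m : ℕ) {A : Finset ℕ} (hA : ∀ p ∈ A, 1 ≤ p) :
    |sieveWeight D A m| ≤ (∏ p ∈ A, p : ℕ) := by
  rw [sieveWeight, Finset.abs_prod, Nat.cast_prod]
  exact Finset.prod_le_prod (fun _ _ => abs_nonneg _) fun p hp => abs_localWeight_le D m (hA p hp)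

lemma sum_sieveWeight_sq_le {D : ℕ} {A : Finset ℕ} (hA : ∀ p ∈ A, p.Prime ∧ 3 ≤ p ∧ ¬ p ∣ D)
    {Q : ℕ} (hQ : ∏ p ∈ A, p ≤ Q) (N : ℕ) :
    (∏ p ∈ A, 2 / ((p : ℝ) - 2)) * ∑ m ∈ range N, sieveWeight D A m * sieveWeight D A m ≤
      N + Q := by
  have hq : 0 < ∏ p ∈ A, p := Finset.prod_pos fun p hp => (hA p hp).1.pos
  have hper : Function.Periodic (fun m => sieveWeight D A m * sieveWeight D A m) (∏ p ∈ A, p) :=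
    (periodic_prod fun p _ => localWeight_periodic D p).mul
      (periodic_prod fun p _ => localWeight_periodic D p)
  have hs : ∑ m ∈ range (∏ p ∈ A, p), sieveWeight D A m * sieveWeight D A m =
      ∏ p ∈ A, ((p : ℝ) * ((p - 2) / 2)) := by
    simp only [sieveWeight, ← Finset.prod_mul_distrib]
    rw [sum_range_prod_prod (fun p hp => (hA p hp).1)
      (k := fun p m => localWeight D p m * localWeight D p m)
      fun p _ => (localWeight_periodic D p).mul (localWeight_periodic D p)]
    exact Finset.prod_congr rfl fun p hp => sum_localWeight_sq (hA p hp).1.pos (hA p hp).2.2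
  have h := sum_range_le_of_periodic_nonneg hper hq (fun m => mul_self_nonneg _) N
  rw [hs] at h
  have hpos : ∀ p ∈ A, (0 : ℝ) < p - 2 := fun p hp => by
    have : (3 : ℝ) ≤ p := by exact_mod_cast (hA p hp).2.1
    linarith
  have hinv : (∏ p ∈ A, 2 / ((p : ℝ) - 2)) * ∏ p ∈ A, ((p : ℝ) * ((p - 2) / 2)) =
      ((∏ p ∈ A, p : ℕ) : ℝ) := by
    rw [← Finset.prod_mul_distrib, Nat.cast_prod]
    refine Finset.prod_congr rfl fun p hp => ?_
    have := (hpos p hp).ne'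
    field_simp
  have hq' : (0 : ℝ) < ((∏ p ∈ A, p : ℕ) : ℝ) := by exact_mod_cast hq
  calc _ ≤ (∏ p ∈ A, 2 / ((p : ℝ) - 2)) * ((N / ((∏ p ∈ A, p : ℕ) : ℝ) + 1) *
        ∏ p ∈ A, ((p : ℝ) * ((p - 2) / 2))) :=
        mul_le_mul_of_nonneg_left h (Finset.prod_nonneg fun p hp => by
          have := hpos p hp
          positivity)
    _ = (N / ((∏ p ∈ A, p : ℕ) : ℝ) + 1) * ((∏ p ∈ A, p : ℕ) : ℝ) := by rw [← hinv]; ring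
    _ = N + ((∏ p ∈ A, p : ℕ) : ℝ) := by field_simp
    _ ≤ N + Q := by gcongr

lemma sum_sieveWeight_mul_le {D : ℕ} {A B : Finset ℕ} (hA : ∀ p ∈ A, p.Prime ∧ 3 ≤ p ∧ ¬ p ∣ D)
    (hB : ∀ p ∈ B, p.Prime ∧ 3 ≤ p ∧ ¬ p ∣ D) (hAB : A ≠ B)
    {Q : ℕ} (hAQ : ∏ p ∈ A, p ≤ Q) (hBQ : ∏ p ∈ B, p ≤ Q) (N : ℕ) :
    ∑ m ∈ range N, sieveWeight D A m * sieveWeight D B m ≤ Q ^ 4 := by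
  set k : ℕ → ℕ → ℝ := fun p m => (if p ∈ A then localWeight D p m else 1) *
    if p ∈ B then localWeight D p m else 1 with hk
  have hC : ∀ p ∈ A ∪ B, p.Prime ∧ 3 ≤ p ∧ ¬ p ∣ D := fun p hp =>
    (Finset.mem_union.mp hp).elim (hA p) (hB p)
  have hkper : ∀ p ∈ A ∪ B, Function.Periodic (k p) p := by
    intro p _ m
    simp only [hk, localWeight_periodic D p m]
  have hfun : ∀ m, sieveWeight D A m * sieveWeight D B m = ∏ p ∈ A ∪ B, k p m := by
    intro m
    simp only [hk, Finset.prod_mul_distrib, Finset.prod_ite_mem, sieveWeight,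
      Finset.inter_eq_right.mpr (Finset.subset_union_left : A ⊆ A ∪ B),
      Finset.inter_eq_right.mpr (Finset.subset_union_right : B ⊆ A ∪ B)]
  have hzero : ∑ m ∈ range (∏ p ∈ A ∪ B, p), ∏ p ∈ A ∪ B, k p m = 0 := by
    rw [sum_range_prod_prod (fun p hp => (hC p hp).1) hkper]
    obtain ⟨p, hp⟩ : ∃ p, ¬ (p ∈ A ↔ p ∈ B) := by
      by_contra h
      push Not at h
      exact hAB (Finset.ext h)
    have hpC : p ∈ A ∪ B := by
      rw [Finset.mem_union]
      tauto
    refine Finset.prod_eq_zero hpC ?_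
    rw [← sum_localWeight (hC p hpC).1.pos (hC p hpC).2.2]
    refine Finset.sum_congr rfl fun m _ => ?_
    by_cases h : p ∈ A
    · have h' : p ∉ B := fun h' => hp ⟨fun _ => h', fun _ => h⟩
      simp only [hk, h, h', if_true, if_false, mul_one]
    · have h' : p ∈ B := by
        rw [Finset.mem_union] at hpC
        tauto
      simp only [hk, h, h', if_true, if_false, one_mul]
  have hqpos : 0 < ∏ p ∈ A ∪ B, p := Finset.prod_pos fun p hp => (hC p hp).1.pos
  have hq : ∏ p ∈ A ∪ B, p ≤ Q ^ 2 := by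
    calc ∏ p ∈ A ∪ B, p ≤ (∏ p ∈ A ∪ B, p) * ∏ p ∈ A ∩ B, p :=
          Nat.le_mul_of_pos_right _ (Finset.prod_pos fun p hp =>
            (hA p (Finset.mem_inter.mp hp).1).1.pos)
      _ = (∏ p ∈ A, p) * ∏ p ∈ B, p := Finset.prod_union_inter
      _ ≤ Q * Q := Nat.mul_le_mul hAQ hBQ
      _ = Q ^ 2 := (sq Q).symm
  have hbd : ∀ m, ∏ p ∈ A ∪ B, k p m ≤ (Q : ℝ) ^ 2 := by
    intro m
    rw [← hfun]
    refine (le_abs_self _).trans ?_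
    rw [abs_mul, sq]
    have h1 := abs_sieveWeight_le D m (A := A) fun p hp => (hA p hp).1.one_le
    have h2 := abs_sieveWeight_le D m (A := B) fun p hp => (hB p hp).1.one_le
    exact mul_le_mul (h1.trans (by exact_mod_cast hAQ)) (h2.trans (by exact_mod_cast hBQ))
      (abs_nonneg _) (Nat.cast_nonneg _)
  simp only [hfun]
  refine (sum_range_le_of_periodic_sum_zero (periodic_prod hkper) hqpos hzero
    (by positivity) hbd N).trans ?_
  calc ((∏ p ∈ A ∪ B, p : ℕ) : ℝ) * (Q : ℝ) ^ 2 ≤ (Q : ℝ) ^ 2 * (Q : ℝ) ^ 2 := by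
        gcongr
        exact_mod_cast hq
    _ = (Q : ℝ) ^ 4 := by ring

/-- Selberg's upper bound sieve for the pairs `m, m + D` free of prime factors from `P`. -/
lemma card_sifted_mul_le {D : ℕ} {P : Finset ℕ} (hP : ∀ p ∈ P, p.Prime ∧ 3 ≤ p ∧ ¬ p ∣ D)
    {Q : ℕ} {J : ℝ} (hJ : J = ∑ A ∈ P.powerset.filter (fun A => ∏ p ∈ A, p ≤ Q),
      ∏ p ∈ A, 2 / ((p : ℝ) - 2)) (N : ℕ) :
    (((range N).filter fun m => ∀ p ∈ P, ¬ (p ∣ m ∨ p ∣ m + D)).card : ℝ) * J ^ 2 ≤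
      (N + Q) * J + Q ^ 4 * J ^ 2 := by
  set 𝒟 := P.powerset.filter fun A => ∏ p ∈ A, p ≤ Q with h𝒟
  set g : Finset ℕ → ℝ := fun A => ∏ p ∈ A, 2 / ((p : ℝ) - 2) with hg
  have hmem : ∀ A ∈ 𝒟, (∀ p ∈ A, p.Prime ∧ 3 ≤ p ∧ ¬ p ∣ D) ∧ ∏ p ∈ A, p ≤ Q := by
    intro A hA
    rw [h𝒟, Finset.mem_filter, Finset.mem_powerset] at hA
    exact ⟨fun p hp => hP p (hA.1 hp), hA.2⟩
  have hg0 : ∀ A ∈ 𝒟, 0 ≤ g A := by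
    intro A hA
    refine Finset.prod_nonneg fun p hp => ?_
    have : (3 : ℝ) ≤ p := by exact_mod_cast ((hmem A hA).1 p hp).2.1
    exact div_nonneg zero_le_two (by linarith)
  set F : ℕ → ℝ := fun m => ∑ A ∈ 𝒟, g A * sieveWeight D A m with hF
  have hF1 : ∀ m, (∀ p ∈ P, ¬ (p ∣ m ∨ p ∣ m + D)) → F m = J := by
    intro m hm
    rw [hJ, hF]
    refine Finset.sum_congr rfl fun A hA => ?_
    have : sieveWeight D A m = 1 := by
      refine Finset.prod_eq_one fun p hp => ?_
      rw [h𝒟, Finset.mem_filter, Finset.mem_powerset] at hA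
      rw [localWeight, if_neg (hm p (hA.1 hp))]
      ring
    rw [this, mul_one]
  calc (((range N).filter fun m => ∀ p ∈ P, ¬ (p ∣ m ∨ p ∣ m + D)).card : ℝ) * J ^ 2
      = ∑ m ∈ (range N).filter fun m => ∀ p ∈ P, ¬ (p ∣ m ∨ p ∣ m + D), F m ^ 2 := by
        rw [← nsmul_eq_mul, ← Finset.sum_const]
        refine Finset.sum_congr rfl fun m hm => ?_
        rw [hF1 m (Finset.mem_filter.mp hm).2]
    _ ≤ ∑ m ∈ range N, F m ^ 2 :=
        Finset.sum_le_sum_of_subset_of_nonneg (Finset.filter_subset _ _) fun m _ _ => sq_nonneg _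
    _ = ∑ A ∈ 𝒟, ∑ B ∈ 𝒟, g A * g B * ∑ m ∈ range N, sieveWeight D A m * sieveWeight D B m := by
        simp only [hF, sq, Finset.sum_mul_sum]
        simp only [Finset.mul_sum]
        rw [Finset.sum_comm]
        refine Finset.sum_congr rfl fun A _ => ?_
        rw [Finset.sum_comm]
        refine Finset.sum_congr rfl fun B _ => Finset.sum_congr rfl fun m _ => ?_
        ring
    _ ≤ ∑ A ∈ 𝒟, ∑ B ∈ 𝒟, ((if A = B then g A * (N + Q) else 0) + g A * g B * Q ^ 4) := by
        refine Finset.sum_le_sum fun A hA => Finset.sum_le_sum fun B hB => ?_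
        have hAB : 0 ≤ g A * g B := mul_nonneg (hg0 A hA) (hg0 B hB)
        by_cases h : A = B
        · subst h
          rw [if_pos rfl]
          have h1 := sum_sieveWeight_sq_le (hmem A hA).1 (hmem A hA).2 N
          have h2 := mul_le_mul_of_nonneg_left h1 (hg0 A hA)
          have h3 : 0 ≤ g A * g A * (Q : ℝ) ^ 4 := by positivity
          rw [mul_assoc (g A)]
          linarith
        · rw [if_neg h, zero_add]
          exact mul_le_mul_of_nonneg_left (sum_sieveWeight_mul_le (hmem A hA).1 (hmem B hB).1 h
            (hmem A hA).2 (hmem B hB).2 N) hAB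
    _ = (N + Q) * J + Q ^ 4 * J ^ 2 := by
        simp only [Finset.sum_add_distrib]
        congr 1
        · rw [hJ, Finset.mul_sum]
          refine Finset.sum_congr rfl fun A hA => ?_
          rw [Finset.sum_ite_eq, if_pos hA, mul_comm]
        · simp only [← Finset.sum_mul, ← Finset.sum_mul_sum]
          rw [← hJ]
          ring

/-- The number of `m ≤ Y` such that `m` and `m + D` are both split products. -/
noncomputable def pairCount (Y D : ℕ) : ℕ :=
  ((splitProducts Y).filter fun m => IsSplitProduct (m + D)).card

lemma exists_pow_le_lt_succ_pow {k Y : ℕ} (hk : k ≠ 0) :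
    ∃ w : ℕ, w ^ k ≤ Y ∧ Y < (w + 1) ^ k := by
  refine ⟨Nat.findGreatest (fun w => w ^ k ≤ Y) Y, ?_, ?_⟩
  · exact Nat.findGreatest_spec (P := fun w => w ^ k ≤ Y) (Nat.zero_le _) (by simp [hk])
  · by_contra h
    rw [not_lt] at h
    have h1 := Nat.le_findGreatest (P := fun w => w ^ k ≤ Y)
      ((Nat.le_self_pow hk _).trans h) h
    omega

lemma exists_pow_le_and_log_le {Y : ℕ} (hY : 2 ^ 16 ≤ Y) : ∃ w : ℕ, 2 ≤ w ∧
    (∀ k ≤ 16, (w : ℝ) ^ k ≤ Y) ∧ Real.log Y ≤ 32 * Real.log w := by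
  obtain ⟨w, hw1, hw2⟩ := exists_pow_le_lt_succ_pow (k := 16) (Y := Y) (by norm_num)
  have hw : 2 ≤ w := by
    by_contra h
    have : (w + 1) ^ 16 ≤ 2 ^ 16 := Nat.pow_le_pow_left (by omega) 16
    omega
  have hYpos : 0 < Y := lt_of_lt_of_le (by norm_num) hY
  clear hY
  refine ⟨w, hw, fun k hk => ?_, ?_⟩
  · have h : w ^ k ≤ Y := (Nat.pow_le_pow_right (by omega) hk).trans hw1
    exact_mod_cast h
  have hsq : w + 1 ≤ w ^ 2 := by
    clear hw1 hw2
    nlinarith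
  have h1 : Y ≤ w ^ 32 := by
    refine hw2.le.trans ?_
    calc (w + 1) ^ 16 ≤ (w ^ 2) ^ 16 := Nat.pow_le_pow_left hsq 16
      _ = w ^ 32 := by rw [← pow_mul]
  calc Real.log Y ≤ Real.log ((w : ℝ) ^ 32) :=
        Real.log_le_log (by exact_mod_cast hYpos) (by exact_mod_cast h1)
    _ = 32 * Real.log w := by rw [Real.log_pow]; norm_num

lemma exists_pairCount_mul_log_le : ∃ C : ℝ, 0 < C ∧ ∃ Y₀ : ℕ, ∀ Y : ℕ, Y₀ ≤ Y → ∀ D : ℕ, D ≠ 0 →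
    pairCount Y D * Real.log Y ≤ C * Y * dedekindRatio D ^ 2 := by
  obtain ⟨c, hc0, hc⟩ := exists_recipSum_primesMod_ge
  refine ⟨32 * (3 / c ^ 2 + 1), by positivity, 2 ^ 16, fun Y hY D hD => ?_⟩
  have hY1 : (1 : ℝ) ≤ Y := by exact_mod_cast le_trans (Nat.one_le_pow _ _ (by norm_num)) hY
  obtain ⟨w, hw, hwY, hlog⟩ := exists_pow_le_and_log_le hY
  clear hY
  have hwr : (2 : ℝ) ≤ w := by exact_mod_cast hw
  have lw0 : 0 < Real.log w := Real.log_pos (by linarith)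
  set P := (primesMod 3 w).filter fun p => ¬ p ∣ D with hPdef
  have hP : ∀ p ∈ P, p.Prime ∧ 3 ≤ p ∧ ¬ p ∣ D := by
    intro p hp
    rw [hPdef, Finset.mem_filter, mem_primesMod] at hp
    obtain ⟨⟨-, h1, h2⟩, h3⟩ := hp
    exact ⟨h1, by omega, h3⟩
  set J := ∑ A ∈ P.powerset.filter (fun A => ∏ p ∈ A, p ≤ w ^ 2), ∏ p ∈ A, 2 / ((p : ℝ) - 2)
    with hJ
  have hs := card_sifted_mul_le hP hJ (Y + 1)
  set S := (range (Y + 1)).filter fun m => ∀ p ∈ P, ¬ (p ∣ m ∨ p ∣ m + D)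
  have hcard : (pairCount Y D : ℝ) ≤ S.card := by
    refine Nat.cast_le.mpr (Finset.card_le_card fun m hm => ?_)
    rw [Finset.mem_filter, mem_splitProducts] at hm
    rw [Finset.mem_filter, Finset.mem_range]
    refine ⟨by omega, fun p hp h => ?_⟩
    rw [hPdef, Finset.mem_filter, mem_primesMod] at hp
    have : p % 4 = 1 := h.elim (hm.1.2.2 p hp.1.2.1) (hm.2.2 p hp.1.2.1)
    omega
  set R := dedekindRatio D with hR
  have hR1 : 1 ≤ R := one_le_dedekindRatio D
  have hrec : c * √(Real.log w) ≤ recipSum P w * R := hc 3 (Or.inr rfl) D hD w hw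
  have hJge : c ^ 2 * Real.log w ≤ J * R ^ 2 := by
    calc c ^ 2 * Real.log w = (c * √(Real.log w)) ^ 2 := by rw [mul_pow, Real.sq_sqrt lw0.le]
      _ ≤ (recipSum P w * R) ^ 2 := pow_le_pow_left₀ (by positivity) hrec 2
      _ = recipSum P w ^ 2 * R ^ 2 := mul_pow _ _ _
      _ ≤ J * R ^ 2 := by
          gcongr
          exact recipSum_sq_le (fun p hp => (hP p hp).2.1) w
  have hJ0 : 0 < J := by
    have : 0 < J * R ^ 2 := lt_of_lt_of_le (by positivity) hJge
    exact pos_of_mul_pos_left this (by positivity)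
  have h1 : (S.card : ℝ) * J ≤ (Y + 1 + (w : ℝ) ^ 2) + (w : ℝ) ^ 8 * J := by
    refine le_of_mul_le_mul_right ?_ hJ0
    push_cast at hs
    linear_combination hs
  have h2 : (S.card : ℝ) * Real.log w ≤ (3 / c ^ 2 + 1) * Y * R ^ 2 := by
    have h3 : ((S.card : ℝ) - (w : ℝ) ^ 8) * J ≤ 3 * Y := by
      have := hwY 2 (by norm_num)
      linarith
    have h4 : (w : ℝ) ^ 8 * Real.log w ≤ Y * R ^ 2 := by
      calc (w : ℝ) ^ 8 * Real.log w ≤ (w : ℝ) ^ 8 * w := by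
            gcongr
            exact Real.log_le_self (by positivity)
        _ = (w : ℝ) ^ 9 := by ring
        _ ≤ Y := hwY 9 (by norm_num)
        _ ≤ Y * R ^ 2 := le_mul_of_one_le_right (by positivity) (one_le_pow₀ hR1)
    rcases le_or_gt (S.card : ℝ) ((w : ℝ) ^ 8) with h | h
    · have h5 : (S.card : ℝ) * Real.log w ≤ (w : ℝ) ^ 8 * Real.log w := by gcongr
      have h6 : 0 ≤ 3 / c ^ 2 * (Y * R ^ 2) := by positivity
      linarith
    · have h5 : ((S.card : ℝ) - (w : ℝ) ^ 8) * (c ^ 2 * Real.log w) ≤ 3 * Y * R ^ 2 := by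
        calc _ ≤ ((S.card : ℝ) - (w : ℝ) ^ 8) * (J * R ^ 2) :=
              mul_le_mul_of_nonneg_left hJge (by linarith)
          _ = ((S.card : ℝ) - (w : ℝ) ^ 8) * J * R ^ 2 := by ring
          _ ≤ _ := by gcongr
      have h6 : ((S.card : ℝ) - (w : ℝ) ^ 8) * Real.log w ≤ 3 / c ^ 2 * (Y * R ^ 2) := by
        rw [div_mul_eq_mul_div, le_div_iff₀ (by positivity)]
        linarith
      linarith
  calc (pairCount Y D : ℝ) * Real.log Y ≤ S.card * (32 * Real.log w) :=
        mul_le_mul hcard hlog (Real.log_natCast_nonneg _) (Nat.cast_nonneg _)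
    _ = 32 * (S.card * Real.log w) := by ring
    _ ≤ 32 * ((3 / c ^ 2 + 1) * Y * R ^ 2) := by gcongr
    _ = _ := by ring

lemma dedekindRatio_le_sum_divisors {n : ℕ} (hn : n ≠ 0) :
    dedekindRatio n ≤ ∑ d ∈ n.divisors, (d : ℝ) ^ (-1 : ℝ) := by
  rw [dedekindRatio, Finset.prod_one_add]
  refine sum_le_sum_of_injection (fun A => ∏ p ∈ A, p) ?_ ?_ ?_ fun _ _ => by positivity
  · intro A hA
    rw [Finset.mem_powerset] at hA
    exact Nat.mem_divisors.mpr ⟨(Finset.prod_dvd_prod_of_subset _ _ _ hA).trans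
      (Nat.prod_primeFactors_dvd n), hn⟩
  · intro A hA B hB h
    have hA' := Finset.mem_powerset.mp hA
    have hB' := Finset.mem_powerset.mp hB
    rw [← Nat.primeFactors_prod (s := A) fun p hp => Nat.prime_of_mem_primeFactors (hA' hp),
      ← Nat.primeFactors_prod (s := B) fun p hp => Nat.prime_of_mem_primeFactors (hB' hp)]
    exact congrArg _ h
  · intro A _
    rw [Finset.prod_div_distrib, Finset.prod_const_one, Nat.cast_prod, Real.rpow_neg_one, one_div]

lemma sq_sum_rpow_le (S : Finset ℕ) (hS : ∀ d ∈ S, 0 < d) (s : ℝ) :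
    (∑ d ∈ S, (d : ℝ) ^ s) ^ 2 ≤
      (∑' d : ℕ, (d : ℝ) ^ (-(5 / 4) : ℝ)) * ∑ d ∈ S, (d : ℝ) ^ (2 * s + 5 / 4) := by
  have h := Finset.sum_mul_sq_le_sq_mul_sq S (fun d : ℕ => (d : ℝ) ^ (-(5 / 8) : ℝ))
    (fun d : ℕ => (d : ℝ) ^ (s + 5 / 8))
  have e1 : ∑ d ∈ S, (d : ℝ) ^ (-(5 / 8) : ℝ) * (d : ℝ) ^ (s + 5 / 8) = ∑ d ∈ S, (d : ℝ) ^ s := by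
    refine Finset.sum_congr rfl fun d hd => ?_
    rw [← Real.rpow_add (by exact_mod_cast hS d hd)]
    congr 1
    ring
  have e2 : ∀ t : ℝ, ∑ d ∈ S, ((d : ℝ) ^ t) ^ 2 = ∑ d ∈ S, (d : ℝ) ^ (2 * t) := by
    intro t
    refine Finset.sum_congr rfl fun d _ => ?_
    rw [mul_comm 2 t, Real.rpow_mul (Nat.cast_nonneg _)]
    norm_cast
  rw [e1, e2, e2] at h
  refine h.trans ?_
  have e3 : (2 : ℝ) * (s + 5 / 8) = 2 * s + 5 / 4 := by ring
  have e4 : (2 : ℝ) * -(5 / 8) = -(5 / 4) := by norm_num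
  rw [e3, e4]
  refine mul_le_mul_of_nonneg_right ?_ (Finset.sum_nonneg fun _ _ => by positivity)
  exact Summable.sum_le_tsum _ (fun _ _ => by positivity)
    (Real.summable_nat_rpow.mpr (by norm_num))

lemma sum_sum_divisors_le {f : ℕ → ℝ} (hf : ∀ d, 0 ≤ f d) (N : ℕ) :
    ∑ n ∈ Ioc 0 N, ∑ d ∈ n.divisors, f d ≤ N * ∑ d ∈ Ioc 0 N, f d / d := by
  calc ∑ n ∈ Ioc 0 N, ∑ d ∈ n.divisors, f d
      ≤ ∑ n ∈ Ioc 0 N, ∑ d ∈ Ioc 0 N, if d ∣ n then f d else 0 := by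
        refine Finset.sum_le_sum fun n hn => ?_
        rw [← Finset.sum_filter]
        rw [Finset.mem_Ioc] at hn
        refine Finset.sum_le_sum_of_subset_of_nonneg (fun d hd => ?_) fun d _ _ => hf d
        rw [Nat.mem_divisors] at hd
        rw [Finset.mem_filter, Finset.mem_Ioc]
        exact ⟨⟨Nat.pos_of_dvd_of_pos hd.1 hn.1, (Nat.le_of_dvd hn.1 hd.1).trans hn.2⟩, hd.1⟩
    _ = ∑ d ∈ Ioc 0 N, ((N / d : ℕ) : ℝ) * f d := by
        rw [Finset.sum_comm]
        refine Finset.sum_congr rfl fun d _ => ?_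
        rw [← Finset.sum_filter, Finset.sum_const, Nat.Ioc_filter_dvd_card_eq_div, nsmul_eq_mul]
    _ ≤ ∑ d ∈ Ioc 0 N, (N : ℝ) / d * f d :=
        Finset.sum_le_sum fun d _ => mul_le_mul_of_nonneg_right Nat.cast_div_le (hf d)
    _ = _ := by
        rw [Finset.mul_sum]
        exact Finset.sum_congr rfl fun d _ => by ring

lemma exists_sum_dedekindRatio_pow_four_le : ∃ C : ℝ, 0 < C ∧ ∀ N : ℕ,
    ∑ n ∈ Ioc 0 N, dedekindRatio n ^ 4 ≤ C * N := by
  set Z := ∑' d : ℕ, (d : ℝ) ^ (-(5 / 4) : ℝ) with hZ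
  have hsum : Summable fun d : ℕ => (d : ℝ) ^ (-(5 / 4) : ℝ) :=
    Real.summable_nat_rpow.mpr (by norm_num)
  have hZ0 : 0 ≤ Z := tsum_nonneg fun _ => by positivity
  refine ⟨Z ^ 4 + 1, by positivity, fun N => ?_⟩
  have hpt : ∀ n ∈ Ioc 0 N, dedekindRatio n ^ 4 ≤
      Z ^ 3 * ∑ d ∈ n.divisors, (d : ℝ) ^ (-(1 / 4) : ℝ) := by
    intro n hn
    rw [Finset.mem_Ioc] at hn
    have hd : ∀ d ∈ n.divisors, 0 < d := fun d hd => Nat.pos_of_mem_divisors hd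
    have h1 := dedekindRatio_le_sum_divisors hn.1.ne'
    have h2 := sq_sum_rpow_le n.divisors hd (-1)
    have h3 := sq_sum_rpow_le n.divisors hd (-(3 / 4))
    have e1 : (2 : ℝ) * -1 + 5 / 4 = -(3 / 4) := by norm_num
    have e2 : (2 : ℝ) * -(3 / 4) + 5 / 4 = -(1 / 4) := by norm_num
    rw [e1] at h2
    rw [e2] at h3
    calc dedekindRatio n ^ 4 ≤ (∑ d ∈ n.divisors, (d : ℝ) ^ (-1 : ℝ)) ^ 4 :=
          pow_le_pow_left₀ (zero_le_one.trans (one_le_dedekindRatio n)) h1 4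
      _ = ((∑ d ∈ n.divisors, (d : ℝ) ^ (-1 : ℝ)) ^ 2) ^ 2 := by ring
      _ ≤ (Z * ∑ d ∈ n.divisors, (d : ℝ) ^ (-(3 / 4) : ℝ)) ^ 2 :=
          pow_le_pow_left₀ (sq_nonneg _) h2 2
      _ = Z ^ 2 * (∑ d ∈ n.divisors, (d : ℝ) ^ (-(3 / 4) : ℝ)) ^ 2 := mul_pow _ _ _
      _ ≤ Z ^ 2 * (Z * ∑ d ∈ n.divisors, (d : ℝ) ^ (-(1 / 4) : ℝ)) := by gcongr
      _ = _ := by ring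
  calc ∑ n ∈ Ioc 0 N, dedekindRatio n ^ 4
      ≤ Z ^ 3 * ∑ n ∈ Ioc 0 N, ∑ d ∈ n.divisors, (d : ℝ) ^ (-(1 / 4) : ℝ) := by
        rw [Finset.mul_sum]
        exact Finset.sum_le_sum hpt
    _ ≤ Z ^ 3 * (N * ∑ d ∈ Ioc 0 N, (d : ℝ) ^ (-(1 / 4) : ℝ) / d) := by
        gcongr
        exact sum_sum_divisors_le (fun _ => by positivity) N
    _ ≤ Z ^ 3 * (N * Z) := by
        gcongr
        refine le_trans (le_of_eq (Finset.sum_congr rfl fun d hd => ?_))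
          (Summable.sum_le_tsum (Ioc 0 N) (fun _ _ => by positivity) hsum)
        have hd0 : (0 : ℝ) < d := by exact_mod_cast (Finset.mem_Ioc.mp hd).1
        nth_rw 2 [← Real.rpow_one (d : ℝ)]
        rw [← Real.rpow_sub hd0]
        norm_num
    _ ≤ (Z ^ 4 + 1) * N := by
        have : (0 : ℝ) ≤ N := Nat.cast_nonneg N
        nlinarith

lemma exists_sum_dedekindRatio_sq_le : ∃ C : ℝ, 0 < C ∧ ∀ N : ℕ,
    ∑ n ∈ Ioc 0 N, dedekindRatio n ^ 2 ≤ C * N := by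
  obtain ⟨C, hC0, hC⟩ := exists_sum_dedekindRatio_pow_four_le
  exact ⟨C, hC0, fun N => (Finset.sum_le_sum fun n _ =>
    pow_le_pow_right₀ (one_le_dedekindRatio n) (by norm_num)).trans (hC N)⟩

lemma card_sq_le_mul_card_modEq (T : Finset ℕ) {k : ℕ} (hk : 0 < k) :
    T.card ^ 2 ≤ k * ((T ×ˢ T).filter fun x => x.1 % k = x.2 % k).card := by
  have h1 : T.card = ∑ c ∈ range k, (T.filter fun m => m % k = c).card :=
    Finset.card_eq_sum_card_fiberwise fun m _ => by simpa using Nat.mod_lt m hk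
  have h2 : ((T ×ˢ T).filter fun x => x.1 % k = x.2 % k).card =
      ∑ c ∈ range k, (T.filter fun m => m % k = c).card ^ 2 := by
    rw [Finset.card_eq_sum_card_fiberwise (t := range k) (f := fun x : ℕ × ℕ => x.1 % k)
      fun x _ => by simpa using Nat.mod_lt x.1 hk]
    refine Finset.sum_congr rfl fun c _ => ?_
    rw [sq, ← Finset.card_product]
    congr 1
    ext x
    simp only [Finset.mem_filter, Finset.mem_product]
    constructor
    · rintro ⟨⟨⟨h1, h2⟩, h3⟩, h4⟩
      exact ⟨⟨h1, h4⟩, h2, h3 ▸ h4⟩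
    · rintro ⟨⟨h1, h2⟩, h3, h4⟩
      exact ⟨⟨⟨h1, h3⟩, h2.trans h4.symm⟩, h2⟩
  rw [h2]
  conv_lhs => rw [h1]
  have := sq_sum_le_card_mul_sum_sq (s := range k) (f := fun c => (T.filter fun m => m % k = c).card)
  rwa [Finset.card_range] at this

lemma card_modEq_le (T : Finset ℕ) (k : ℕ) :
    ((T ×ˢ T).filter fun x => x.1 % k = x.2 % k).card ≤
      T.card + 2 * ((T ×ˢ T).filter fun x => x.1 < x.2 ∧ x.1 % k = x.2 % k).card := by
  set E := (T ×ˢ T).filter fun x => x.1 < x.2 ∧ x.1 % k = x.2 % k with hE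
  have hsub : ((T ×ˢ T).filter fun x => x.1 % k = x.2 % k) ⊆
      (T.image fun m => (m, m)) ∪ (E ∪ E.image Prod.swap) := by
    rintro ⟨m, n⟩ h
    simp only [hE, Finset.mem_filter, Finset.mem_product, Finset.mem_union, Finset.mem_image,
      Prod.exists, Prod.swap_prod_mk, Prod.mk.injEq] at h ⊢
    obtain ⟨⟨h1, h2⟩, h3⟩ := h
    rcases lt_trichotomy m n with h | h | h
    · exact Or.inr (Or.inl ⟨⟨h1, h2⟩, h, h3⟩)
    · exact Or.inl ⟨m, h1, rfl, h⟩
    · exact Or.inr (Or.inr ⟨n, m, ⟨⟨h2, h1⟩, h, h3.symm⟩, rfl, rfl⟩)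
  refine (Finset.card_le_card hsub).trans ((Finset.card_union_le _ _).trans ?_)
  have h1 : (T.image fun m => (m, m)).card ≤ T.card := Finset.card_image_le
  have h2 : (E ∪ E.image Prod.swap).card ≤ E.card + (E.image Prod.swap).card :=
    Finset.card_union_le _ _
  have h3 : (E.image Prod.swap).card ≤ E.card := Finset.card_image_le
  omega

lemma card_lt_modEq_le_sum_pairCount {Y k M : ℕ} (hY : Y < k * (2 * M)) :
    (((splitProducts Y) ×ˢ (splitProducts Y)).filter
      fun x => x.1 < x.2 ∧ x.1 % k = x.2 % k).card ≤ ∑ n ∈ Ico 1 (2 * M), pairCount Y (n * k) := by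
  simp only [pairCount]
  rw [← Finset.card_sigma]
  have key : ∀ x : ℕ × ℕ, x.1 < x.2 ∧ x.1 % k = x.2 % k → x.1 + (x.2 - x.1) / k * k = x.2 := by
    intro x hx
    rw [Nat.div_mul_cancel ((Nat.modEq_iff_dvd' hx.1.le).mp hx.2)]
    omega
  refine Finset.card_le_card_of_injOn (fun x => (⟨(x.2 - x.1) / k, x.1⟩ : (_ : ℕ) × ℕ)) ?_ ?_
  · intro x hx
    simp only [Finset.coe_filter, Finset.mem_product, mem_splitProducts, Set.mem_ofPred_eq] at hx
    obtain ⟨⟨h1, h2⟩, h3⟩ := hx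
    have hxk := key x h3
    simp only [Finset.coe_sigma, Set.mem_sigma_iff, Finset.mem_coe, Finset.mem_Ico,
      Finset.mem_filter, mem_splitProducts]
    refine ⟨⟨?_, ?_⟩, h1, by rw [hxk]; exact h2.2⟩
    · by_contra h
      have : (x.2 - x.1) / k = 0 := Nat.lt_one_iff.mp (not_le.mp h)
      rw [this] at hxk
      omega
    · refine Nat.div_lt_of_lt_mul ?_
      omega
  · intro x hx y hy h
    simp only [Finset.coe_filter, Set.mem_ofPred_eq] at hx hy
    simp only [Sigma.mk.injEq, heq_eq_eq] at h
    have h1 := key x hx.2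
    have h2 := key y hy.2
    refine Prod.ext h.2 ?_
    rw [← h1, ← h2, h.1, h.2]

lemma card_sq_le_sum_pairCount {Y k M : ℕ} (hk : 0 < k) (hY : Y < k * (2 * M))
    (hT : 2 * k ≤ (splitProducts Y).card) :
    (splitProducts Y).card ^ 2 ≤ 4 * k * ∑ n ∈ Ico 1 (2 * M), pairCount Y (n * k) := by
  have h1 := card_sq_le_mul_card_modEq (splitProducts Y) hk
  have h2 := card_modEq_le (splitProducts Y) k
  have h3 := card_lt_modEq_le_sum_pairCount hY
  have h4 : k * ((splitProducts Y ×ˢ splitProducts Y).filter fun x => x.1 % k = x.2 % k).card ≤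
      k * ((splitProducts Y).card + 2 * ∑ n ∈ Ico 1 (2 * M), pairCount Y (n * k)) :=
    Nat.mul_le_mul_left _ (by omega)
  nlinarith

lemma sum_pairCount_dyadic_le (Y M J K : ℕ) :
    ∑ k ∈ Ioc 0 K, ∑ n ∈ (Ico 1 (2 * M)).filter (fun n => M ≤ n * 2 ^ J),
        pairCount Y (n * (2 ^ J * k)) ≤
      (J + 1) * ∑ N ∈ Ico M (2 * M), ∑ κ ∈ Ioc 0 (2 ^ J * K), pairCount Y (N * κ) := by
  have hex : ∀ n : ℕ, ∃ j, 1 ≤ n → n < 2 * M → M ≤ n * 2 ^ J →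
      j ≤ J ∧ M ≤ n * 2 ^ j ∧ n * 2 ^ j < 2 * M := by
    intro n
    by_cases h : M ≤ n * 2 ^ J
    · have hP : ∃ j, M ≤ n * 2 ^ j := ⟨J, h⟩
      refine ⟨Nat.find hP, fun h1 h2 _ => ⟨Nat.find_min' hP h, Nat.find_spec hP, ?_⟩⟩
      rcases hj : Nat.find hP with _ | i
      · simpa using h2
      · have := Nat.find_min hP (m := i) (by omega)
        rw [not_le] at this
        rw [pow_succ, ← mul_assoc]
        omega
    · exact ⟨0, fun _ _ h' => absurd h' h⟩
  choose j hj using hex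
  have e : (J + 1) * ∑ N ∈ Ico M (2 * M), ∑ κ ∈ Ioc 0 (2 ^ J * K), pairCount Y (N * κ) =
      ∑ x ∈ range (J + 1) ×ˢ (Ico M (2 * M) ×ˢ Ioc 0 (2 ^ J * K)), pairCount Y (x.2.1 * x.2.2) := by
    rw [Finset.sum_product]
    simp only [Finset.sum_const, Finset.card_range, smul_eq_mul, Finset.sum_product]
  rw [e, ← Finset.sum_product']
  have hcast := sum_le_sum_of_injection
    (s := Ioc 0 K ×ˢ ((Ico 1 (2 * M)).filter fun n => M ≤ n * 2 ^ J))
    (t := range (J + 1) ×ˢ (Ico M (2 * M) ×ˢ Ioc 0 (2 ^ J * K)))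
    (f := fun x => (pairCount Y (x.2 * (2 ^ J * x.1)) : ℝ))
    (g := fun x => (pairCount Y (x.2.1 * x.2.2) : ℝ))
    (fun x => (j x.2, x.2 * 2 ^ j x.2, 2 ^ (J - j x.2) * x.1)) ?_ ?_ ?_ ?_
  · exact_mod_cast hcast
  · rintro ⟨k, n⟩ hx
    simp only [Finset.mem_product, Finset.mem_Ioc, Finset.mem_filter, Finset.mem_Ico,
      Finset.mem_range] at hx ⊢
    obtain ⟨⟨hk0, hkK⟩, ⟨hn1, hn2⟩, hn3⟩ := hx
    obtain ⟨h1, h2, h3⟩ := hj n hn1 hn2 hn3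
    exact ⟨by omega, ⟨h2, h3⟩, by positivity,
      Nat.mul_le_mul (Nat.pow_le_pow_right (by norm_num) (by omega)) hkK⟩
  · rintro ⟨k, n⟩ _ ⟨k', n'⟩ _ h
    simp only [Prod.mk.injEq] at h
    obtain ⟨h1, h2, h3⟩ := h
    rw [h1] at h2 h3
    have hn := Nat.eq_of_mul_eq_mul_right (by positivity) h2
    have hk := Nat.eq_of_mul_eq_mul_left (by positivity) h3
    rw [hn, hk]
  · rintro ⟨k, n⟩ hx
    simp only [Finset.mem_product, Finset.mem_Ioc, Finset.mem_filter, Finset.mem_Ico] at hx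
    obtain ⟨⟨hk0, hkK⟩, ⟨hn1, hn2⟩, hn3⟩ := hx
    obtain ⟨h1, h2, h3⟩ := hj n hn1 hn2 hn3
    have : n * (2 ^ J * k) = n * 2 ^ j n * (2 ^ (J - j n) * k) := by
      have h : 2 ^ J = 2 ^ j n * 2 ^ (J - j n) := by rw [← pow_add]; congr 1; omega
      rw [h]
      ring
    simp only [this]
    exact le_rfl
  · intro x _
    exact Nat.cast_nonneg _

lemma dedekindRatio_two_pow_le (J : ℕ) : dedekindRatio (2 ^ J) ≤ 3 / 2 := by
  have : (2 ^ J).primeFactors ⊆ {2} := by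
    intro p hp
    rw [Nat.mem_primeFactors] at hp
    rw [Finset.mem_singleton]
    exact (Nat.prime_dvd_prime_iff_eq hp.1 Nat.prime_two).mp (hp.1.dvd_of_dvd_pow hp.2.1)
  refine (prod_one_add_mono this).trans ?_
  norm_num

lemma sum_pairCount_mul_log_le {C₁ C₂ : ℝ} (hC₁ : 0 < C₁)
    (hC₂ : ∀ N : ℕ, ∑ n ∈ Ioc 0 N, dedekindRatio n ^ 2 ≤ C₂ * N) {Y : ℕ}
    (hY : ∀ D : ℕ, D ≠ 0 → pairCount Y D * Real.log Y ≤ C₁ * Y * dedekindRatio D ^ 2)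
    {k : ℕ} (hk : k ≠ 0) (R : ℕ) :
    (∑ n ∈ Ioc 0 R, (pairCount Y (n * k) : ℝ)) * Real.log Y ≤
      C₁ * Y * dedekindRatio k ^ 2 * (C₂ * R) := by
  calc (∑ n ∈ Ioc 0 R, (pairCount Y (n * k) : ℝ)) * Real.log Y
      ≤ ∑ n ∈ Ioc 0 R, C₁ * Y * dedekindRatio k ^ 2 * dedekindRatio n ^ 2 := by
        rw [Finset.sum_mul]
        refine Finset.sum_le_sum fun n hn => ?_
        have hn0 : n ≠ 0 := (Finset.mem_Ioc.mp hn).1.ne'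
        refine (hY _ (mul_ne_zero hn0 hk)).trans ?_
        rw [mul_assoc (C₁ * Y), mul_comm (dedekindRatio k ^ 2), ← mul_pow]
        gcongr
        · exact zero_le_one.trans (one_le_dedekindRatio _)
        · exact dedekindRatio_mul_le hn0 hk
    _ ≤ _ := by
        rw [← Finset.mul_sum]
        gcongr
        exact hC₂ R

lemma exists_sum_pairCount_ge : ∃ c₀ c₁ : ℝ, 0 < c₀ ∧ 0 < c₁ ∧ ∃ B Y₀ : ℕ, 1 ≤ B ∧
    ∀ K M Y : ℕ, 1 ≤ K → 1 ≤ M → Y = B * K * M → Y₀ ≤ Y → 2 * √(Real.log Y) ≤ c₀ * M →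
    c₁ * K * Y * M ≤
      (∑ N ∈ Ico M (2 * M), ∑ κ ∈ Ioc 0 (B * K), (pairCount Y (N * κ) : ℝ)) * Real.log Y := by
  obtain ⟨c₀, hc₀, Y₁, hcard⟩ := exists_card_splitProducts_ge
  obtain ⟨C₁, hC₁, Y₂, hpair⟩ := exists_pairCount_mul_log_le
  obtain ⟨C₂, hC₂0, hC₂⟩ := exists_sum_dedekindRatio_sq_le
  obtain ⟨J, hJ⟩ := pow_unbounded_of_one_lt (36 * C₁ * C₂ ^ 2 / c₀ ^ 2) (one_lt_two : (1 : ℝ) < 2)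
  refine ⟨c₀, c₀ ^ 2 / (16 * (J + 1)), hc₀, by positivity, 2 ^ J, max (max Y₁ Y₂) 3,
    Nat.one_le_two_pow, fun K M Y hK hM hYdef hY hM' => ?_⟩
  have hY1 : Y₁ ≤ Y := ((le_max_left _ _).trans (le_max_left _ _)).trans hY
  have hY2 : Y₂ ≤ Y := ((le_max_right _ _).trans (le_max_left _ _)).trans hY
  have hY3 : 3 ≤ Y := (le_max_right _ _).trans hY
  clear hY
  have hY0 : (0 : ℝ) < Y := by exact_mod_cast (by omega : 0 < Y)
  have hM0 : (0 : ℝ) < M := by exact_mod_cast hM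
  have hK0 : (0 : ℝ) < K := by exact_mod_cast hK
  have l0 : 0 < Real.log Y := Real.log_pos (by exact_mod_cast (by omega : 1 < Y))
  have hs0 : 0 < √(Real.log Y) := Real.sqrt_pos.mpr l0
  set t : ℝ := ((splitProducts Y).card : ℝ) with ht
  have ht1 : c₀ * Y ≤ t * √(Real.log Y) := hcard Y hY1
  have hYr : (Y : ℝ) = 2 ^ J * K * M := by
    rw [hYdef]
    push_cast
    ring
  have ht2 : 2 * (2 ^ J * K : ℝ) ≤ t := by
    refine le_of_mul_le_mul_right (le_trans ?_ ht1) hs0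
    calc 2 * (2 ^ J * K : ℝ) * √(Real.log Y) = (2 ^ J * K) * (2 * √(Real.log Y)) := by ring
      _ ≤ (2 ^ J * K) * (c₀ * M) := by gcongr
      _ = c₀ * Y := by rw [hYr]; ring
  have ht3 : c₀ ^ 2 * Y ^ 2 ≤ t ^ 2 * Real.log Y := by
    have h := pow_le_pow_left₀ (by positivity) ht1 2
    rwa [mul_pow, mul_pow, Real.sq_sqrt l0.le] at h
  have hmain : ∀ k ∈ Ioc (K / 2) K, c₀ ^ 2 / 4 * Y * M ≤
      (∑ n ∈ Ico 1 (2 * M), (pairCount Y (n * (2 ^ J * k)) : ℝ)) * Real.log Y := by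
    intro k hk
    rw [Finset.mem_Ioc] at hk
    have hk0 : 0 < k := by omega
    have hkK : (k : ℝ) ≤ K := by exact_mod_cast hk.2
    have hYk : Y < 2 ^ J * k * (2 * M) := by
      rw [hYdef]
      have h : K < k * 2 := by omega
      calc 2 ^ J * K * M < 2 ^ J * (k * 2) * M := by gcongr
        _ = 2 ^ J * k * (2 * M) := by ring
    have hTk : 2 * (2 ^ J * k) ≤ (splitProducts Y).card := by
      have : (2 * (2 ^ J * k) : ℝ) ≤ (splitProducts Y).card := le_trans (by gcongr) ht2
      exact_mod_cast this
    have h := card_sq_le_sum_pairCount (by positivity) hYk hTk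
    set S := ∑ n ∈ Ico 1 (2 * M), (pairCount Y (n * (2 ^ J * k)) : ℝ) with hS
    have h' : t ^ 2 ≤ 4 * (2 ^ J * k) * S := by
      rw [ht, hS]
      exact_mod_cast h
    have hS0 : 0 ≤ S := Finset.sum_nonneg fun _ _ => Nat.cast_nonneg _
    refine le_of_mul_le_mul_left ?_ (by positivity : (0 : ℝ) < 4 * (2 ^ J * K))
    calc 4 * (2 ^ J * K) * (c₀ ^ 2 / 4 * Y * M) = c₀ ^ 2 * Y * (2 ^ J * K * M) := by ring
      _ = c₀ ^ 2 * Y ^ 2 := by rw [← hYr]; ring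
      _ ≤ t ^ 2 * Real.log Y := ht3
      _ ≤ 4 * (2 ^ J * k) * S * Real.log Y := by gcongr
      _ ≤ 4 * (2 ^ J * K) * S * Real.log Y := by gcongr
      _ = 4 * (2 ^ J * K) * (S * Real.log Y) := by ring
  have hsmall : ∀ k ∈ Ioc (K / 2) K,
      (∑ n ∈ (Ico 1 (2 * M)).filter (fun n => ¬ M ≤ n * 2 ^ J),
        (pairCount Y (n * (2 ^ J * k)) : ℝ)) * Real.log Y ≤
      9 / 4 * C₁ * C₂ * Y * (M / 2 ^ J) * dedekindRatio k ^ 2 := by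
    intro k hk
    have hk0 : k ≠ 0 := by
      rw [Finset.mem_Ioc] at hk
      omega
    have h := sum_pairCount_mul_log_le hC₁ hC₂ (hpair Y hY2)
      (mul_ne_zero (Nat.two_pow_pos J).ne' hk0) (M / 2 ^ J)
    have hsub : (Ico 1 (2 * M)).filter (fun n => ¬ M ≤ n * 2 ^ J) ⊆ Ioc 0 (M / 2 ^ J) := by
      intro n hn
      rw [Finset.mem_filter, Finset.mem_Ico, not_le] at hn
      rw [Finset.mem_Ioc, Nat.le_div_iff_mul_le (Nat.two_pow_pos J)]
      exact ⟨by omega, hn.2.le⟩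
    have hr : dedekindRatio (2 ^ J * k) ^ 2 ≤ 9 / 4 * dedekindRatio k ^ 2 := by
      calc dedekindRatio (2 ^ J * k) ^ 2 ≤ (3 / 2 * dedekindRatio k) ^ 2 := by
            refine pow_le_pow_left₀ (zero_le_one.trans (one_le_dedekindRatio _)) ?_ 2
            refine (dedekindRatio_mul_le (Nat.two_pow_pos J).ne' hk0).trans ?_
            exact mul_le_mul_of_nonneg_right (dedekindRatio_two_pow_le J)
              (zero_le_one.trans (one_le_dedekindRatio _))
        _ = _ := by ring
    have hd : ((M / 2 ^ J : ℕ) : ℝ) ≤ M / 2 ^ J := by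
      refine Nat.cast_div_le.trans ?_
      push_cast
      exact le_rfl
    calc _ ≤ (∑ n ∈ Ioc 0 (M / 2 ^ J), (pairCount Y (n * (2 ^ J * k)) : ℝ)) * Real.log Y := by
          gcongr
      _ ≤ C₁ * Y * dedekindRatio (2 ^ J * k) ^ 2 * (C₂ * (M / 2 ^ J : ℕ)) := h
      _ ≤ C₁ * Y * (9 / 4 * dedekindRatio k ^ 2) * (C₂ * (M / 2 ^ J)) := by gcongr
      _ = _ := by ring
  have hlarge : ∀ k ∈ Ioc (K / 2) K, c₀ ^ 2 / 4 * Y * M -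
        9 / 4 * C₁ * C₂ * Y * (M / 2 ^ J) * dedekindRatio k ^ 2 ≤
      (∑ n ∈ (Ico 1 (2 * M)).filter (fun n => M ≤ n * 2 ^ J),
        (pairCount Y (n * (2 ^ J * k)) : ℝ)) * Real.log Y := by
    intro k hk
    have h1 := hmain k hk
    have h2 := hsmall k hk
    rw [← Finset.sum_filter_add_sum_filter_not (Ico 1 (2 * M)) (fun n => M ≤ n * 2 ^ J),
      add_mul] at h1
    linarith
  have hcardK : (K : ℝ) / 2 ≤ (Ioc (K / 2) K).card := by
    rw [Nat.card_Ioc, div_le_iff₀ two_pos]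
    exact_mod_cast (by omega : K ≤ (K - K / 2) * 2)
  have hratio : ∑ k ∈ Ioc (K / 2) K, dedekindRatio k ^ 2 ≤ C₂ * K := by
    refine le_trans (Finset.sum_le_sum_of_subset_of_nonneg ?_ fun _ _ _ => sq_nonneg _) (hC₂ K)
    exact Finset.Ioc_subset_Ioc_left (Nat.zero_le _)
  have hJ' : 36 * C₁ * C₂ ^ 2 / 2 ^ J ≤ c₀ ^ 2 := by
    rw [div_lt_iff₀ (by positivity)] at hJ
    rw [div_le_iff₀ (by positivity)]
    linarith
  have hsum : c₀ ^ 2 / 16 * K * Y * M ≤ ∑ k ∈ Ioc (K / 2) K,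
      (∑ n ∈ (Ico 1 (2 * M)).filter (fun n => M ≤ n * 2 ^ J),
        (pairCount Y (n * (2 ^ J * k)) : ℝ)) * Real.log Y := by
    refine le_trans ?_ (Finset.sum_le_sum hlarge)
    rw [Finset.sum_sub_distrib, Finset.sum_const, nsmul_eq_mul, ← Finset.mul_sum]
    have h1 : (K : ℝ) / 2 * (c₀ ^ 2 / 4 * Y * M) ≤
        (Ioc (K / 2) K).card * (c₀ ^ 2 / 4 * Y * M) := by gcongr
    have h2 : 9 / 4 * C₁ * C₂ * Y * (M / 2 ^ J) * ∑ k ∈ Ioc (K / 2) K, dedekindRatio k ^ 2 ≤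
        9 / 4 * C₁ * C₂ * Y * (M / 2 ^ J) * (C₂ * K) := by gcongr
    have h3 : 9 / 4 * C₁ * C₂ * Y * (M / 2 ^ J) * (C₂ * K) ≤ c₀ ^ 2 / 16 * K * Y * M := by
      calc 9 / 4 * C₁ * C₂ * Y * (M / 2 ^ J) * (C₂ * K) =
            36 * C₁ * C₂ ^ 2 / 2 ^ J * (K * Y * M / 16) := by ring
        _ ≤ c₀ ^ 2 * (K * Y * M / 16) := by gcongr
        _ = _ := by ring
    linarith
  have hdy := sum_pairCount_dyadic_le Y M J K
  have hdy' : ∑ k ∈ Ioc 0 K, ∑ n ∈ (Ico 1 (2 * M)).filter (fun n => M ≤ n * 2 ^ J),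
        (pairCount Y (n * (2 ^ J * k)) : ℝ) ≤
      (J + 1) * ∑ N ∈ Ico M (2 * M), ∑ κ ∈ Ioc 0 (2 ^ J * K), (pairCount Y (N * κ) : ℝ) := by
    exact_mod_cast hdy
  set W := ∑ N ∈ Ico M (2 * M), ∑ κ ∈ Ioc 0 (2 ^ J * K), (pairCount Y (N * κ) : ℝ) with hW
  have hfin : c₀ ^ 2 / 16 * K * Y * M ≤ (J + 1) * W * Real.log Y := by
    refine hsum.trans ?_
    rw [← Finset.sum_mul]
    refine mul_le_mul_of_nonneg_right (le_trans ?_ hdy') l0.le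
    exact Finset.sum_le_sum_of_subset_of_nonneg (Finset.Ioc_subset_Ioc_left (Nat.zero_le _))
      fun _ _ _ => Finset.sum_nonneg fun _ _ => Nat.cast_nonneg _
  have hJ1 : (0 : ℝ) < J + 1 := by positivity
  calc c₀ ^ 2 / (16 * (J + 1)) * K * Y * M = (c₀ ^ 2 / 16 * K * Y * M) / (J + 1) := by
        field_simp
    _ ≤ ((J + 1) * W * Real.log Y) / (J + 1) := by gcongr
    _ = W * Real.log Y := by field_simp

lemma exists_sum_sq_pairCount_le : ∃ C : ℝ, 0 < C ∧ ∃ Y₀ : ℕ, ∀ Y M R : ℕ, Y₀ ≤ Y → 1 ≤ M →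
    ∑ N ∈ Ico M (2 * M), ((∑ κ ∈ Ioc 0 R, (pairCount Y (N * κ) : ℝ)) * Real.log Y) ^ 2 ≤
      C * (Y * R) ^ 2 * M := by
  obtain ⟨C₁, hC₁, Y₀, hpair⟩ := exists_pairCount_mul_log_le
  obtain ⟨C₂, hC₂0, hC₂⟩ := exists_sum_dedekindRatio_sq_le
  obtain ⟨C₃, hC₃0, hC₃⟩ := exists_sum_dedekindRatio_pow_four_le
  refine ⟨2 * (C₁ * C₂) ^ 2 * C₃, by positivity, Y₀, fun Y M R hY hM => ?_⟩
  calc _ ≤ ∑ N ∈ Ico M (2 * M), (C₁ * C₂ * (Y * R)) ^ 2 * dedekindRatio N ^ 4 := by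
        refine Finset.sum_le_sum fun N hN => ?_
        have hN0 : N ≠ 0 := by
          rw [Finset.mem_Ico] at hN
          omega
        have h := sum_pairCount_mul_log_le hC₁ hC₂ (hpair Y hY) hN0 R
        simp only [mul_comm _ N] at h
        refine (pow_le_pow_left₀ (mul_nonneg (Finset.sum_nonneg fun _ _ => Nat.cast_nonneg _)
          (Real.log_natCast_nonneg _)) h 2).trans (le_of_eq ?_)
        ring
    _ ≤ (C₁ * C₂ * (Y * R)) ^ 2 * (C₃ * (2 * M : ℕ)) := by
        rw [← Finset.mul_sum]
        gcongr
        refine le_trans (Finset.sum_le_sum_of_subset_of_nonneg (fun N hN => ?_) fun N _ _ => ?_)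
          (hC₃ (2 * M))
        · rw [Finset.mem_Ico] at hN
          rw [Finset.mem_Ioc]
          omega
        · exact pow_nonneg (zero_le_one.trans (one_le_dedekindRatio N)) 4
    _ = _ := by
        push_cast
        ring

/-- A second moment lower bound for the number of large values. -/
lemma card_large_values_ge {s : Finset ℕ} {X : ℕ → ℝ} {a v : ℝ} (hX : ∀ n ∈ s, 0 ≤ X n)
    (ha : 0 < a) (h1 : a * s.card ≤ ∑ n ∈ s, X n) (h2 : ∑ n ∈ s, X n ^ 2 ≤ v * s.card)
    (hv : 0 < v) :
    a ^ 2 / (4 * v) * s.card ≤ (s.filter fun n => a / 2 ≤ X n).card := by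
  rcases s.eq_empty_or_nonempty with rfl | hs
  · simp
  have hs0 : (0 : ℝ) < s.card := by exact_mod_cast hs.card_pos
  set S := s.filter fun n => a / 2 ≤ X n with hS
  have h3 : ∑ n ∈ s.filter (fun n => ¬ a / 2 ≤ X n), X n ≤ a / 2 * s.card := by
    calc _ ≤ ∑ n ∈ s.filter (fun n => ¬ a / 2 ≤ X n), a / 2 :=
          Finset.sum_le_sum fun n hn => (not_le.mp (Finset.mem_filter.mp hn).2).le
      _ = (s.filter (fun n => ¬ a / 2 ≤ X n)).card * (a / 2) := by
          rw [Finset.sum_const, nsmul_eq_mul]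
      _ ≤ s.card * (a / 2) := by
          gcongr
          exact Finset.filter_subset _ _
      _ = _ := mul_comm _ _
  have h4 : a / 2 * s.card ≤ ∑ n ∈ S, X n := by
    rw [← Finset.sum_filter_add_sum_filter_not s (fun n => a / 2 ≤ X n)] at h1
    linarith
  have h5 : (∑ n ∈ S, X n) ^ 2 ≤ S.card * ∑ n ∈ S, X n ^ 2 := sq_sum_le_card_mul_sum_sq
  have h6 : ∑ n ∈ S, X n ^ 2 ≤ v * s.card :=
    (Finset.sum_le_sum_of_subset_of_nonneg (Finset.filter_subset _ _)
      fun _ _ _ => sq_nonneg _).trans h2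
  have h7 : (a / 2 * s.card) ^ 2 ≤ S.card * (v * s.card) :=
    (pow_le_pow_left₀ (by positivity) h4 2).trans (h5.trans (by gcongr))
  rw [div_mul_eq_mul_div, div_le_iff₀ (by positivity)]
  refine le_of_mul_le_mul_right ?_ hs0
  linarith

lemma sum_pairCount_le_G {n R Y : ℕ} (hR : (R : ℝ) ≤ Real.log n ^ ((5 : ℝ) / 8))
    (hY : (Y : ℝ) ≤ n * Real.log n ^ ((5 : ℝ) / 8)) :
    ∑ κ ∈ Ioc 0 R, pairCount Y (n * κ) ≤ G n := by
  have hsub : ∀ {a : ℕ} {x : ℝ}, (a : ℝ) ≤ x → Ioc 0 a ⊆ Finset.Icc 1 ⌊x⌋₊ := by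
    intro a x hax k hk
    rw [Finset.mem_Ioc] at hk
    rw [Finset.mem_Icc]
    exact ⟨hk.1, hk.2.trans (Nat.le_floor hax)⟩
  refine (Finset.sum_le_sum fun κ _ => ?_).trans (Finset.sum_le_sum_of_subset (hsub hR))
  refine le_trans ?_ (Finset.sum_le_sum_of_subset (hsub hY))
  rw [pairCount, splitProducts, Finset.filter_filter, Finset.card_filter]
  refine Finset.sum_le_sum fun m _ => ?_
  split_ifs with h
  · rw [b, b, if_pos h.1.isSumTwoSquares, if_pos h.2.isSumTwoSquares]
  · exact Nat.zero_le _

lemma eventually_large (B Y₀ : ℕ) {c₀ : ℝ} (hc₀ : 0 < c₀) : ∀ᶠ M : ℕ in atTop,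
    Y₀ ≤ M ∧ 3 ≤ Real.log M ∧ (B : ℝ) ≤ Real.log M ^ ((5 : ℝ) / 8) ∧
      4 * Real.log M ≤ c₀ * M := by
  have hlog : Tendsto (fun M : ℕ => Real.log M) atTop atTop :=
    Real.tendsto_log_atTop.comp tendsto_natCast_atTop_atTop
  have h1 := hlog.eventually_ge_atTop 3
  have h2 := ((tendsto_rpow_atTop (by norm_num : (0 : ℝ) < 5 / 8)).comp hlog).eventually_ge_atTop
    (B : ℝ)
  have h3 := tendsto_natCast_atTop_atTop.eventually
    (Real.isLittleO_log_id_atTop.bound (by positivity : 0 < c₀ / 4))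
  filter_upwards [eventually_ge_atTop Y₀, h1, h2, h3] with M hM0 hM1 hM2 hM3
  refine ⟨hM0, hM1, hM2, ?_⟩
  rw [id, Real.norm_eq_abs, Real.norm_eq_abs, abs_of_nonneg (by linarith),
    abs_of_nonneg (Nat.cast_nonneg M)] at hM3
  linarith

lemma rpow_le_two_mul_rpow {x L : ℝ} (hx : 0 ≤ x) (hL : 0 ≤ L) (h : x ≤ 2 * L) :
    x ^ ((1 : ℝ) / 4) ≤ 2 * L ^ ((1 : ℝ) / 4) := by
  calc x ^ ((1 : ℝ) / 4) ≤ (2 * L) ^ ((1 : ℝ) / 4) := Real.rpow_le_rpow hx h (by norm_num)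
    _ = 2 ^ ((1 : ℝ) / 4) * L ^ ((1 : ℝ) / 4) := Real.mul_rpow (by norm_num) hL
    _ ≤ 2 * L ^ ((1 : ℝ) / 4) := by
        gcongr
        exact (Real.rpow_le_rpow_of_exponent_le one_le_two (by norm_num)).trans_eq
          (Real.rpow_one 2)

lemma exists_many_G_large : ∃ c c' : ℝ, 0 < c ∧ 0 < c' ∧ ∀ᶠ M : ℕ in atTop,
    3 ≤ Real.log M ∧ c' * M ≤ ((Ico M (2 * M)).filter fun n : ℕ =>
      c * (n : ℝ) * Real.log n ^ ((1 : ℝ) / 4) ≤ (G n : ℝ)).card := by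
  obtain ⟨c₀, c₁, hc₀, hc₁, B, Y₀, hB, hfirst⟩ := exists_sum_pairCount_ge
  obtain ⟨C, hC, Y₁, hsecond⟩ := exists_sum_sq_pairCount_le
  have hB0 : (0 : ℝ) < B := by exact_mod_cast hB
  refine ⟨c₁ / (64 * B), c₁ ^ 2 / (4 * (C * B ^ 2)), by positivity, by positivity, ?_⟩
  filter_upwards [eventually_large B (max Y₀ Y₁) hc₀] with M hM
  obtain ⟨hMY, hL3, hLB, hLM⟩ := hM
  refine ⟨hL3, ?_⟩
  set L := Real.log M with hL
  have hL0 : 0 < L := by linarith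
  have hM1 : 1 ≤ M := by
    rcases Nat.eq_zero_or_pos M with rfl | h
    · simp [hL] at hL3
      linarith
    · exact h
  have hM0 : (0 : ℝ) < M := by exact_mod_cast hM1
  set x := L ^ ((5 : ℝ) / 8) with hx
  have hx0 : 0 < x := Real.rpow_pos_of_pos hL0 _
  have hxL : x ≤ L := by
    calc x ≤ L ^ (1 : ℝ) := Real.rpow_le_rpow_of_exponent_le (by linarith) (by norm_num)
      _ = L := Real.rpow_one L
  have hxx : x ^ 2 = L * L ^ ((1 : ℝ) / 4) := by
    calc x ^ 2 = L ^ ((5 : ℝ) / 4) := by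
          rw [hx, ← Real.rpow_natCast, ← Real.rpow_mul hL0.le]
          norm_num
      _ = L ^ (1 : ℝ) * L ^ ((1 : ℝ) / 4) := by
          rw [← Real.rpow_add hL0]
          norm_num
      _ = L * L ^ ((1 : ℝ) / 4) := by rw [Real.rpow_one]
  set K := ⌊x / B⌋₊ with hK
  have hK1 : 1 ≤ K := Nat.le_floor (by rw [le_div_iff₀ hB0]; simpa using hLB)
  have hK0 : (0 : ℝ) < K := by exact_mod_cast hK1
  have hKle : (B : ℝ) * K ≤ x := by
    have := Nat.floor_le (by positivity : 0 ≤ x / B)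
    rw [le_div_iff₀ hB0] at this
    linarith
  have hKge : x ≤ 2 * B * K := by
    have h1 := Nat.lt_floor_add_one (x / B)
    rw [div_lt_iff₀ hB0] at h1
    have h2 : (1 : ℝ) ≤ K := by exact_mod_cast hK1
    nlinarith
  set Y := B * K * M with hY
  have hYr : (Y : ℝ) = B * K * M := by
    rw [hY]
    push_cast
    ring
  have hMleY : M ≤ Y := Nat.le_mul_of_pos_left M (by positivity)
  have hY0 : (0 : ℝ) < Y := by
    rw [hYr]
    positivity
  have hlogY : Real.log Y ≤ 2 * L := by
    have h : (Y : ℝ) ≤ (M : ℝ) ^ 2 := by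
      rw [hYr, sq]
      gcongr
      exact (hKle.trans hxL).trans (Real.log_le_self (Nat.cast_nonneg M))
    calc Real.log Y ≤ Real.log ((M : ℝ) ^ 2) := Real.log_le_log hY0 h
      _ = 2 * L := by rw [Real.log_pow, hL]; norm_num
  have hlogY0 : 0 < Real.log Y :=
    hL0.trans_le (Real.log_le_log hM0 (by exact_mod_cast hMleY))
  have hsq : 2 * √(Real.log Y) ≤ c₀ * M := by
    have : √(Real.log Y) ≤ 2 * L := (Real.sqrt_le_sqrt hlogY).trans
      (Real.sqrt_le_iff.mpr ⟨by positivity, by nlinarith⟩)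
    linarith
  set W : ℕ → ℝ := fun N => ∑ κ ∈ Ioc 0 (B * K), (pairCount Y (N * κ) : ℝ) with hW
  have h1 : c₁ * K * Y * M ≤ (∑ N ∈ Ico M (2 * M), W N) * Real.log Y :=
    hfirst K M Y hK1 hM1 hY (((le_max_left _ _).trans hMY).trans hMleY) hsq
  have h2 : ∑ N ∈ Ico M (2 * M), (W N * Real.log Y) ^ 2 ≤ C * (Y * (B * K : ℕ)) ^ 2 * M :=
    hsecond Y M (B * K) (((le_max_right _ _).trans hMY).trans hMleY) hM1
  have hcard : ((Ico M (2 * M)).card : ℝ) = M := by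
    rw [Nat.card_Ico]
    congr 1
    omega
  have hKY : (0 : ℝ) < K * Y := by positivity
  have hlarge := card_large_values_ge (s := Ico M (2 * M))
    (X := fun N => W N * Real.log Y / (K * Y)) (a := c₁) (v := C * B ^ 2) ?_ hc₁ ?_ ?_
    (by positivity)
  rotate_left
  · intro N _
    exact div_nonneg (mul_nonneg (Finset.sum_nonneg fun _ _ => Nat.cast_nonneg _) hlogY0.le) hKY.le
  · rw [hcard, ← Finset.sum_div, ← Finset.sum_mul, le_div_iff₀ hKY]
    linarith
  · simp only [div_pow]
    rw [hcard, ← Finset.sum_div, div_le_iff₀ (by positivity)]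
    refine h2.trans (le_of_eq ?_)
    push_cast
    ring
  rw [hcard] at hlarge
  refine hlarge.trans (Nat.cast_le.mpr (Finset.card_le_card fun n hn => ?_))
  rw [Finset.mem_filter] at hn ⊢
  refine ⟨hn.1, ?_⟩
  obtain ⟨hn1, hn2⟩ := hn
  rw [Finset.mem_Ico] at hn1
  have hMn : (M : ℝ) ≤ n := by exact_mod_cast hn1.1
  have hnM : (n : ℝ) ≤ 2 * M := by exact_mod_cast hn1.2.le
  have hLn : L ≤ Real.log n := Real.log_le_log hM0 hMn
  have hLn' : Real.log n ≤ 2 * L := by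
    have h : Real.log n ≤ Real.log (2 * M) := Real.log_le_log (hM0.trans_le hMn) hnM
    rw [Real.log_mul two_ne_zero hM0.ne'] at h
    have := Real.log_two_lt_d9
    linarith
  have hxn : x ≤ Real.log n ^ ((5 : ℝ) / 8) := Real.rpow_le_rpow hL0.le hLn (by norm_num)
  have hWG : W n ≤ G n := by
    have h := sum_pairCount_le_G (n := n) (R := B * K) (Y := Y) ?_ ?_
    · simp only [hW]
      exact_mod_cast h
    · push_cast
      exact hKle.trans hxn
    · rw [hYr, mul_comm]
      exact mul_le_mul hMn (hKle.trans hxn) (by positivity) (by positivity)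
  refine le_trans ?_ hWG
  rw [div_le_div_iff₀ two_pos hKY] at hn2
  have h3 : c₁ * (K * Y) ≤ 4 * L * W n := by
    have hW0 : 0 ≤ W n := Finset.sum_nonneg fun _ _ => Nat.cast_nonneg _
    nlinarith
  have h4 : c₁ / (16 * B) * M * L ^ ((1 : ℝ) / 4) ≤ W n := by
    refine le_of_mul_le_mul_left ?_ (by positivity : 0 < 4 * L)
    refine le_trans ?_ h3
    calc 4 * L * (c₁ / (16 * B) * M * L ^ ((1 : ℝ) / 4)) =
          c₁ * M / (4 * B) * (L * L ^ ((1 : ℝ) / 4)) := by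
          field_simp
          norm_num
      _ = c₁ * M / (4 * B) * x ^ 2 := by rw [hxx]
      _ ≤ c₁ * M / (4 * B) * (2 * B * K) ^ 2 := by gcongr
      _ = c₁ * (K * Y) := by
          rw [hYr]
          field_simp
          norm_num
  refine le_trans ?_ h4
  calc c₁ / (64 * B) * n * Real.log n ^ ((1 : ℝ) / 4)
      ≤ c₁ / (64 * B) * (2 * M) * (2 * L ^ ((1 : ℝ) / 4)) := by
        gcongr
        exact rpow_le_two_mul_rpow (hL0.le.trans hLn) hL0.le hLn'
    _ = _ := by
        field_simp
        norm_num

lemma one_le_log {x : ℝ} (hx : 3 ≤ x) : 1 ≤ Real.log x := by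
  rw [Real.le_log_iff_exp_le (by linarith)]
  linarith [Real.exp_one_lt_d9]

end TwoSquares

/-- There are `c, c' > 0` such that for all large `M`, the number of `n ∈ [M,2M)`
with `G(n) ≥ c·n·(log n)^{1/4}/(log log n)` is at least `c'·M/(log log M)²`. -/
theorem many_n_with_G_large :
    ∃ c c' : ℝ, 0 < c ∧ 0 < c' ∧
      ∀ᶠ M : ℕ in atTop,
        c' * M / (Real.log (Real.log M)) ^ 2 ≤
          ((Finset.Ico M (2 * M)).filter
            (fun n : ℕ =>
              c * (n : ℝ) * Real.log n ^ ((1:ℝ)/4) / Real.log (Real.log n) ≤ (G n : ℝ))).card := by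
  obtain ⟨c, c', hc, hc', h⟩ := TwoSquares.exists_many_G_large
  refine ⟨c, c', hc, hc', ?_⟩
  filter_upwards [h] with M hM
  obtain ⟨hL, hM⟩ := hM
  have hM0 : (0 : ℝ) < M := by
    rcases Nat.eq_zero_or_pos M with rfl | h
    · norm_num at hL
    · exact_mod_cast h
  refine (div_le_self (by positivity) (one_le_pow₀ (TwoSquares.one_le_log hL))).trans
    (hM.trans (Nat.cast_le.mpr (Finset.card_le_card fun n hn => ?_)))
  rw [Finset.mem_filter] at hn ⊢
  refine ⟨hn.1, le_trans ?_ hn.2⟩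
  have hLn : Real.log M ≤ Real.log n :=
    Real.log_le_log hM0 (by exact_mod_cast (Finset.mem_Ico.mp hn.1).1)
  have h0 : 0 ≤ Real.log n := by linarith
  exact div_le_self (by positivity) (TwoSquares.one_le_log (hL.trans hLn))
end

section
/- For all sufficiently large N and every n ≥ 2 with n·(log n)^{5/8} ≤ 5N·√(log N), one has Σ_{k ≤ (log n)^{5/8}} R_{10N}(nk) ≥ G(n). -/
open Real MeasureTheory Filter Finset
open scoped Classical

/-- `a n` is the `n`-th (1-indexed) natural number that is a sum of two squares,
in strictly increasing order. -/
noncomputable def a (n : ℕ) : ℕ := Nat.nth IsSumTwoSquares (n - 1)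

/-- Distance to the nearest integer. -/
noncomputable def nint (x : ℝ) : ℝ := |x - round x|

/-- `R N v` counts pairs `1 ≤ n < m ≤ N` with `a m - a n = v`. -/
noncomputable def R (N v : ℕ) : ℕ :=
  ((Finset.Icc 1 N ×ˢ Finset.Icc 1 N).filter
    (fun p => p.1 < p.2 ∧ a p.2 - a p.1 = v)).card

namespace LandauUpper

/-- `n` is a nonzero natural number all of whose prime factors are congruent to `r` mod `4`. -/
def PrimesMod (r n : ℕ) : Prop := n ≠ 0 ∧ ∀ p : ℕ, p.Prime → p ∣ n → p % 4 = r

lemma PrimesMod.pos {r n : ℕ} (h : PrimesMod r n) : 0 < n := Nat.pos_of_ne_zero h.1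

lemma primesMod_one (r : ℕ) : PrimesMod r 1 :=
  ⟨one_ne_zero, fun _ hp h => absurd (Nat.dvd_one.mp h) hp.ne_one⟩

lemma primesMod_mul {r m n : ℕ} : PrimesMod r (m * n) ↔ PrimesMod r m ∧ PrimesMod r n := by
  constructor
  · rintro ⟨h0, h⟩
    exact ⟨⟨left_ne_zero_of_mul h0, fun p hp hd => h p hp (hd.mul_right n)⟩,
      ⟨right_ne_zero_of_mul h0, fun p hp hd => h p hp (hd.mul_left m)⟩⟩
  · rintro ⟨⟨hm, h⟩, ⟨hn, h'⟩⟩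
    exact ⟨mul_ne_zero hm hn, fun p hp hd => (hp.dvd_mul.mp hd).elim (h p hp) (h' p hp)⟩

lemma PrimesMod.of_dvd {r m n : ℕ} (h : PrimesMod r n) (hd : m ∣ n) : PrimesMod r m := by
  obtain ⟨k, rfl⟩ := hd
  exact (primesMod_mul.mp h).1

lemma primesMod_prime {r p : ℕ} (hp : p.Prime) : PrimesMod r p ↔ p % 4 = r :=
  ⟨fun h => h.2 p hp dvd_rfl, fun h =>
    ⟨hp.ne_zero, fun _ hq hd => (Nat.prime_dvd_prime_iff_eq hq hp).mp hd ▸ h⟩⟩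

/-- The completely multiplicative function `n ↦ 1 / n` on numbers composed of primes that are
`r` mod `4`. -/
noncomputable def invOn (r : ℕ) : ℕ →*₀ ℝ where
  toFun n := if PrimesMod r n then (n : ℝ)⁻¹ else 0
  map_zero' := by simp
  map_one' := by simp [primesMod_one]
  map_mul' m n := by
    by_cases hm : PrimesMod r m <;> by_cases hn : PrimesMod r n <;>
      simp [primesMod_mul, hm, hn, mul_comm]

lemma invOn_apply (r n : ℕ) : invOn r n = if PrimesMod r n then (n : ℝ)⁻¹ else 0 := rfl

lemma invOn_nonneg (r n : ℕ) : 0 ≤ invOn r n := by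
  rw [invOn_apply]; split_ifs <;> positivity

/-- The completely multiplicative function `n ↦ χ₄ n / n`. -/
noncomputable def chiInv : ℕ →*₀ ℝ where
  toFun n := (ZMod.χ₄ (n : ZMod 4) : ℝ) * (n : ℝ)⁻¹
  map_zero' := by simp
  map_one' := by simp
  map_mul' m n := by push_cast; rw [map_mul]; push_cast; ring

lemma chiInv_apply (n : ℕ) : chiInv n = (ZMod.χ₄ (n : ZMod 4) : ℝ) * (n : ℝ)⁻¹ := rfl

/-- The completely multiplicative function `n ↦ χ₄ n / n` on numbers composed of primes that are
`3` mod `4`. -/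
noncomputable def chiInvOn : ℕ →*₀ ℝ where
  toFun n := if PrimesMod 3 n then chiInv n else 0
  map_zero' := by simp
  map_one' := by simp [primesMod_one]
  map_mul' m n := by
    by_cases hm : PrimesMod 3 m <;> by_cases hn : PrimesMod 3 n <;>
      simp [primesMod_mul, hm, hn]

lemma chiInvOn_apply (n : ℕ) : chiInvOn n = if PrimesMod 3 n then chiInv n else 0 := rfl

/-- The completely multiplicative function `n ↦ 1 / n` on odd numbers. -/
noncomputable def oddInv : ℕ →*₀ ℝ where
  toFun n := if n % 2 = 1 then (n : ℝ)⁻¹ else 0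
  map_zero' := by simp
  map_one' := by simp
  map_mul' m n := by
    rcases Nat.mod_two_eq_zero_or_one m with hm | hm <;>
    rcases Nat.mod_two_eq_zero_or_one n with hn | hn <;>
      simp [Nat.mul_mod, hm, hn, mul_comm]

lemma oddInv_apply (n : ℕ) : oddInv n = if n % 2 = 1 then (n : ℝ)⁻¹ else 0 := rfl

lemma oddInv_nonneg (n : ℕ) : 0 ≤ oddInv n := by
  rw [oddInv_apply]; split_ifs <;> positivity

/-- A completely multiplicative function as an arithmetic function. -/
noncomputable def toArith (f : ℕ →*₀ ℝ) : ArithmeticFunction ℝ := ⟨f, map_zero f⟩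

@[simp] lemma toArith_apply (f : ℕ →*₀ ℝ) (n : ℕ) : toArith f n = f n := rfl

lemma isMultiplicative_toArith (f : ℕ →*₀ ℝ) : (toArith f).IsMultiplicative :=
  ⟨map_one f, fun _ => map_mul f _ _⟩

lemma toArith_mul_prime_pow (f g : ℕ →*₀ ℝ) {p : ℕ} (hp : p.Prime) (k : ℕ) :
    (toArith f * toArith g) (p ^ k) = ∑ i ∈ range (k + 1), f p ^ i * g p ^ (k - i) := by
  rw [ArithmeticFunction.mul_apply,
    Nat.sum_divisorsAntidiagonal (f := fun i j => toArith f i * toArith g j),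
    Nat.sum_divisors_prime_pow hp]
  refine sum_congr rfl fun i hi => ?_
  rw [Nat.pow_div (by simpa [Nat.lt_succ_iff] using hi) hp.pos]
  simp

lemma sum_pow_mul_zero_pow (x : ℝ) (k : ℕ) :
    ∑ i ∈ range (k + 1), x ^ i * (0 : ℝ) ^ (k - i) = x ^ k := by
  rw [sum_range_succ, sum_eq_zero]
  · simp
  · intro i hi
    rw [zero_pow (by have := mem_range.mp hi; omega), mul_zero]

lemma sum_zero_pow_mul_pow (x : ℝ) (k : ℕ) :
    ∑ i ∈ range (k + 1), (0 : ℝ) ^ i * x ^ (k - i) = x ^ k := by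
  rw [sum_range_succ', sum_eq_zero]
  · simp
  · intro i hi
    simp

lemma sum_pow_mul_neg_pow (x : ℝ) (k : ℕ) :
    ∑ i ∈ range (k + 1), x ^ i * (-x) ^ (k - i) = if Even k then x ^ k else 0 := by
  induction k with
  | zero => simp
  | succ k ih =>
    rw [sum_range_succ]
    have : ∑ i ∈ range (k + 1), x ^ i * (-x) ^ (k + 1 - i)
        = (-x) * ∑ i ∈ range (k + 1), x ^ i * (-x) ^ (k - i) := by
      rw [mul_sum]
      refine sum_congr rfl fun i hi => ?_
      rw [show k + 1 - i = (k - i) + 1 by have := mem_range.mp hi; omega, pow_succ]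
      ring
    rw [this, ih]
    by_cases h : Even k
    · simp [h, Nat.even_add_one, pow_succ]; ring
    · simp [h, Nat.even_add_one]

lemma invOn_prime {r p : ℕ} (hp : p.Prime) :
    invOn r p = if p % 4 = r then (p : ℝ)⁻¹ else 0 := by
  simp [invOn_apply, primesMod_prime hp]

lemma chiInvOn_prime {p : ℕ} (hp : p.Prime) : chiInvOn p = -invOn 3 p := by
  rw [invOn_prime hp, chiInvOn_apply, primesMod_prime hp]
  split_ifs with h
  · simp [chiInv_apply, ZMod.χ₄_nat_three_mod_four h]
  · simp

lemma prime_mod_four {p : ℕ} (hp : p.Prime) : p = 2 ∨ p % 4 = 1 ∨ p % 4 = 3 := by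
  rcases hp.eq_two_or_odd with h | h <;> omega

lemma invOn_one_mul_invOn_three : toArith (invOn 1) * toArith (invOn 3) = toArith oddInv := by
  rw [ArithmeticFunction.IsMultiplicative.eq_iff_eq_on_prime_powers _
    ((isMultiplicative_toArith _).mul (isMultiplicative_toArith _)) _ (isMultiplicative_toArith _)]
  intro p k hp
  rw [toArith_mul_prime_pow _ _ hp, toArith_apply, map_pow, invOn_prime hp, invOn_prime hp]
  rcases prime_mod_four hp with rfl | h | h
  · simp [oddInv_apply, sum_pow_mul_zero_pow]
  · simp [-inv_pow, oddInv_apply, h, sum_pow_mul_zero_pow, show p % 2 = 1 by omega]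
  · simp [-inv_pow, oddInv_apply, h, sum_zero_pow_mul_pow, show p % 2 = 1 by omega]

lemma invOn_one_mul_chiInvOn : toArith (invOn 1) * toArith chiInvOn = toArith chiInv := by
  rw [ArithmeticFunction.IsMultiplicative.eq_iff_eq_on_prime_powers _
    ((isMultiplicative_toArith _).mul (isMultiplicative_toArith _)) _ (isMultiplicative_toArith _)]
  intro p k hp
  rw [toArith_mul_prime_pow _ _ hp, toArith_apply, map_pow, invOn_prime hp, chiInvOn_prime hp,
    invOn_prime hp, chiInv_apply]
  rcases prime_mod_four hp with rfl | h | h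
  · have : ZMod.χ₄ 2 = 0 := by decide
    simp [this, sum_pow_mul_zero_pow]
  · simp [-inv_pow, h, sum_pow_mul_zero_pow, ZMod.χ₄_nat_one_mod_four h]
  · simp [h, sum_zero_pow_mul_pow, ZMod.χ₄_nat_three_mod_four h]

/-- The Dirichlet convolution supported on squares of numbers composed of primes `3` mod `4`. -/
noncomputable def sqInv : ArithmeticFunction ℝ := toArith (invOn 3) * toArith chiInvOn

lemma isMultiplicative_sqInv : sqInv.IsMultiplicative :=
  (isMultiplicative_toArith _).mul (isMultiplicative_toArith _)

lemma sqInv_prime_pow {p : ℕ} (hp : p.Prime) (k : ℕ) :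
    sqInv (p ^ k) = if Even k then invOn 3 p ^ k else 0 := by
  rw [sqInv, toArith_mul_prime_pow _ _ hp, chiInvOn_prime hp, sum_pow_mul_neg_pow]

lemma sqInv_nonneg (n : ℕ) : 0 ≤ sqInv n := by
  rcases eq_or_ne n 0 with rfl | hn
  · simp
  rw [isMultiplicative_sqInv.multiplicative_factorization _ hn]
  refine prod_nonneg fun p hp => ?_
  dsimp only
  rw [sqInv_prime_pow (Nat.prime_of_mem_primeFactors hp)]
  split_ifs
  · exact pow_nonneg (invOn_nonneg _ _) _
  · rfl

lemma invOn_mul_invOn_mul_chiInv :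
    toArith (invOn 3) * (toArith (invOn 3) * toArith chiInv) = sqInv * toArith oddInv := by
  rw [← invOn_one_mul_invOn_three, ← invOn_one_mul_chiInvOn, sqInv]
  ring

/-- The sum of reciprocals of numbers up to `y` composed of primes `3` mod `4`. -/
noncomputable def T (y : ℕ) : ℝ := ∑ n ∈ Ioc 0 y, invOn 3 n

lemma T_nonneg (y : ℕ) : 0 ≤ T y := sum_nonneg fun _ _ => invOn_nonneg _ _

lemma one_le_T {y : ℕ} (hy : 1 ≤ y) : 1 ≤ T y := by
  have : invOn 3 1 ≤ T y := single_le_sum (f := fun n => invOn 3 n)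
    (fun _ _ => invOn_nonneg _ _) (by simp; omega)
  simpa using this

lemma sum_leibniz_le (K : ℕ) :
    ∑ i ∈ range K, (-1 : ℝ) ^ i * (1 / (2 * (i : ℝ) + 1)) ≤ π / 4 + 1 / (2 * (K : ℝ) + 1) := by
  have hl : Tendsto (fun n : ℕ => ∑ i ∈ range n, (-1 : ℝ) ^ i * (1 / (2 * (i : ℝ) + 1))) atTop
      (nhds (π / 4)) := by
    refine Real.tendsto_sum_pi_div_four.congr fun n => sum_congr rfl fun i _ => ?_
    ring
  have ha : Antitone (fun i : ℕ => 1 / (2 * (i : ℝ) + 1)) := by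
    intro i j h
    dsimp only
    gcongr
  rcases Nat.even_or_odd' K with ⟨k, rfl | rfl⟩
  · have := ha.alternating_series_le_tendsto hl k
    have h2 : (0 : ℝ) ≤ 1 / (2 * ((2 * k : ℕ) : ℝ) + 1) := by positivity
    linarith
  · have := ha.alternating_series_le_tendsto hl (k + 1)
    rw [show 2 * (k + 1) = 2 * k + 1 + 1 by ring, sum_range_succ] at this
    have h1 : (-1 : ℝ) ^ (2 * k + 1) = -1 := by simp [pow_succ]
    rw [h1] at this
    linarith

lemma sum_chiInv_two_mul (K : ℕ) : ∑ n ∈ Ioc 0 (2 * K), chiInv n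
    = ∑ i ∈ range K, (-1 : ℝ) ^ i * (1 / (2 * (i : ℝ) + 1)) := by
  induction K with
  | zero => simp
  | succ K ih =>
    rw [show 2 * (K + 1) = 2 * K + 1 + 1 by ring, sum_Ioc_succ_top (by omega),
      sum_Ioc_succ_top (by omega), ih, sum_range_succ]
    have h1 : chiInv (2 * K + 1 + 1) = 0 := by
      rw [chiInv_apply, ZMod.χ₄_nat_eq_if_mod_four, if_pos (by omega)]; simp
    have h2 : chiInv (2 * K + 1) = (-1 : ℝ) ^ K * (1 / (2 * (K : ℝ) + 1)) := by
      rw [chiInv_apply, ZMod.χ₄_eq_neg_one_pow (by omega), show (2 * K + 1) / 2 = K by omega]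
      push_cast; ring
    rw [h1, h2, add_zero]

lemma sum_chiInv_le (t : ℕ) : ∑ n ∈ Ioc 0 t, chiInv n ≤ π / 4 + 1 / ((t : ℝ) + 1) := by
  rcases Nat.even_or_odd' t with ⟨K, rfl | rfl⟩
  · rw [sum_chiInv_two_mul]
    exact_mod_cast sum_leibniz_le K
  · have h : ∑ n ∈ Ioc 0 (2 * K + 1), chiInv n = ∑ n ∈ Ioc 0 (2 * (K + 1)), chiInv n := by
      rw [show 2 * (K + 1) = 2 * K + 1 + 1 by ring, sum_Ioc_succ_top (b := 2 * K + 1) (by omega)]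
      rw [chiInv_apply (2 * K + 1 + 1), ZMod.χ₄_nat_eq_if_mod_four, if_pos (by omega)]; simp
    rw [h, sum_chiInv_two_mul]
    refine (sum_leibniz_le _).trans ?_
    gcongr
    push_cast
    linarith

lemma sum_sqInv_mul_oddInv_le {y : ℕ} (hy : 0 < y) :
    ∑ n ∈ Ioc 0 y, (sqInv * toArith oddInv) n ≤ π / 4 * T y ^ 2 + T y := by
  have hy' : (0 : ℝ) < y := by exact_mod_cast hy
  have step (m : ℕ) (hm : m ∈ Ioc 0 y) : invOn 3 m *
      ∑ n ∈ Ioc 0 (y / m), invOn 3 n * ∑ e ∈ Ioc 0 (y / m / n), chiInv e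
      ≤ invOn 3 m * (π / 4 * T y) + invOn 3 m := by
    rw [← mul_add_one]
    refine mul_le_mul_of_nonneg_left ?_ (invOn_nonneg _ _)
    have hm0 : 0 < m := (mem_Ioc.mp hm).1
    have hm' : (0 : ℝ) < m := by exact_mod_cast hm0
    have inner (n : ℕ) (hn : n ∈ Ioc 0 (y / m)) :
        invOn 3 n * ∑ e ∈ Ioc 0 (y / m / n), chiInv e ≤ π / 4 * invOn 3 n + m / y := by
      have hn0 : 0 < n := (mem_Ioc.mp hn).1
      have hn' : (0 : ℝ) < n := by exact_mod_cast hn0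
      have h1 : 1 / (((y / m / n : ℕ) : ℝ) + 1) ≤ m * n / y := by
        rw [div_le_div_iff₀ (by positivity) hy', one_mul, Nat.div_div_eq_div_mul]
        have : y < m * n * (y / (m * n) + 1) := Nat.lt_mul_div_succ y (by positivity)
        exact_mod_cast this.le
      calc _ ≤ invOn 3 n * (π / 4 + m * n / y) :=
            mul_le_mul_of_nonneg_left ((sum_chiInv_le _).trans (by linarith)) (invOn_nonneg _ _)
        _ = π / 4 * invOn 3 n + invOn 3 n * n * (m / y) := by ring
        _ ≤ _ := by
          have : invOn 3 n * n ≤ 1 := by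
            rw [invOn_apply]; split_ifs
            · rw [inv_mul_cancel₀ hn'.ne']
            · simp
          have h2 : (0 : ℝ) ≤ m / y := by positivity
          nlinarith
    refine (sum_le_sum inner).trans ?_
    rw [sum_add_distrib, ← mul_sum, sum_const, Nat.card_Ioc, nsmul_eq_mul]
    have h3 : ∑ n ∈ Ioc 0 (y / m), invOn 3 n ≤ T y :=
      sum_le_sum_of_subset_of_nonneg (Ioc_subset_Ioc_right (Nat.div_le_self _ _))
        fun _ _ _ => invOn_nonneg _ _
    have h4 : ((y / m - 0 : ℕ) : ℝ) * (m / y) ≤ 1 := by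
      rw [Nat.sub_zero, mul_div_assoc', div_le_one hy']
      exact_mod_cast Nat.div_mul_le_self y m
    have := mul_le_mul_of_nonneg_left h3 (show 0 ≤ π / 4 by positivity)
    linarith
  rw [← invOn_mul_invOn_mul_chiInv, ArithmeticFunction.sum_Ioc_mul_eq_sum_sum]
  simp_rw [ArithmeticFunction.sum_Ioc_mul_eq_sum_sum, toArith_apply]
  refine (sum_le_sum step).trans (le_of_eq ?_)
  rw [sum_add_distrib, ← sum_mul, ← T]
  ring

lemma half_log_le_sum_oddInv (u : ℕ) :
    1 / 2 * Real.log ((u + 1 : ℝ) / 2) ≤ ∑ n ∈ Ioc 0 u, oddInv n := by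
  have key (K : ℕ) : 1 / 2 * Real.log (K + 1) ≤ ∑ n ∈ Ioc 0 (2 * K), oddInv n := by
    have h1 : (1 / 2 : ℝ) * (harmonic K : ℝ) ≤ ∑ n ∈ Ioc 0 (2 * K), oddInv n := by
      induction K with
      | zero => simp
      | succ K ih =>
        rw [show 2 * (K + 1) = 2 * K + 1 + 1 by ring, sum_Ioc_succ_top (by omega),
          sum_Ioc_succ_top (by omega), harmonic_succ]
        have h2 : oddInv (2 * K + 1) = ((2 * K + 1 : ℕ) : ℝ)⁻¹ := by
          rw [oddInv_apply, if_pos (by omega)]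
        have h3 := oddInv_nonneg (2 * K + 1 + 1)
        have h4 : (1 / 2 : ℝ) * ((K + 1 : ℕ) : ℝ)⁻¹ ≤ ((2 * K + 1 : ℕ) : ℝ)⁻¹ := by
          rw [← one_div, ← one_div, div_mul_div_comm,
            div_le_div_iff₀ (by positivity) (by positivity)]
          push_cast; linarith
        push_cast at ih h4 h2 ⊢
        linarith
    have := log_add_one_le_harmonic K
    push_cast at this
    linarith
  have h := key (u / 2)
  have h5 : ∑ n ∈ Ioc 0 (2 * (u / 2)), oddInv n ≤ ∑ n ∈ Ioc 0 u, oddInv n :=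
    sum_le_sum_of_subset_of_nonneg (Ioc_subset_Ioc_right (Nat.mul_div_le u 2))
      fun _ _ _ => oddInv_nonneg _
  have h6 : Real.log ((u + 1 : ℝ) / 2) ≤ Real.log ((u / 2 : ℕ) + 1) := by
    refine Real.log_le_log (by positivity) ?_
    rw [div_le_iff₀ two_pos]
    have : u + 1 ≤ (u / 2 + 1) * 2 := by omega
    exact_mod_cast this
  linarith

lemma sqInv_values : sqInv 1 = 1 ∧ sqInv 9 = 1 / 9 ∧ sqInv 49 = 1 / 49 ∧ sqInv 81 = 1 / 81 ∧
    sqInv 121 = 1 / 121 := by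
  have h3 := sqInv_prime_pow (p := 3) (by norm_num)
  have h7 := sqInv_prime_pow (p := 7) (by norm_num)
  have h11 := sqInv_prime_pow (p := 11) (by norm_num)
  rw [invOn_prime (by norm_num), if_pos (by norm_num)] at h3 h7 h11
  refine ⟨isMultiplicative_sqInv.map_one, ?_, ?_, ?_, ?_⟩
  · have := h3 2; norm_num at this ⊢; exact this
  · have := h7 2; norm_num at this ⊢; exact this
  · have := h3 4; rw [if_pos (by decide)] at this; norm_num at this ⊢; exact this
  · have := h11 2; norm_num at this ⊢; exact this

lemma le_sum_sqInv_mul_oddInv {y : ℕ} (hy : 242 ≤ y) :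
    0.57606 * Real.log (y / 242) ≤ ∑ n ∈ Ioc 0 y, (sqInv * toArith oddInv) n := by
  have hy' : (242 : ℝ) ≤ y := by exact_mod_cast hy
  rw [ArithmeticFunction.sum_Ioc_mul_eq_sum_sum]
  set L := Real.log (y / 242)
  have hL : 0 ≤ L := Real.log_nonneg (by rw [le_div_iff₀ (by norm_num)]; linarith)
  have hinner (q : ℕ) (hq : 0 < q) (hq' : q ≤ 121) :
      1 / 2 * L ≤ ∑ m ∈ Ioc 0 (y / q), toArith oddInv m := by
    refine le_trans ?_ (half_log_le_sum_oddInv (y / q))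
    refine mul_le_mul_of_nonneg_left (Real.log_le_log (by positivity) ?_) (by norm_num)
    rw [div_le_div_iff₀ (by norm_num) (by norm_num)]
    have h1 : y < q * (y / q + 1) := Nat.lt_mul_div_succ y hq
    have h2 : y * 2 ≤ (y / q + 1) * 242 := by nlinarith
    exact_mod_cast h2
  have hsub : ({1, 9, 49, 81, 121} : Finset ℕ) ⊆ Ioc 0 y := by
    intro q hq
    simp only [mem_insert, mem_singleton] at hq
    rw [mem_Ioc]; omega
  have hnn (q : ℕ) : 0 ≤ sqInv q * ∑ m ∈ Ioc 0 (y / q), toArith oddInv m :=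
    mul_nonneg (sqInv_nonneg q) (sum_nonneg fun _ _ => oddInv_nonneg _)
  refine le_trans ?_ (sum_le_sum_of_subset_of_nonneg hsub fun q _ _ => hnn q)
  obtain ⟨h1, h9, h49, h81, h121⟩ := sqInv_values
  have hall : ∑ q ∈ ({1, 9, 49, 81, 121} : Finset ℕ), sqInv q * (1 / 2 * L)
      ≤ ∑ q ∈ ({1, 9, 49, 81, 121} : Finset ℕ),
        sqInv q * ∑ m ∈ Ioc 0 (y / q), toArith oddInv m := by
    refine sum_le_sum fun q hq => mul_le_mul_of_nonneg_left (hinner q ?_ ?_) (sqInv_nonneg q)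
    all_goals simp only [mem_insert, mem_singleton] at hq; omega
  refine le_trans ?_ hall
  simp only [← sum_mul]
  rw [sum_insert (by decide), sum_insert (by decide), sum_insert (by decide),
    sum_insert (by decide), sum_singleton, h1, h9, h49, h81, h121]
  nlinarith

/-- Lower bound for the sum of reciprocals of numbers composed of primes `3` mod `4`. -/
lemma eventually_le_T_sq : ∀ᶠ y : ℕ in atTop, 0.73 * Real.log y ≤ T y ^ 2 := by
  have hlog : Tendsto (fun y : ℕ => Real.log (y : ℝ)) atTop atTop :=
    Real.tendsto_log_atTop.comp tendsto_natCast_atTop_atTop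
  filter_upwards [eventually_ge_atTop 242,
    hlog.eventually_ge_atTop (10 ^ 7), hlog.eventually_ge_atTop (10 ^ 4 * Real.log 242)]
    with y hy h1 h2
  by_contra! hlt
  have hy' : (242 : ℝ) ≤ y := by exact_mod_cast hy
  have hlow := le_sum_sqInv_mul_oddInv hy
  have hup := sum_sqInv_mul_oddInv_le (y := y) (by omega)
  rw [Real.log_div (by positivity) (by norm_num)] at hlow
  have hpi := Real.pi_lt_d4
  set l := Real.log (y : ℝ)
  have hT := T_nonneg y
  have hTl : T y ≤ 0.001 * l := by
    refine abs_le_of_sq_le_sq' ?_ (by positivity) |>.2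
    nlinarith
  nlinarith [Real.pi_pos, sq_nonneg (T y)]

/-- The squarefree numbers up to `z` composed of primes `3` mod `4`. -/
noncomputable def sieveSet (z : ℕ) : Finset ℕ := {d ∈ Ioc 0 z | Squarefree d ∧ PrimesMod 3 d}

lemma mem_sieveSet {z d : ℕ} : d ∈ sieveSet z ↔ d ≤ z ∧ Squarefree d ∧ PrimesMod 3 d := by
  simp only [sieveSet, mem_filter, mem_Ioc]
  exact ⟨fun h => ⟨h.1.2, h.2⟩, fun h => ⟨⟨h.2.2.pos, h.1⟩, h.2⟩⟩

lemma mem_sieveSet_of_dvd {z d m : ℕ} (hm : m ∈ sieveSet z) (hd : d ∣ m) : d ∈ sieveSet z := by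
  rw [mem_sieveSet] at *
  exact ⟨(Nat.le_of_dvd hm.2.2.pos hd).trans hm.1, hm.2.1.squarefree_of_dvd hd, hm.2.2.of_dvd hd⟩

lemma pos_of_mem_sieveSet {z d : ℕ} (hd : d ∈ sieveSet z) : 0 < d := (mem_sieveSet.mp hd).2.2.pos

lemma one_mem_sieveSet {z : ℕ} (hz : 1 ≤ z) : 1 ∈ sieveSet z :=
  mem_sieveSet.mpr ⟨hz, squarefree_one, primesMod_one 3⟩

/-- The normalising sum of the Selberg sieve. -/
noncomputable def sieveSum (z : ℕ) : ℝ := ∑ l ∈ sieveSet z, (Nat.totient l : ℝ)⁻¹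

lemma one_le_sieveSum {z : ℕ} (hz : 1 ≤ z) : 1 ≤ sieveSum z := by
  have := single_le_sum (f := fun l => (Nat.totient l : ℝ)⁻¹)
    (fun _ _ => by positivity) (one_mem_sieveSet hz)
  rw [sieveSum]
  simpa using this

lemma sum_inv_le_inv_totient (l : ℕ) (hl : Squarefree l) (s : Finset ℕ)
    (hs : ∀ n ∈ s, n ≠ 0 ∧ ∏ p ∈ n.primeFactors, p = l) :
    ∑ n ∈ s, (n : ℝ)⁻¹ ≤ (Nat.totient l : ℝ)⁻¹ := by
  have hl0 : (l : ℝ) ≠ 0 := by exact_mod_cast hl.ne_zero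
  let f : ℕ →* ℝ :=
    { toFun := fun n => (n : ℝ)⁻¹
      map_one' := by simp
      map_mul' := fun m n => by push_cast; rw [mul_inv] }
  have hf (n : ℕ) : f n = (n : ℝ)⁻¹ := rfl
  have hnorm {p : ℕ} (hp : p.Prime) : ‖f p‖ < 1 := by
    rw [hf, norm_inv, RCLike.norm_natCast]
    exact inv_lt_one_of_one_lt₀ (by exact_mod_cast hp.one_lt)
  have hsum := (EulerProduct.summable_and_hasSum_factoredNumbers_prod_filter_prime_geometric
    (f := f) hnorm l.primeFactors).2
  have hprod : ∏ p ∈ l.primeFactors with p.Prime, (1 - f p)⁻¹ = l * (Nat.totient l : ℝ)⁻¹ := by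
    rw [filter_true_of_mem fun p hp => Nat.prime_of_mem_primeFactors hp, prod_inv_distrib]
    have h : (Nat.totient l : ℝ) = l * ∏ p ∈ l.primeFactors, (1 - (p : ℝ)⁻¹) := by
      have h := congrArg (Rat.cast : ℚ → ℝ) (Nat.totient_eq_mul_prod_factors l)
      push_cast at h
      exact h
    rw [h, mul_inv, mul_inv_cancel_left₀ hl0]
    rfl
  rw [hprod, show (fun m : Nat.factoredNumbers l.primeFactors => f m) = f ∘ Subtype.val from rfl,
    hasSum_subtype_iff_indicator] at hsum
  have hdvd (n : ℕ) (hn : n ∈ s) : l ∣ n := (hs n hn).2 ▸ Nat.prod_primeFactors_dvd n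
  have hinj : Set.InjOn (fun n => n / l) s := by
    intro m hm n hn h
    rw [← Nat.div_mul_cancel (hdvd m hm), ← Nat.div_mul_cancel (hdvd n hn)]
    exact congrArg (· * l) h
  have hle := sum_le_hasSum (s.image fun n => n / l)
    (fun n _ => Set.indicator_nonneg (fun n _ => by rw [hf]; positivity) n) hsum
  rw [sum_image hinj] at hle
  have hterm (n : ℕ) (hn : n ∈ s) :
      Set.indicator (Nat.factoredNumbers l.primeFactors) f (n / l) = l * (n : ℝ)⁻¹ := by
    obtain ⟨k, hk⟩ := hdvd n hn
    have hn0 := (hs n hn).1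
    have hk' : n / l = k := by rw [hk, Nat.mul_div_cancel_left _ (Nat.pos_of_ne_zero hl.ne_zero)]
    have hk0 : k ≠ 0 := fun h => hn0 (by rw [hk, h, mul_zero])
    have hmem : k ∈ Nat.factoredNumbers l.primeFactors := by
      refine (Nat.mem_factoredNumbers_iff_primeFactors_subset).mpr ⟨hk0, fun p hp => ?_⟩
      have hpn : p ∈ n.primeFactors := Nat.primeFactors_mono (Dvd.intro_left l hk.symm) hn0 hp
      have := Finset.dvd_prod_of_mem (fun p => p) hpn
      rw [(hs n hn).2] at this
      exact Nat.mem_primeFactors.mpr ⟨Nat.prime_of_mem_primeFactors hp, this, hl.ne_zero⟩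
    rw [hk', Set.indicator_of_mem hmem, hf, hk]
    push_cast
    rw [mul_inv, mul_inv_cancel_left₀ hl0]
  rw [sum_congr rfl hterm, ← mul_sum] at hle
  have hl1 : (0 : ℝ) < l := by exact_mod_cast Nat.pos_of_ne_zero hl.ne_zero
  exact le_of_mul_le_mul_left hle hl1

lemma T_le_sieveSum (z : ℕ) : T z ≤ sieveSum z := by
  have hT : T z = ∑ n ∈ Ioc 0 z with PrimesMod 3 n, (n : ℝ)⁻¹ := by
    simp_rw [T, invOn_apply, sum_filter]
  have hmaps : ∀ n ∈ {n ∈ Ioc 0 z | PrimesMod 3 n}, ∏ p ∈ n.primeFactors, p ∈ sieveSet z := by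
    intro n hn
    rw [mem_filter, mem_Ioc] at hn
    have hd := Nat.prod_primeFactors_dvd n
    refine mem_sieveSet.mpr ⟨(Nat.le_of_dvd hn.1.1 hd).trans hn.1.2, ?_, hn.2.of_dvd hd⟩
    refine Finset.squarefree_prod_of_pairwise_isCoprime ?_ ?_
    · intro p hp q hq hpq
      exact Nat.coprime_iff_isRelPrime.mp ((Nat.coprime_primes (Nat.prime_of_mem_primeFactors hp)
        (Nat.prime_of_mem_primeFactors hq)).mpr hpq)
    · exact fun p hp => (Nat.prime_of_mem_primeFactors hp).squarefree
  rw [hT, ← sum_fiberwise_of_maps_to hmaps, sieveSum]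
  refine sum_le_sum fun l hl => sum_inv_le_inv_totient l (mem_sieveSet.mp hl).2.1 _ fun n hn => ?_
  rw [mem_filter, mem_filter, mem_Ioc] at hn
  exact ⟨by omega, hn.2⟩

/-- The coefficient `λ_d / d` of the Selberg sieve. -/
noncomputable def sieveCoeff (z d : ℕ) : ℝ :=
  ArithmeticFunction.moebius d / sieveSum z * ∑ m ∈ sieveSet z with d ∣ m, (Nat.totient m : ℝ)⁻¹

lemma sieveCoeff_one {z : ℕ} (hz : 1 ≤ z) : sieveCoeff z 1 = 1 := by
  have := one_le_sieveSum hz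
  rw [sieveCoeff, filter_true_of_mem fun _ _ => one_dvd _, ← sieveSum]
  simp
  rw [inv_mul_cancel₀ (by linarith)]

lemma sum_moebius_between {l m : ℕ} (hm : Squarefree m) (hl : l ∣ m) :
    ∑ d ∈ m.divisors with l ∣ d, ArithmeticFunction.moebius d
      = if m = l then ArithmeticFunction.moebius l else 0 := by
  obtain ⟨k, rfl⟩ := hl
  have hl0 : l ≠ 0 := left_ne_zero_of_mul hm.ne_zero
  have hk0 : k ≠ 0 := right_ne_zero_of_mul hm.ne_zero
  have hcop : l.Coprime k := (Nat.squarefree_mul_iff.mp hm).1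
  have hset : {d ∈ (l * k).divisors | l ∣ d} = k.divisors.image (l * ·) := by
    ext d
    simp only [mem_filter, Nat.mem_divisors, mem_image]
    constructor
    · rintro ⟨⟨h1, -⟩, e, rfl⟩
      exact ⟨e, ⟨Nat.dvd_of_mul_dvd_mul_left (Nat.pos_of_ne_zero hl0) h1, hk0⟩, rfl⟩
    · rintro ⟨e, ⟨h1, -⟩, rfl⟩
      exact ⟨⟨mul_dvd_mul_left l h1, mul_ne_zero hl0 hk0⟩, dvd_mul_right l e⟩
  rw [hset, sum_image fun _ _ _ _ h => Nat.eq_of_mul_eq_mul_left (Nat.pos_of_ne_zero hl0) h]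
  have hmul : ∀ e ∈ k.divisors, ArithmeticFunction.moebius (l * e)
      = ArithmeticFunction.moebius l * ArithmeticFunction.moebius e := fun e he =>
    ArithmeticFunction.isMultiplicative_moebius.map_mul_of_coprime
      (hcop.coprime_dvd_right (Nat.dvd_of_mem_divisors he))
  rw [sum_congr rfl hmul, ← mul_sum, ← ArithmeticFunction.coe_mul_zeta_apply,
    ArithmeticFunction.moebius_mul_coe_zeta, ArithmeticFunction.one_apply]
  by_cases h : k = 1
  · simp [h]
  · have : ¬ l * k = l := fun h' => h (Nat.eq_of_mul_eq_mul_left (Nat.pos_of_ne_zero hl0)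
      (h'.trans (mul_one l).symm))
    simp [h, this]

lemma sum_sieveCoeff {z l : ℕ} (hl : l ∈ sieveSet z) :
    ∑ d ∈ sieveSet z with l ∣ d, sieveCoeff z d
      = ArithmeticFunction.moebius l / sieveSum z * (Nat.totient l : ℝ)⁻¹ := by
  have hswap : ∑ d ∈ sieveSet z with l ∣ d, sieveCoeff z d = ∑ m ∈ sieveSet z,
      (sieveSum z)⁻¹ * (Nat.totient m : ℝ)⁻¹ *
        ((∑ d ∈ m.divisors with l ∣ d, ArithmeticFunction.moebius d : ℤ) : ℝ) := by
    simp_rw [sieveCoeff, mul_sum, Int.cast_sum, mul_sum]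
    rw [sum_comm' (t' := sieveSet z) (s' := fun m => {d ∈ m.divisors | l ∣ d})]
    · refine sum_congr rfl fun m _ => sum_congr rfl fun d _ => ?_
      ring
    · intro d m
      simp only [mem_filter, Nat.mem_divisors]
      constructor
      · rintro ⟨⟨_, h2⟩, h3, h4⟩
        exact ⟨⟨⟨h4, (pos_of_mem_sieveSet h3).ne'⟩, h2⟩, h3⟩
      · rintro ⟨⟨⟨h1, _⟩, h2⟩, h3⟩
        exact ⟨⟨mem_sieveSet_of_dvd h3 h1, h2⟩, h3, h1⟩
  rw [hswap, sum_eq_single_of_mem l hl]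
  · rw [sum_moebius_between (mem_sieveSet.mp hl).2.1 dvd_rfl, if_pos rfl]
    ring
  · intro m hm hne
    by_cases h : l ∣ m
    · rw [sum_moebius_between (mem_sieveSet.mp hm).2.1 h, if_neg hne]
      simp
    · rw [filter_false_of_mem fun d hd hld => h (hld.trans (Nat.dvd_of_mem_divisors hd))]
      simp

lemma sum_sieveCoeff_mul_gcd {z : ℕ} (hz : 1 ≤ z) :
    ∑ d ∈ sieveSet z, ∑ e ∈ sieveSet z, sieveCoeff z d * sieveCoeff z e * (Nat.gcd d e : ℝ)
      = (sieveSum z)⁻¹ := by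
  have hS := one_le_sieveSum hz
  have hgcd (d e : ℕ) (hd : d ∈ sieveSet z) (he : e ∈ sieveSet z) : (Nat.gcd d e : ℝ)
      = ∑ l ∈ sieveSet z, if l ∣ d ∧ l ∣ e then (Nat.totient l : ℝ) else 0 := by
    rw [← sum_filter]
    have : {l ∈ sieveSet z | l ∣ d ∧ l ∣ e} = (Nat.gcd d e).divisors := by
      ext l
      rw [mem_filter, Nat.mem_divisors, Nat.dvd_gcd_iff]
      exact ⟨fun h => ⟨h.2, (Nat.gcd_pos_of_pos_left _ (pos_of_mem_sieveSet hd)).ne'⟩,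
        fun h => ⟨mem_sieveSet_of_dvd hd h.1.1, h.1⟩⟩
    rw [this]
    exact_mod_cast (Nat.sum_totient _).symm
  calc _ = ∑ d ∈ sieveSet z, ∑ e ∈ sieveSet z, ∑ l ∈ sieveSet z, (Nat.totient l : ℝ) *
        ((if l ∣ d then sieveCoeff z d else 0) * (if l ∣ e then sieveCoeff z e else 0)) := by
        refine sum_congr rfl fun d hd => sum_congr rfl fun e he => ?_
        rw [hgcd d e hd he, mul_sum]
        refine sum_congr rfl fun l _ => ?_
        by_cases h1 : l ∣ d <;> by_cases h2 : l ∣ e <;> simp [h1, h2]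
        ring
    _ = ∑ l ∈ sieveSet z, (Nat.totient l : ℝ) *
        (∑ d ∈ sieveSet z with l ∣ d, sieveCoeff z d) ^ 2 := by
        simp_rw [sum_comm (t := sieveSet z) (s := sieveSet z) (f := fun e l => (Nat.totient l : ℝ) *
          ((if l ∣ _ then sieveCoeff z _ else 0) * (if l ∣ e then sieveCoeff z e else 0)))]
        rw [sum_comm]
        refine sum_congr rfl fun l _ => ?_
        rw [sum_filter, sq, sum_mul_sum, mul_sum]
        refine sum_congr rfl fun d _ => ?_
        rw [mul_sum]
    _ = ∑ l ∈ sieveSet z, (sieveSum z)⁻¹ ^ 2 * (Nat.totient l : ℝ)⁻¹ := by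
        refine sum_congr rfl fun l hl => ?_
        have hφ : (Nat.totient l : ℝ) ≠ 0 := by
          exact_mod_cast (Nat.totient_pos.mpr (pos_of_mem_sieveSet hl)).ne'
        have hμ : (ArithmeticFunction.moebius l : ℝ) ^ 2 = 1 := by
          exact_mod_cast ArithmeticFunction.moebius_sq_eq_one_of_squarefree (mem_sieveSet.mp hl).2.1
        rw [sum_sieveCoeff hl, mul_pow, div_pow, hμ]
        field_simp
    _ = _ := by
        rw [← mul_sum, ← sieveSum]
        field_simp

lemma sigma_le_sigma_mul_totient {m : ℕ} (hm : Squarefree m) (h : PrimesMod 3 m) :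
    ArithmeticFunction.sigma 1 m ≤ ArithmeticFunction.sigma 0 m * Nat.totient m := by
  induction m using induction_on_primes with
  | zero => simp
  | one => simp
  | prime_mul p a hp ih =>
    have hsq := Nat.squarefree_mul_iff.mp hm
    have hP := primesMod_mul.mp h
    have hp3 : 3 ≤ p := by have := (primesMod_prime hp).mp hP.1; have := hp.two_le; omega
    rw [ArithmeticFunction.isMultiplicative_sigma.map_mul_of_coprime hsq.1,
      ArithmeticFunction.isMultiplicative_sigma.map_mul_of_coprime hsq.1,
      Nat.totient_mul hsq.1, Nat.totient_prime hp]
    have h1 : ArithmeticFunction.sigma 1 p = p + 1 := by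
      rw [ArithmeticFunction.sigma_one_apply, hp.sum_divisors]
    have h0 : ArithmeticFunction.sigma 0 p = 2 := by
      rw [ArithmeticFunction.sigma_zero_apply, hp.divisors, card_pair hp.one_lt.ne]
    rw [h1, h0]
    calc (p + 1) * ArithmeticFunction.sigma 1 a
        ≤ (2 * (p - 1)) * (ArithmeticFunction.sigma 0 a * Nat.totient a) :=
          Nat.mul_le_mul (by omega) (ih hsq.2.2 hP.2)
      _ = _ := by ring

lemma sum_abs_sieveCoeff_le {z : ℕ} (hz : 1 ≤ z) :
    ∑ d ∈ sieveSet z, |d * sieveCoeff z d| ≤ z * (1 + Real.log z) := by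
  have hS := one_le_sieveSum hz
  have habs (d : ℕ) (hd : d ∈ sieveSet z) : |d * sieveCoeff z d|
      ≤ ∑ m ∈ sieveSet z with d ∣ m, d * (Nat.totient m : ℝ)⁻¹ := by
    have hμ : |(ArithmeticFunction.moebius d : ℝ)| = 1 := by
      exact_mod_cast ArithmeticFunction.abs_moebius_eq_one_of_squarefree (mem_sieveSet.mp hd).2.1
    have hnn : 0 ≤ ∑ m ∈ sieveSet z with d ∣ m, (Nat.totient m : ℝ)⁻¹ :=
      sum_nonneg fun _ _ => by positivity
    rw [sieveCoeff, abs_mul, abs_mul, abs_div, hμ, Nat.abs_cast, abs_of_nonneg hnn, ← mul_sum,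
      abs_of_pos (by linarith)]
    refine mul_le_mul_of_nonneg_left (mul_le_of_le_one_left hnn ?_) (by positivity)
    rw [div_le_one (by linarith)]
    exact hS
  calc _ ≤ ∑ d ∈ sieveSet z, ∑ m ∈ sieveSet z with d ∣ m, d * (Nat.totient m : ℝ)⁻¹ :=
        sum_le_sum habs
    _ = ∑ m ∈ sieveSet z, ∑ d ∈ m.divisors, d * (Nat.totient m : ℝ)⁻¹ := by
        refine sum_comm' fun d m => ?_
        simp only [mem_filter, Nat.mem_divisors]
        exact ⟨fun h => ⟨⟨h.2.2, (pos_of_mem_sieveSet h.2.1).ne'⟩, h.2.1⟩,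
          fun h => ⟨mem_sieveSet_of_dvd h.2 h.1.1, h.2, h.1.1⟩⟩
    _ ≤ ∑ m ∈ sieveSet z, (ArithmeticFunction.sigma 0 m : ℝ) := by
        refine sum_le_sum fun m hm => ?_
        have hm' := mem_sieveSet.mp hm
        have hφ : (0 : ℝ) < Nat.totient m := by
          exact_mod_cast Nat.totient_pos.mpr (pos_of_mem_sieveSet hm)
        rw [← sum_mul, mul_inv_le_iff₀ hφ]
        have := sigma_le_sigma_mul_totient hm'.2.1 hm'.2.2
        rw [ArithmeticFunction.sigma_one_apply] at this
        have hcast : ((∑ d ∈ m.divisors, d : ℕ) : ℝ)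
            ≤ ((ArithmeticFunction.sigma 0 m * Nat.totient m : ℕ) : ℝ) := Nat.cast_le.mpr this
        push_cast at hcast
        exact hcast
    _ ≤ ∑ m ∈ Ioc 0 z, (ArithmeticFunction.sigma 0 m : ℝ) :=
        sum_le_sum_of_subset_of_nonneg (filter_subset _ _) fun _ _ _ => by positivity
    _ = ∑ n ∈ Ioc 0 z, ((z / n : ℕ) : ℝ) := by
        exact_mod_cast ArithmeticFunction.sum_Ioc_sigma0_eq_sum_div z
    _ ≤ z * (harmonic z : ℝ) := by
        rw [harmonic_eq_sum_Icc]
        push_cast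
        rw [mul_sum]
        exact sum_le_sum fun n _ => by rw [← div_eq_mul_inv]; exact Nat.cast_div_le
    _ ≤ _ := mul_le_mul_of_nonneg_left (harmonic_le_one_add_log z) (by positivity)


lemma card_mod_four_dvd_le {d : ℕ} (hd : d % 2 = 1) (y : ℕ) :
    |(#{n ∈ Ioc 0 y | n % 4 = 1 ∧ d ∣ n} : ℝ) - y / (4 * d)| ≤ 1 := by
  have hcop : Nat.Coprime 4 d := by
    rw [show 4 = 2 ^ 2 by norm_num]
    exact Nat.Coprime.pow_left 2 ((Nat.coprime_two_left).mpr (Nat.odd_iff.mpr hd))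
  obtain ⟨v, hv4, hvd⟩ := Nat.chineseRemainder hcop 1 0
  have hset : {n ∈ Ioc 0 y | n % 4 = 1 ∧ d ∣ n} = {n ∈ Ioc 0 y | n ≡ v [MOD 4 * d]} := by
    refine filter_congr fun n _ => ?_
    rw [← Nat.modEq_and_modEq_iff_modEq_mul hcop]
    refine and_congr ?_ ?_
    · exact ⟨fun h => Nat.ModEq.trans (show n ≡ 1 [MOD 4] from h) hv4.symm, fun h => h.trans hv4⟩
    · exact ⟨fun h => ((Nat.modEq_zero_iff_dvd).mpr h).trans hvd.symm,
        fun h => (Nat.modEq_zero_iff_dvd).mp (h.trans hvd)⟩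
  have hr : 0 < 4 * d := by omega
  have hcard : (#{n ∈ Ioc 0 y | n ≡ v [MOD 4 * d]} : ℚ)
      = max (⌊((y : ℚ) - v) / (4 * d : ℕ)⌋ - ⌊(((0 : ℕ) : ℚ) - v) / (4 * d : ℕ)⌋ : ℚ) 0 := by
    exact_mod_cast congrArg (Int.cast : ℤ → ℚ) (Nat.Ioc_filter_modEq_card 0 y hr v)
  have hsub : ((y : ℚ) - v) / (4 * d : ℕ) - (((0 : ℕ) : ℚ) - v) / (4 * d : ℕ) = y / (4 * d) := by
    push_cast
    ring
  have hnn : (0 : ℚ) ≤ y / (4 * d) := by positivity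
  have h1 := Int.floor_le (((y : ℚ) - v) / (4 * d : ℕ))
  have h2 := Int.lt_floor_add_one (((y : ℚ) - v) / (4 * d : ℕ))
  have h3 := Int.floor_le ((((0 : ℕ) : ℚ) - v) / (4 * d : ℕ))
  have h4 := Int.lt_floor_add_one ((((0 : ℕ) : ℚ) - v) / (4 * d : ℕ))
  have key : |(#{n ∈ Ioc 0 y | n ≡ v [MOD 4 * d]} : ℚ) - y / (4 * d)| ≤ 1 := by
    rw [hcard, abs_le]
    constructor
    · linarith [le_max_left (⌊((y : ℚ) - v) / (4 * d : ℕ)⌋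
        - ⌊(((0 : ℕ) : ℚ) - v) / (4 * d : ℕ)⌋ : ℚ) 0]
    · rw [sub_le_iff_le_add]
      exact max_le (by linarith) (by linarith)
  rw [hset]
  have hcast := (Rat.cast_le (K := ℝ)).mpr key
  push_cast at hcast
  exact hcast

lemma PrimesMod.mod_four {n : ℕ} (h : PrimesMod 1 n) : n % 4 = 1 := by
  induction n using induction_on_primes with
  | zero => exact absurd rfl h.1
  | one => rfl
  | prime_mul p m hp ih =>
    rw [primesMod_mul] at h
    rw [Nat.mul_mod, (primesMod_prime hp).mp h.1, ih h.2]

lemma PrimesMod.odd {n : ℕ} (h : PrimesMod 3 n) : n % 2 = 1 := by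
  by_contra hn
  have := h.2 2 Nat.prime_two (by omega)
  omega

lemma PrimesMod.eq_one {d n : ℕ} (hd : PrimesMod 3 d) (hn : PrimesMod 1 n) (h : d ∣ n) :
    d = 1 := by
  by_contra h1
  obtain ⟨p, hp, hpd⟩ := Nat.exists_prime_and_dvd h1
  have := hd.2 p hp hpd
  have := hn.2 p hp (hpd.trans h)
  omega

/-- Selberg's sieve bound for numbers composed of primes `1` mod `4`. -/
lemma card_primesMod_one_le (y : ℕ) {z : ℕ} (hz : 1 ≤ z) :
    (#{n ∈ Ioc 0 y | PrimesMod 1 n} : ℝ) ≤ y / (4 * T z) + (z * (1 + Real.log z)) ^ 2 := by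
  set S := sieveSet z
  set c : ℕ → ℝ := fun d => d * sieveCoeff z d with hc
  have hone (n : ℕ) (hn : PrimesMod 1 n) : ∑ d ∈ S, (if d ∣ n then c d else 0) = 1 := by
    rw [sum_eq_single_of_mem 1 (one_mem_sieveSet hz)]
    · simp [hc, sieveCoeff_one hz]
    · exact fun d hd hd1 => if_neg fun h => hd1 ((mem_sieveSet.mp hd).2.2.eq_one hn h)
  have hterm (d e : ℕ) (hd : d ∈ S) (he : e ∈ S) :
      c d * c e * (#{n ∈ Ioc 0 y | n % 4 = 1 ∧ Nat.lcm d e ∣ n} : ℝ)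
        ≤ y / 4 * (sieveCoeff z d * sieveCoeff z e * (Nat.gcd d e : ℝ)) + |c d| * |c e| := by
    have hodd : Nat.lcm d e % 2 = 1 :=
      Nat.odd_iff.mp ((Nat.odd_mul.mpr ⟨Nat.odd_iff.mpr (mem_sieveSet.mp hd).2.2.odd,
        Nat.odd_iff.mpr (mem_sieveSet.mp he).2.2.odd⟩).of_dvd_nat (Nat.lcm_dvd_mul d e))
    have hL : (Nat.lcm d e : ℝ) ≠ 0 := by exact_mod_cast (by omega : Nat.lcm d e ≠ 0)
    have hgl : (Nat.gcd d e : ℝ) * Nat.lcm d e = d * e := by exact_mod_cast Nat.gcd_mul_lcm d e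
    have heq : y / 4 * (sieveCoeff z d * sieveCoeff z e * (Nat.gcd d e : ℝ))
        = c d * c e * (y / (4 * (Nat.lcm d e : ℝ))) := by
      have : c d * c e = sieveCoeff z d * sieveCoeff z e * ((Nat.gcd d e : ℝ) * Nat.lcm d e) := by
        rw [hgl]
        ring
      rw [this]
      field_simp
    rw [heq, ← abs_mul, ← sub_le_iff_le_add', ← mul_sub]
    refine (le_abs_self _).trans ?_
    rw [abs_mul]
    exact mul_le_of_le_one_right (abs_nonneg _) (card_mod_four_dvd_le hodd y)
  have hT : 0 < T z := by linarith [one_le_T hz]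
  calc (#{n ∈ Ioc 0 y | PrimesMod 1 n} : ℝ)
      = ∑ n ∈ Ioc 0 y with PrimesMod 1 n, (∑ d ∈ S, (if d ∣ n then c d else 0)) ^ 2 := by
        rw [sum_congr rfl fun n hn => by rw [hone n (mem_filter.mp hn).2, one_pow]]
        simp
    _ ≤ ∑ n ∈ Ioc 0 y with n % 4 = 1, (∑ d ∈ S, (if d ∣ n then c d else 0)) ^ 2 :=
        sum_le_sum_of_subset_of_nonneg
          (monotone_filter_right _ fun _ _ h => h.mod_four) fun _ _ _ => sq_nonneg _
    _ = ∑ d ∈ S, ∑ e ∈ S, c d * c e * (#{n ∈ Ioc 0 y | n % 4 = 1 ∧ Nat.lcm d e ∣ n} : ℝ) := by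
        simp_rw [sq, sum_mul_sum]
        rw [sum_comm]
        refine sum_congr rfl fun d _ => ?_
        rw [sum_comm]
        refine sum_congr rfl fun e _ => ?_
        rw [← filter_filter, card_filter, Nat.cast_sum, mul_sum]
        refine sum_congr rfl fun n _ => ?_
        by_cases h1 : d ∣ n <;> by_cases h2 : e ∣ n <;> simp [h1, h2, Nat.lcm_dvd_iff]
    _ ≤ ∑ d ∈ S, ∑ e ∈ S, (y / 4 * (sieveCoeff z d * sieveCoeff z e * (Nat.gcd d e : ℝ))
          + |c d| * |c e|) :=
        sum_le_sum fun d hd => sum_le_sum fun e he => hterm d e hd he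
    _ = y / 4 * (sieveSum z)⁻¹ + (∑ d ∈ S, |c d|) ^ 2 := by
        rw [← sum_sieveCoeff_mul_gcd hz, sq, sum_mul_sum, mul_sum, ← sum_add_distrib]
        refine sum_congr rfl fun d _ => ?_
        rw [mul_sum, ← sum_add_distrib]
    _ ≤ _ := by
        refine add_le_add ?_ ?_
        · rw [← div_div, div_eq_mul_inv _ (T z)]
          gcongr
          exact T_le_sieveSum z
        · exact pow_le_pow_left₀ (sum_nonneg fun _ _ => abs_nonneg _) (sum_abs_sieveCoeff_le hz) 2

lemma exists_mul_of_odd {n : ℕ} (hn : n % 2 = 1) :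
    ∃ d e, n = d * e ∧ PrimesMod 1 d ∧ PrimesMod 3 e := by
  have h := congrArg (fun f : ArithmeticFunction ℝ => f n) invOn_one_mul_invOn_three
  simp only [ArithmeticFunction.mul_apply, toArith_apply, oddInv_apply, if_pos hn] at h
  have hn0 : (n : ℝ)⁻¹ ≠ 0 := inv_ne_zero (by exact_mod_cast (by omega : n ≠ 0))
  obtain ⟨⟨d, e⟩, hmem, hne⟩ := exists_ne_zero_of_sum_ne_zero (h.symm ▸ hn0)
  have hd := left_ne_zero_of_mul hne
  have he := right_ne_zero_of_mul hne
  simp only [invOn_apply, ne_eq, ite_eq_right_iff, not_forall] at hd he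
  exact ⟨d, e, (Nat.mem_divisorsAntidiagonal.mp hmem).1.symm, hd.1, he.1⟩

/-- Every positive sum of two squares is a power of two, times the square of a number composed of
primes `3` mod `4`, times a number composed of primes `1` mod `4`. -/
lemma exists_eq_two_pow_mul_sq_mul {n : ℕ} (hn : n ≠ 0) (h : IsSumTwoSquares n) :
    ∃ j q m, n = 2 ^ j * q ^ 2 * m ∧ PrimesMod 3 q ∧ PrimesMod 1 m := by
  obtain ⟨x, y, hxy⟩ := h
  have hnat : ∃ x y : ℕ, n = x ^ 2 + y ^ 2 := by
    refine ⟨x.natAbs, y.natAbs, ?_⟩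
    zify
    simpa using hxy
  obtain ⟨c, d, rfl, hd⟩ := Nat.eq_sq_add_sq_iff_eq_sq_mul.mp hnat
  have hd0 : d ≠ 0 := right_ne_zero_of_mul hn
  have hc0 : c ≠ 0 := fun h => hn (by simp [h])
  obtain ⟨i, c', hc', rfl⟩ := Nat.exists_eq_two_pow_mul_odd hc0
  obtain ⟨j, d', hd', rfl⟩ := Nat.exists_eq_two_pow_mul_odd hd0
  obtain ⟨u, v, rfl, hu, hv⟩ := exists_mul_of_odd (Nat.odd_iff.mp hc')
  refine ⟨2 * i + j, v, u ^ 2 * d', by ring, hv, ?_⟩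
  rw [sq, primesMod_mul, primesMod_mul]
  refine ⟨⟨hu, hu⟩, right_ne_zero_of_mul hd0, fun p hp hpd => ?_⟩
  have h3 := Nat.mod_four_ne_three_of_mem_primeFactors_of_isSquare_neg_one
    (Nat.mem_primeFactors.mpr ⟨hp, hpd.mul_left _, hd0⟩) hd
  rcases prime_mod_four hp with rfl | h1 | h1
  · exact absurd (hd'.of_dvd_nat hpd) (by decide)
  · exact h1
  · exact absurd h1 h3

lemma sum_inv_sq_le (k : ℕ) :
    ∑ q ∈ Ioc 0 k with PrimesMod 3 q, ((q : ℝ) ^ 2)⁻¹ ≤ 1.18 := by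
  set f : ℕ → ℝ := fun q => if PrimesMod 3 q then ((q : ℝ) ^ 2)⁻¹ else 0 with hf
  have hle (q : ℕ) : f q ≤ ((q : ℝ) ^ 2)⁻¹ := by
    simp only [hf]
    split_ifs
    · rfl
    · positivity
  have hnn (q : ℕ) : 0 ≤ f q := by
    simp only [hf]
    split_ifs
    · positivity
    · rfl
  have hzero {p q : ℕ} (hp : p.Prime) (hpq : p ∣ q) (h : p % 4 ≠ 3) : f q = 0 :=
    if_neg fun hq => h (hq.2 p hp hpq)
  have hbound (n : ℕ) (hn : 9 ≤ n) : ∑ q ∈ Ioc 0 (2 * n), f q ≤ 1.18 - 1 / (4 * n) := by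
    induction n, hn using Nat.le_induction with
    | base =>
      have h2 (q : ℕ) : f (2 * q) = 0 := hzero Nat.prime_two (dvd_mul_right 2 q) (by norm_num)
      have h5 (q : ℕ) : f (5 * q) = 0 :=
        hzero (by norm_num : Nat.Prime 5) (dvd_mul_right 5 q) (by norm_num)
      have h13 : f 13 = 0 := hzero (by norm_num : Nat.Prime 13) dvd_rfl (by norm_num)
      have h17 : f 17 = 0 := hzero (by norm_num : Nat.Prime 17) dvd_rfl (by norm_num)
      simp only [Nat.reduceMul, sum_Ioc_succ_top (Nat.zero_le _), Ioc_self, sum_empty, zero_add,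
        Nat.reduceAdd]
      rw [h2 1, h2 2, h5 1, h2 3, h2 4, h2 5, h2 6, h13, h2 7, h5 3, h2 8, h17, h2 9]
      have := hle 1
      have := hle 3
      have := hle 7
      have := hle 9
      have := hle 11
      norm_num at *
      linarith
    | succ n hn ih =>
      have h2 : f (2 * n + 1 + 1) = 0 :=
        hzero Nat.prime_two (Dvd.intro (n + 1) (by ring)) (by norm_num)
      have h1 := hle (2 * n + 1)
      rw [show 2 * (n + 1) = 2 * n + 1 + 1 by ring, sum_Ioc_succ_top (Nat.zero_le _),
        sum_Ioc_succ_top (Nat.zero_le _), h2]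
      have hn0 : (0 : ℝ) < n := by exact_mod_cast (by omega : 0 < n)
      have : (((2 * n + 1 : ℕ) : ℝ) ^ 2)⁻¹ ≤ 1 / (4 * n) - 1 / (4 * (n + 1 : ℕ)) := by
        push_cast
        rw [show (1 : ℝ) / (4 * n) - 1 / (4 * (n + 1)) = (4 * n * (n + 1) : ℝ)⁻¹ by
          field_simp
          ring]
        exact inv_anti₀ (by positivity) (by nlinarith)
      linarith
  rw [sum_filter]
  refine (sum_le_sum_of_subset_of_nonneg (Ioc_subset_Ioc_right (by omega : k ≤ 2 * (k + 9)))
    fun q _ _ => hnn q).trans ((hbound (k + 9) (by omega)).trans ?_)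
  rw [sub_le_self_iff]
  positivity

/-- The number of positive sums of two squares up to `x`. -/
noncomputable def countSq (x : ℕ) : ℕ := #{n ∈ Ioc 0 x | IsSumTwoSquares n}

lemma countSq_le_sum (x k : ℕ) :
    countSq x ≤ ∑ j ∈ range k, ∑ q ∈ Ioc 0 k with PrimesMod 3 q,
      #{m ∈ Ioc 0 (x / (2 ^ j * q ^ 2)) | PrimesMod 1 m} + x / 2 ^ k
      + ∑ q ∈ Ioc k x, x / q ^ 2 := by
  have hsub : {n ∈ Ioc 0 x | IsSumTwoSquares n} ⊆
      ((range k).biUnion (fun j => {q ∈ Ioc 0 k | PrimesMod 3 q}.biUnion fun q =>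
        {m ∈ Ioc 0 (x / (2 ^ j * q ^ 2)) | PrimesMod 1 m}.image (2 ^ j * q ^ 2 * ·))
      ∪ {n ∈ Ioc 0 x | 2 ^ k ∣ n}) ∪ (Ioc k x).biUnion fun q => {n ∈ Ioc 0 x | q ^ 2 ∣ n} := by
    intro n hn
    simp only [mem_filter, mem_Ioc] at hn
    obtain ⟨j, q, m, rfl, hq, hm⟩ := exists_eq_two_pow_mul_sq_mul (by omega) hn.2
    simp only [mem_union, mem_biUnion, mem_image, mem_filter, mem_Ioc, mem_range]
    have hpos : 0 < 2 ^ j * q ^ 2 := by have := hq.pos; positivity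
    by_cases hqk : q ≤ k
    · left
      by_cases hjk : j < k
      · left
        refine ⟨j, hjk, q, ⟨⟨hq.pos, hqk⟩, hq⟩, m, ⟨⟨hm.pos, ?_⟩, hm⟩, rfl⟩
        rw [Nat.le_div_iff_mul_le hpos, mul_comm]
        exact hn.1.2
      · right
        exact ⟨hn.1, ((pow_dvd_pow 2 (by omega)).mul_right _).mul_right _⟩
    · right
      have hdvd : q ^ 2 ∣ 2 ^ j * q ^ 2 * m := (dvd_mul_left _ _).mul_right _
      refine ⟨q, ⟨by omega, ?_⟩, hn.1, hdvd⟩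
      exact ((Nat.le_self_pow two_ne_zero q).trans (Nat.le_of_dvd hn.1.1 hdvd)).trans hn.1.2
  refine (card_le_card hsub).trans ((card_union_le _ _).trans (add_le_add
    ((card_union_le _ _).trans (add_le_add ?_ ?_)) ?_))
  · exact card_biUnion_le.trans (sum_le_sum fun j _ => card_biUnion_le.trans
      (sum_le_sum fun q _ => card_image_le))
  · rw [Nat.Ioc_filter_dvd_card_eq_div]
  · exact card_biUnion_le.trans (sum_le_sum fun q _ => (Nat.Ioc_filter_dvd_card_eq_div _ _).le)

lemma countSq_le (x : ℕ) {k z : ℕ} (hk : 1 ≤ k) (hz : 1 ≤ z) :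
    (countSq x : ℝ) ≤ 0.59 * x / T z + k ^ 2 * (z * (1 + Real.log z)) ^ 2 + 2 * x / k := by
  have hT : 0 < T z := by linarith [one_le_T hz]
  have hk0 : (0 : ℝ) < k := by exact_mod_cast hk
  set E : ℝ := (z * (1 + Real.log z)) ^ 2
  have hE : 0 ≤ E := sq_nonneg _
  have hmain : ∑ j ∈ range k, ∑ q ∈ Ioc 0 k with PrimesMod 3 q,
      (#{m ∈ Ioc 0 (x / (2 ^ j * q ^ 2)) | PrimesMod 1 m} : ℝ)
        ≤ 0.59 * x / T z + k ^ 2 * E := by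
    have hgeom : ∑ j ∈ range k, (1 / (2 : ℝ)) ^ j ≤ 2 := sum_geometric_two_le k
    calc _ ≤ ∑ j ∈ range k, ∑ q ∈ Ioc 0 k with PrimesMod 3 q,
          (x / (4 * T z) * ((1 / (2 : ℝ)) ^ j * ((q : ℝ) ^ 2)⁻¹) + E) := by
          refine sum_le_sum fun j _ => sum_le_sum fun q _ =>
            (card_primesMod_one_le _ hz).trans (add_le_add ?_ le_rfl)
          have hdiv : ((x / (2 ^ j * q ^ 2) : ℕ) : ℝ) ≤ x * ((1 / (2 : ℝ)) ^ j * ((q : ℝ) ^ 2)⁻¹) := by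
            refine Nat.cast_div_le.trans (le_of_eq ?_)
            push_cast
            rw [div_eq_mul_inv, mul_inv, one_div, inv_pow]
          rw [div_mul_eq_mul_div]
          gcongr
      _ = x / (4 * T z) * ((∑ j ∈ range k, (1 / (2 : ℝ)) ^ j) *
            ∑ q ∈ Ioc 0 k with PrimesMod 3 q, ((q : ℝ) ^ 2)⁻¹)
          + k * (#{q ∈ Ioc 0 k | PrimesMod 3 q} * E) := by
          rw [sum_mul_sum, mul_sum]
          simp_rw [sum_add_distrib, mul_sum]
          simp
      _ ≤ x / (4 * T z) * (2 * 1.18) + k * (k * E) := by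
          have hcard : (#{q ∈ Ioc 0 k | PrimesMod 3 q} : ℝ) ≤ k := by
            exact_mod_cast (card_filter_le _ _).trans (by simp)
          have := sum_inv_sq_le k
          gcongr
      _ = _ := by
          field_simp
          ring
  have hpow : ((x / 2 ^ k : ℕ) : ℝ) ≤ x / k := by
    refine Nat.cast_div_le.trans ?_
    gcongr
    exact_mod_cast Nat.lt_two_pow_self.le
  have htail : ∑ q ∈ Ioc k x, ((x / q ^ 2 : ℕ) : ℝ) ≤ x / k := by
    rcases le_total k x with hkx | hkx
    · calc _ ≤ ∑ q ∈ Ioc k x, x * ((q : ℝ) ^ 2)⁻¹ := by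
            refine sum_le_sum fun q _ => Nat.cast_div_le.trans (le_of_eq ?_)
            push_cast
            rw [div_eq_mul_inv]
        _ ≤ x * ((k : ℝ)⁻¹ - (x : ℝ)⁻¹) := by
            rw [← mul_sum]
            gcongr
            exact sum_Ioc_inv_sq_le_sub (by omega) hkx
        _ ≤ x * (k : ℝ)⁻¹ := by
            gcongr
            simp
        _ = _ := (div_eq_mul_inv _ _).symm
    · rw [Ioc_eq_empty_of_le hkx, sum_empty]
      positivity
  have h := (Nat.cast_le (α := ℝ)).mpr (countSq_le_sum x k)
  push_cast at h hpow htail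
  calc _ ≤ _ := h
    _ ≤ (0.59 * x / T z + k ^ 2 * E) + x / k + x / k := by gcongr
    _ = _ := by ring

lemma eventually_countSq_le :
    ∀ᶠ x : ℕ in atTop, (countSq x : ℝ) ≤ 0.99 * x / √(Real.log x) := by
  have hcast := tendsto_natCast_atTop_atTop (R := ℝ)
  have hpow : Tendsto (fun x : ℕ => (x : ℝ) ^ (0.49 : ℝ)) atTop atTop :=
    (tendsto_rpow_atTop (by norm_num)).comp hcast
  have hT := (tendsto_nat_floor_atTop.comp hpow).eventually eventually_le_T_sq
  have hlog5 := hcast.eventually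
    ((isLittleO_log_rpow_rpow_atTop 5 (by norm_num : (0 : ℝ) < 0.02)).bound
      (by norm_num : (0 : ℝ) < 0.00025))
  have hlarge := hcast.eventually
    ((tendsto_rpow_atTop (by norm_num : (0 : ℝ) < 0.001)).eventually_ge_atTop 2)
  have hlog := (Real.tendsto_log_atTop.comp hcast).eventually_ge_atTop ((4000 : ℝ) ^ 2)
  filter_upwards [hT, hlog5, hlarge, hlog, eventually_ge_atTop 1] with x hT hlog5 hlarge hlog hx
  simp only [Function.comp_apply] at hT hlog
  set L := Real.log x with hL
  set z := ⌊(x : ℝ) ^ (0.49 : ℝ)⌋₊ with hz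
  have hx1 : (1 : ℝ) ≤ x := by exact_mod_cast hx
  have hx0 : (0 : ℝ) < x := by linarith
  have hL0 : 0 < L := by linarith
  set s := √L with hs
  have hsL : s ^ 2 = L := Real.sq_sqrt hL0.le
  have hs4 : 4000 ≤ s := Real.le_sqrt_of_sq_le hlog
  have hz1 : 1 ≤ z := Nat.le_floor (by simpa using Real.one_le_rpow hx1 (by norm_num))
  have hk1 : 1 ≤ ⌊L⌋₊ := Nat.le_floor (by push_cast; linarith)
  have hzle : (z : ℝ) ≤ (x : ℝ) ^ (0.49 : ℝ) := Nat.floor_le (by positivity)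
  have hlogz : 0.489 * L ≤ Real.log z := by
    rw [hL, ← Real.log_rpow hx0]
    refine Real.log_le_log (by positivity) ?_
    have h1 : (x : ℝ) ^ (0.49 : ℝ) = x ^ (0.489 : ℝ) * x ^ (0.001 : ℝ) := by
      rw [← Real.rpow_add hx0]
      norm_num
    have h2 : 1 ≤ (x : ℝ) ^ (0.489 : ℝ) := Real.one_le_rpow hx1 (by norm_num)
    have h3 := Nat.lt_floor_add_one ((x : ℝ) ^ (0.49 : ℝ))
    have h4 : (x : ℝ) ^ (0.489 : ℝ) + 1 ≤ (x : ℝ) ^ (0.49 : ℝ) := by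
      rw [h1]
      nlinarith
    rw [← hz] at h3
    linarith
  have hlogz' : Real.log z ≤ L :=
    Real.log_le_log (by exact_mod_cast hz1) (hzle.trans
      ((Real.rpow_le_rpow_of_exponent_le hx1 (by norm_num : (0.49 : ℝ) ≤ 1)).trans_eq
        (Real.rpow_one _)))
  have hlogz0 : 0 ≤ Real.log z := Real.log_natCast_nonneg z
  have hTs : 0.5974 * s ≤ T z := by
    refine le_of_sq_le_sq ?_ (T_nonneg z)
    rw [mul_pow, hsL]
    linarith
  have hmain : 0.59 * x / T z ≤ 0.988 * (x / s) := by
    rw [← mul_div_assoc, div_le_div_iff₀ (by linarith) (by linarith)]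
    nlinarith
  have herr : (⌊L⌋₊ : ℝ) ^ 2 * (z * (1 + Real.log z)) ^ 2 ≤ 0.001 * (x / s) := by
    have h5 : L ^ 5 ≤ 0.00025 * (x : ℝ) ^ (0.02 : ℝ) := by
      rw [Real.norm_of_nonneg (by positivity), Real.norm_of_nonneg (by positivity)] at hlog5
      exact_mod_cast hlog5
    have hxx : (x : ℝ) ^ (0.02 : ℝ) * ((x : ℝ) ^ (0.49 : ℝ)) ^ 2 = x := by
      rw [← Real.rpow_natCast, ← Real.rpow_mul hx0.le, ← Real.rpow_add hx0]
      norm_num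
    rw [← mul_div_assoc, le_div_iff₀ (by linarith)]
    calc _ ≤ L ^ 2 * ((x : ℝ) ^ (0.49 : ℝ) * (L + L)) ^ 2 * L := by
          gcongr
          · exact Nat.floor_le hL0.le
          · linarith
          · nlinarith
      _ = 4 * L ^ 5 * ((x : ℝ) ^ (0.49 : ℝ)) ^ 2 := by ring
      _ ≤ 4 * (0.00025 * (x : ℝ) ^ (0.02 : ℝ)) * ((x : ℝ) ^ (0.49 : ℝ)) ^ 2 := by gcongr
      _ = 0.001 * ((x : ℝ) ^ (0.02 : ℝ) * ((x : ℝ) ^ (0.49 : ℝ)) ^ 2) := by ring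
      _ = _ := by rw [hxx]
  have htail : 2 * x / (⌊L⌋₊ : ℝ) ≤ 0.001 * (x / s) := by
    have h1 := Nat.lt_floor_add_one L
    rw [← mul_div_assoc, div_le_div_iff₀ (by exact_mod_cast hk1) (by linarith)]
    have : 2 * s ≤ 0.001 * (⌊L⌋₊ : ℝ) := by nlinarith
    nlinarith
  calc _ ≤ _ := countSq_le x hk1 hz1
    _ ≤ 0.988 * (x / s) + 0.001 * (x / s) + 0.001 * (x / s) := by gcongr
    _ = _ := by ring

lemma count_le (v : ℕ) : Nat.count IsSumTwoSquares v ≤ countSq v + 1 := by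
  rw [Nat.count_eq_card_filter_range, countSq]
  refine (card_le_card (t := insert 0 {n ∈ Ioc 0 v | IsSumTwoSquares n}) fun n hn => ?_).trans
    (card_insert_le _ _)
  simp only [mem_filter, mem_range, mem_insert, mem_Ioc] at hn ⊢
  rcases Nat.eq_zero_or_pos n with h | h
  · exact Or.inl h
  · exact Or.inr ⟨⟨h, hn.1.le⟩, hn.2⟩

lemma eventually_count_lt : ∀ᶠ N : ℕ in atTop, ∀ v : ℕ, (v : ℝ) ≤ 10 * N * √(Real.log N) →
    Nat.count IsSumTwoSquares v + 1 ≤ 10 * N := by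
  have hlog := (Real.tendsto_log_atTop.comp
    (tendsto_natCast_atTop_atTop (R := ℝ))).eventually_ge_atTop 1
  obtain ⟨M, hM⟩ := eventually_atTop.mp eventually_countSq_le
  filter_upwards [hlog, eventually_ge_atTop M, eventually_ge_atTop 20] with N hlog hNM hN v hv
  simp only [Function.comp_apply] at hlog
  have hs : 1 ≤ √(Real.log N) := Real.one_le_sqrt.mpr hlog
  have hN0 : (20 : ℝ) ≤ N := by exact_mod_cast hN
  set x := ⌊10 * N * √(Real.log N)⌋₊
  have hx : (x : ℝ) ≤ 10 * N * √(Real.log N) := Nat.floor_le (by positivity)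
  have hNx : N ≤ x := Nat.le_floor (by nlinarith)
  have hvx : countSq v ≤ countSq x :=
    card_le_card (filter_subset_filter _ (Ioc_subset_Ioc_right (Nat.le_floor hv)))
  have hcount : (countSq x : ℝ) ≤ 9.9 * N := by
    refine (hM x (hNM.trans hNx)).trans ?_
    have hlogx : √(Real.log N) ≤ √(Real.log x) :=
      Real.sqrt_le_sqrt (Real.log_le_log (by linarith) (by exact_mod_cast hNx))
    rw [div_le_iff₀ (by linarith)]
    nlinarith
  have h1 : (Nat.count IsSumTwoSquares v : ℝ) ≤ countSq x + 1 := by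
    exact_mod_cast (count_le v).trans (by omega)
  have : (Nat.count IsSumTwoSquares v : ℝ) + 1 ≤ 10 * N := by linarith
  exact_mod_cast this

lemma a_count {v : ℕ} (hv : IsSumTwoSquares v) : a (Nat.count IsSumTwoSquares v + 1) = v := by
  rw [a, Nat.add_sub_cancel, Nat.nth_count hv]

lemma sum_b_mul_b_le_R {N M v : ℕ} (hv : 0 < v)
    (h : ∀ w ≤ M + v, Nat.count IsSumTwoSquares w + 1 ≤ N) :
    ∑ m ∈ Icc 1 M, b m * b (m + v) ≤ R N v := by
  have hsum : ∑ m ∈ Icc 1 M, b m * b (m + v)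
      = #{m ∈ Icc 1 M | IsSumTwoSquares m ∧ IsSumTwoSquares (m + v)} := by
    rw [card_filter]
    refine sum_congr rfl fun m _ => ?_
    by_cases h1 : IsSumTwoSquares m <;> by_cases h2 : IsSumTwoSquares (m + v) <;> simp [b, h1, h2]
  rw [hsum, R]
  refine card_le_card_of_injOn
    (fun m => (Nat.count IsSumTwoSquares m + 1, Nat.count IsSumTwoSquares (m + v) + 1)) ?_ ?_
  · intro m hm
    simp only [coe_filter, Set.mem_ofPred_eq, mem_Icc] at hm
    simp only [coe_filter, Set.mem_ofPred_eq, mem_product, mem_Icc, a_count hm.2.1, a_count hm.2.2]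
    refine ⟨⟨⟨by omega, h m (by omega)⟩, by omega, h (m + v) (by omega)⟩, ?_, by omega⟩
    exact Nat.succ_lt_succ (Nat.count_strict_mono hm.2.1 (by omega))
  · intro m hm m' hm' heq
    simp only [coe_filter, Set.mem_ofPred_eq] at hm hm'
    exact Nat.count_injective hm.2.1 hm'.2.1 (Nat.succ_injective (Prod.mk.inj heq).1)

end LandauUpper

/-- For all sufficiently large `N` and every `n ≥ 2` with
`n (log n)^{5/8} ≤ 5N√(log N)`, one has `Σ_{k ≤ (log n)^{5/8}} R_{10N}(nk) ≥ G(n)`. -/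
theorem sum_R_ge_G :
    ∀ᶠ N : ℕ in atTop, ∀ n : ℕ, 2 ≤ n →
      (n : ℝ) * Real.log n ^ ((5:ℝ)/8) ≤ 5 * N * Real.sqrt (Real.log N) →
      G n ≤ ∑ k ∈ Finset.Icc 1 ⌊Real.log n ^ ((5:ℝ)/8)⌋₊, R (10 * N) (n * k) := by
  filter_upwards [LandauUpper.eventually_count_lt] with N hN n hn hle
  have hpow : 0 ≤ Real.log n ^ ((5:ℝ)/8) := Real.rpow_nonneg (Real.log_natCast_nonneg n) _
  refine sum_le_sum fun k hk => ?_
  rw [mem_Icc] at hk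
  refine LandauUpper.sum_b_mul_b_le_R (Nat.mul_pos (by omega) (by omega)) fun w hw => hN w ?_
  have hk' : (k : ℝ) ≤ Real.log n ^ ((5:ℝ)/8) := (Nat.le_floor_iff hpow).mp hk.2
  have hM : (⌊(n : ℝ) * Real.log n ^ ((5:ℝ)/8)⌋₊ : ℝ) ≤ n * Real.log n ^ ((5:ℝ)/8) :=
    Nat.floor_le (by positivity)
  have hnk : (n : ℝ) * k ≤ n * Real.log n ^ ((5:ℝ)/8) := by gcongr
  have hw' : (w : ℝ) ≤ (⌊(n : ℝ) * Real.log n ^ ((5:ℝ)/8)⌋₊ : ℝ) + n * k := by exact_mod_cast hw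
  linarith
end
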